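/- Fix p ≥ 2n−1 and set Λ_p = sup{λ_{1,p}(γ) : γ ∈ R_h}. Then there exists a curve α ∈ R_h^+ such that λ_{1,p}(α) = Λ_p, u∘α is monotonically increasing over [0,1], and r∘α is monotonically decreasing over [0,1]. -/

import Mathlib

open Set MeasureTheory Filter Topology

noncomputable section

/-- The closed quarter plane `P`. -/
def Pset : Set (ℝ × ℝ) := {z | 0 ≤ z.1 ∧ 0 ≤ z.2}

/-- The interior `P°` of the quarter plane. -/
def Pint : Set (ℝ × ℝ) := {z | 0 < z.1 ∧ 0 < z.2}

/-- The boundary `∂P` of the quarter plane. -/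
def Pbdry : Set (ℝ × ℝ) := {z | (0 ≤ z.1 ∧ 0 ≤ z.2) ∧ (z.1 = 0 ∨ z.2 = 0)}

/-- `F(x,y) = c_n x^(n-1) y^(n-1)`. -/
def Fvol (n : ℕ) (cn : ℝ) (z : ℝ × ℝ) : ℝ := cn * z.1 ^ (n - 1) * z.2 ^ (n - 1)

/-- Euclidean speed of a curve at `t`, computed with derivatives within `s`. -/
def gSpeedOn (s : Set ℝ) (α : ℝ → ℝ × ℝ) (t : ℝ) : ℝ :=
  Real.sqrt ((derivWithin (fun u => (α u).1) s t) ^ 2 + (derivWithin (fun u => (α u).2) s t) ^ 2)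

/-- Euclidean speed of a curve defined on `[0,1]`. -/
def gSpeed (α : ℝ → ℝ × ℝ) : ℝ → ℝ := gSpeedOn (Icc 0 1) α

/-- Euclidean length `L_g` of a curve on `[0,1]`. -/
def Lg (α : ℝ → ℝ × ℝ) : ℝ := ∫ t in (0:ℝ)..1, gSpeed α t

/-- The `h`-speed `|γ'|_h = F(γ) |γ'|_g`, with derivatives within `s`. -/
def hSpeedOn (n : ℕ) (cn : ℝ) (s : Set ℝ) (α : ℝ → ℝ × ℝ) (t : ℝ) : ℝ :=
  Fvol n cn (α t) * gSpeedOn s α t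

/-- The `h`-speed for curves defined on `[0,1)`. -/
def hSpeed (n : ℕ) (cn : ℝ) (α : ℝ → ℝ × ℝ) : ℝ → ℝ := hSpeedOn n cn (Ico 0 1) α

/-- The `h`-length `L_h` of a curve on `[0,1)`. -/
def Lh (n : ℕ) (cn : ℝ) (α : ℝ → ℝ × ℝ) : ℝ := ∫ t in (0:ℝ)..1, hSpeed n cn α t

/-- Numerator integrand of the `g`-Rayleigh quotient:
`|w'(t)|^p F(α t) |α'(t)|_g^(1-p)`. -/
def numG (n : ℕ) (cn p : ℝ) (s : Set ℝ) (α : ℝ → ℝ × ℝ) (w : ℝ → ℝ) (t : ℝ) : ℝ :=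
  |derivWithin w (Icc 0 1) t| ^ p * Fvol n cn (α t) * gSpeedOn s α t ^ (1 - p)

/-- Denominator integrand of the `g`-Rayleigh quotient:
`|w(t)|^p F(α t) |α'(t)|_g`. -/
def denG (n : ℕ) (cn p : ℝ) (s : Set ℝ) (α : ℝ → ℝ × ℝ) (w : ℝ → ℝ) (t : ℝ) : ℝ :=
  |w t| ^ p * Fvol n cn (α t) * gSpeedOn s α t

/-- First Dirichlet eigenvalue of the `p`-Laplacian along a curve, `g`-form:
infimum of the Rayleigh quotient over Lipschitz test functions on `[0,1]`
vanishing at `0` (with admissible, i.e. integrable with positive denominator,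
Rayleigh quotients). -/
def lambdaGOn (n : ℕ) (cn p : ℝ) (s : Set ℝ) (α : ℝ → ℝ × ℝ) : ℝ :=
  sInf {q | ∃ w : ℝ → ℝ, (∃ K, LipschitzOnWith K w (Icc 0 1)) ∧ w 0 = 0 ∧
    IntervalIntegrable (numG n cn p s α w) volume 0 1 ∧
    IntervalIntegrable (denG n cn p s α w) volume 0 1 ∧
    (0 < ∫ t in (0:ℝ)..1, denG n cn p s α w t) ∧
    q = (∫ t in (0:ℝ)..1, numG n cn p s α w t) / (∫ t in (0:ℝ)..1, denG n cn p s α w t)}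

/-- `λ_{1,p}` in the `g`-form for curves on `[0,1]`. -/
def lambdaG (n : ℕ) (cn p : ℝ) (α : ℝ → ℝ × ℝ) : ℝ := lambdaGOn n cn p (Icc 0 1) α

/-- Numerator integrand of the `h`-Rayleigh quotient on `[c,d]`:
`|w'(t)|^p F(γ t)^p |γ'(t)|_h^(1-p)`. -/
def numH (n : ℕ) (cn p c d : ℝ) (s : Set ℝ) (γ : ℝ → ℝ × ℝ) (w : ℝ → ℝ) (t : ℝ) : ℝ :=
  |derivWithin w (Icc c d) t| ^ p * Fvol n cn (γ t) ^ p * hSpeedOn n cn s γ t ^ (1 - p)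

/-- Denominator integrand of the `h`-Rayleigh quotient: `|w(t)|^p |γ'(t)|_h`. -/
def denH (n : ℕ) (cn p : ℝ) (s : Set ℝ) (γ : ℝ → ℝ × ℝ) (w : ℝ → ℝ) (t : ℝ) : ℝ :=
  |w t| ^ p * hSpeedOn n cn s γ t

/-- `λ_{1,p}` in the `h`-form for a curve on `[c,d)`, with test functions
Lipschitz on `[c,d]` vanishing at `c`. -/
def lambdaHOn (n : ℕ) (cn p c d : ℝ) (s : Set ℝ) (γ : ℝ → ℝ × ℝ) : ℝ :=
  sInf {q | ∃ w : ℝ → ℝ, (∃ K, LipschitzOnWith K w (Icc c d)) ∧ w c = 0 ∧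
    IntervalIntegrable (numH n cn p c d s γ w) volume c d ∧
    IntervalIntegrable (denH n cn p s γ w) volume c d ∧
    (0 < ∫ t in c..d, denH n cn p s γ w t) ∧
    q = (∫ t in c..d, numH n cn p c d s γ w t) / (∫ t in c..d, denH n cn p s γ w t)}

/-- `λ_{1,p}` in the `h`-form for curves on `[0,1)`. -/
def lambdaH (n : ℕ) (cn p : ℝ) (γ : ℝ → ℝ × ℝ) : ℝ :=
  lambdaHOn n cn p 0 1 (Ico 0 1) γ

/-- The class `𝒞` of `C¹` curves from `(x₀,y₀)` to the boundary, with constant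
speed, interior image on `[0,1)`, endpoint away from the origin, and meeting the
boundary orthogonally. -/
def MemC (x0 y0 : ℝ) (α : ℝ → ℝ × ℝ) : Prop :=
  ContDiffOn ℝ 1 α (Icc 0 1) ∧
  α 0 = (x0, y0) ∧
  (∀ t ∈ Ico (0:ℝ) 1, α t ∈ Pint) ∧
  α 1 ∈ Pbdry ∧ α 1 ≠ ((0 : ℝ), (0 : ℝ)) ∧
  (∀ t ∈ Icc (0:ℝ) 1, gSpeed α t = Lg α) ∧
  ((α 1).1 = 0 → derivWithin (fun u => (α u).2) (Icc 0 1) 1 = 0) ∧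
  ((α 1).2 = 0 → derivWithin (fun u => (α u).1) (Icc 0 1) 1 = 0)

/-- The Simons cone curve `σ(t) = (1-t)·(R,R)`. -/
def simonsCurve (R : ℝ) : ℝ → ℝ × ℝ := fun t => ((1 - t) * R, (1 - t) * R)

/-- The class `R_h`: locally Lipschitz curves on `[0,1)` with image in `P°`,
starting at `(x₀,y₀)`, with essentially bounded `h`-speed, reaching the collapsed
boundary point as `t → 1` (i.e. `x(γ t)·y(γ t) → 0`). -/
def MemRh (n : ℕ) (cn x0 y0 : ℝ) (γ : ℝ → ℝ × ℝ) : Prop :=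
  γ 0 = (x0, y0) ∧
  (∀ t ∈ Ico (0:ℝ) 1, γ t ∈ Pint) ∧
  (∀ a ∈ Ico (0:ℝ) 1, ∃ K, LipschitzOnWith K γ (Icc 0 a)) ∧
  (∃ M : ℝ, ∀ᵐ t ∂(volume : Measure ℝ), t ∈ Ico (0:ℝ) 1 → hSpeed n cn γ t ≤ M) ∧
  Tendsto (fun t => (γ t).1 * (γ t).2) (𝓝[<] (1:ℝ)) (𝓝 0)

/-- The class `R_h^+`: continuous curves on `[0,1]` into `P` ending on `∂P`
whose restriction to `[0,1)` belongs to `R_h`. -/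
def MemRhPlus (n : ℕ) (cn x0 y0 : ℝ) (α : ℝ → ℝ × ℝ) : Prop :=
  ContinuousOn α (Icc 0 1) ∧ (∀ t ∈ Icc (0:ℝ) 1, α t ∈ Pset) ∧ α 1 ∈ Pbdry ∧
  MemRh n cn x0 y0 α

/-- The class `R_g`: Lipschitz curves on `[0,1]` from `(x₀,y₀)` to `∂P` with
interior image on `[0,1)`. -/
def MemRg (x0 y0 : ℝ) (α : ℝ → ℝ × ℝ) : Prop :=
  (∃ K, LipschitzOnWith K α (Icc 0 1)) ∧ α 0 = (x0, y0) ∧ α 1 ∈ Pbdry ∧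
  ∀ t ∈ Ico (0:ℝ) 1, α t ∈ Pint

/-- The coordinate `u(x,y) = (x² - y²)/2`. -/
def ucoord (z : ℝ × ℝ) : ℝ := (z.1 ^ 2 - z.2 ^ 2) / 2

/-- The coordinate `v(x,y) = xy`. -/
def vcoord (z : ℝ × ℝ) : ℝ := z.1 * z.2

/-- The coordinate `r = √(u² + v²)`. -/
def rcoord (z : ℝ × ℝ) : ℝ := Real.sqrt (ucoord z ^ 2 + vcoord z ^ 2)

/-- The class `R_g^*`: simple curves in `R_g` with a.e. constant speed,
`u(α(1)) > 0`, and `v(α(t)) ≥ c(1-t)` for some `c > 0`. -/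
def MemRgStar (x0 y0 : ℝ) (α : ℝ → ℝ × ℝ) : Prop :=
  MemRg x0 y0 α ∧ InjOn α (Icc 0 1) ∧
  (∀ᵐ t ∂(volume : Measure ℝ), t ∈ Icc (0:ℝ) 1 → gSpeed α t = Lg α) ∧
  0 < ucoord (α 1) ∧
  ∃ c > (0:ℝ), ∀ t ∈ Icc (0:ℝ) 1, c * (1 - t) ≤ vcoord (α t)

/-! ### Lipschitz functions on subsets of the line -/

/-- `f` is Lipschitz on `S` with some real constant. -/
def IsLip (f : ℝ → ℝ) (S : Set ℝ) : Prop :=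
  ∃ C, 0 ≤ C ∧ ∀ s ∈ S, ∀ t ∈ S, |f s - f t| ≤ C * |s - t|

theorem isLip_of_lipschitzOnWith {f : ℝ → ℝ} {S : Set ℝ} {K : NNReal}
    (h : LipschitzOnWith K f S) : IsLip f S :=
  ⟨K, K.2, fun s hs t ht => by simpa [Real.dist_eq] using h.dist_le_mul s hs t ht⟩

theorem IsLip.lipschitzOnWith {f : ℝ → ℝ} {S : Set ℝ} (h : IsLip f S) :
    ∃ K, LipschitzOnWith K f S := by
  obtain ⟨C, hC, h⟩ := h
  exact ⟨⟨C, hC⟩, LipschitzOnWith.of_dist_le_mul fun s hs t ht => h s hs t ht⟩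

theorem IsLip.mono {f : ℝ → ℝ} {S T : Set ℝ} (h : IsLip f T) (hST : S ⊆ T) : IsLip f S := by
  obtain ⟨C, hC, h⟩ := h
  exact ⟨C, hC, fun s hs t ht => h s (hST hs) t (hST ht)⟩

theorem IsLip.continuousOn {f : ℝ → ℝ} {S : Set ℝ} (h : IsLip f S) : ContinuousOn f S := by
  obtain ⟨K, h⟩ := h.lipschitzOnWith
  exact h.continuousOn

theorem IsLip.neg {f : ℝ → ℝ} {S : Set ℝ} (h : IsLip f S) : IsLip (fun t => -f t) S := by
  obtain ⟨C, hC, h⟩ := h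
  refine ⟨C, hC, fun s hs t ht => ?_⟩
  rw [neg_sub_neg, abs_sub_comm]
  exact h s hs t ht

theorem IsLip.const_mul {f : ℝ → ℝ} {S : Set ℝ} (c : ℝ) (h : IsLip f S) :
    IsLip (fun t => c * f t) S := by
  obtain ⟨C, hC, h⟩ := h
  refine ⟨|c| * C, by positivity, fun s hs t ht => ?_⟩
  rw [← mul_sub, abs_mul, mul_assoc]
  exact mul_le_mul_of_nonneg_left (h s hs t ht) (abs_nonneg c)

theorem IsLip.add {f g : ℝ → ℝ} {S : Set ℝ} (hf : IsLip f S) (hg : IsLip g S) :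
    IsLip (fun t => f t + g t) S := by
  obtain ⟨C, hC, hf⟩ := hf
  obtain ⟨D, hD, hg⟩ := hg
  refine ⟨C + D, by positivity, fun s hs t ht => ?_⟩
  calc |f s + g s - (f t + g t)| = |(f s - f t) + (g s - g t)| := by ring_nf
    _ ≤ |f s - f t| + |g s - g t| := abs_add_le _ _
    _ ≤ _ := by rw [add_mul]; exact add_le_add (hf s hs t ht) (hg s hs t ht)

theorem IsLip.sub {f g : ℝ → ℝ} {S : Set ℝ} (hf : IsLip f S) (hg : IsLip g S) :
    IsLip (fun t => f t - g t) S := by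
  simpa [sub_eq_add_neg] using hf.add hg.neg

theorem IsLip.abs {f : ℝ → ℝ} {S : Set ℝ} (h : IsLip f S) : IsLip (fun t => |f t|) S := by
  obtain ⟨C, hC, h⟩ := h
  exact ⟨C, hC, fun s hs t ht => (abs_abs_sub_abs_le _ _).trans (h s hs t ht)⟩

/-- The composition of a function which is Lipschitz on the compact image with a Lipschitz
function, expressed through a pointwise bound on increments. -/
theorem IsLip.of_le {f g : ℝ → ℝ} {S : Set ℝ} (hg : IsLip g S) {D : ℝ} (hD : 0 ≤ D)
    (h : ∀ s ∈ S, ∀ t ∈ S, |f s - f t| ≤ D * |g s - g t|) : IsLip f S := by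
  obtain ⟨C, hC, hg⟩ := hg
  refine ⟨D * C, by positivity, fun s hs t ht => (h s hs t ht).trans ?_⟩
  rw [mul_assoc]
  exact mul_le_mul_of_nonneg_left (hg s hs t ht) hD

theorem IsLip.mul {f g : ℝ → ℝ} {S : Set ℝ} (hS : IsCompact S) (hf : IsLip f S)
    (hg : IsLip g S) : IsLip (fun t => f t * g t) S := by
  obtain ⟨A, hA⟩ := hS.exists_bound_of_continuousOn hf.continuousOn
  obtain ⟨B, hB⟩ := hS.exists_bound_of_continuousOn hg.continuousOn
  obtain ⟨C, hC, hf⟩ := hf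
  obtain ⟨D, hD, hg⟩ := hg
  refine ⟨|A| * D + |B| * C, by positivity, fun s hs t ht => ?_⟩
  have h1 : |f s| ≤ |A| := (hA s hs).trans (le_abs_self A)
  have h2 : |g t| ≤ |B| := (hB t ht).trans (le_abs_self B)
  calc |f s * g s - f t * g t| = |f s * (g s - g t) + g t * (f s - f t)| := by ring_nf
    _ ≤ |f s| * |g s - g t| + |g t| * |f s - f t| := by
        rw [← abs_mul, ← abs_mul]; exact abs_add_le _ _
    _ ≤ |A| * (D * |s - t|) + |B| * (C * |s - t|) := by
        gcongr
        · exact hg s hs t ht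
        · exact hf s hs t ht
    _ = _ := by ring

theorem IsCompact.exists_pos_forall_le {f : ℝ → ℝ} {S : Set ℝ} (hS : IsCompact S)
    (hf : ContinuousOn f S) (hpos : ∀ s ∈ S, 0 < f s) : ∃ δ > 0, ∀ s ∈ S, δ ≤ f s := by
  rcases S.eq_empty_or_nonempty with rfl | hne
  · exact ⟨1, one_pos, by simp⟩
  · obtain ⟨x, hx, h⟩ := hS.exists_isMinOn hne hf
    exact ⟨f x, hpos x hx, fun s hs => h hs⟩

theorem IsLip.inv {f : ℝ → ℝ} {S : Set ℝ} (hS : IsCompact S) (hf : IsLip f S)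
    (hpos : ∀ s ∈ S, 0 < f s) : IsLip (fun t => (f t)⁻¹) S := by
  obtain ⟨δ, hδ, h⟩ := hS.exists_pos_forall_le hf.continuousOn hpos
  refine hf.of_le (D := (δ * δ)⁻¹) (by positivity) fun s hs t ht => ?_
  have h1 := hpos s hs
  have h2 := hpos t ht
  rw [inv_sub_inv h1.ne' h2.ne', abs_div, abs_sub_comm, abs_of_pos (mul_pos h1 h2), div_eq_inv_mul]
  gcongr
  · exact h s hs
  · exact h t ht

theorem IsLip.sqrt {f : ℝ → ℝ} {S : Set ℝ} (hS : IsCompact S) (hf : IsLip f S)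
    (hpos : ∀ s ∈ S, 0 < f s) : IsLip (fun t => √(f t)) S := by
  obtain ⟨δ, hδ, h⟩ := hS.exists_pos_forall_le hf.continuousOn hpos
  refine hf.of_le (D := (√δ)⁻¹) (by positivity) fun s hs t ht => ?_
  have hs1 : √δ ≤ √(f s) := Real.sqrt_le_sqrt (h s hs)
  have ht0 : 0 ≤ √(f t) := Real.sqrt_nonneg _
  have hd : 0 < √δ := Real.sqrt_pos.2 hδ
  have e : f s - f t = (√(f s) - √(f t)) * (√(f s) + √(f t)) := by
    have a1 := Real.mul_self_sqrt (hpos s hs).le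
    have a2 := Real.mul_self_sqrt (hpos t ht).le
    linear_combination -a1 + a2
  rw [e, abs_mul, abs_of_nonneg (a := √(f s) + √(f t)) (by positivity), le_inv_mul_iff₀ hd,
    mul_comm]
  gcongr
  linarith

/-- `f` is Lipschitz on every `[0,a]` with `a < 1`. -/
def LocLip (f : ℝ → ℝ) : Prop := ∀ a ∈ Ico (0 : ℝ) 1, IsLip f (Icc 0 a)

theorem LocLip.continuousOn {f : ℝ → ℝ} (h : LocLip f) : ContinuousOn f (Ico 0 1) := by
  intro t ht
  obtain ⟨a, hta, ha⟩ := exists_between ht.2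
  have := (h a ⟨ht.1.trans hta.le, ha⟩).continuousOn t ⟨ht.1, hta.le⟩
  refine this.mono_of_mem_nhdsWithin ?_
  filter_upwards [self_mem_nhdsWithin, mem_nhdsWithin_of_mem_nhds (Iio_mem_nhds hta)] with x hx hx'
  exact ⟨hx.1, le_of_lt hx'⟩

theorem IsLip.ae_differentiableAt {f : ℝ → ℝ} {a b : ℝ} (h : IsLip f (Icc a b)) :
    ∀ᵐ t, t ∈ Ioo a b → DifferentiableAt ℝ f t := by
  obtain ⟨K, h⟩ := h.lipschitzOnWith
  filter_upwards [h.ae_differentiableWithinAt_of_mem_real] with t ht hab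
  exact (ht (Ioo_subset_Icc_self hab)).differentiableAt (Icc_mem_nhds hab.1 hab.2)

theorem LocLip.ae_differentiableAt {f : ℝ → ℝ} (h : LocLip f) :
    ∀ᵐ t, t ∈ Ioo (0 : ℝ) 1 → DifferentiableAt ℝ f t := by
  have : ∀ n : ℕ, ∀ᵐ t, t ∈ Ioo (0 : ℝ) (1 - 1 / ((n : ℝ) + 1)) → DifferentiableAt ℝ f t := by
    intro n
    refine (h (1 - 1 / ((n : ℝ) + 1)) ⟨?_, ?_⟩).ae_differentiableAt
    · rw [sub_nonneg, div_le_one (by positivity)]; linarith [Nat.cast_nonneg (α := ℝ) n]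
    · have : 0 < 1 / ((n : ℝ) + 1) := by positivity
      linarith
  filter_upwards [ae_all_iff.2 this] with t ht hab
  obtain ⟨n, hn⟩ := exists_nat_one_div_lt (sub_pos.2 hab.2)
  exact ht n ⟨hab.1, by linarith⟩

/-- A Lipschitz function with a.e. nonnegative derivative does not decrease. -/
theorem IsLip.le_of_deriv_nonneg {f : ℝ → ℝ} {a b : ℝ} (hab : a ≤ b) (h : IsLip f (Icc a b))
    (hd : ∀ᵐ t, t ∈ Ioo a b → 0 ≤ deriv f t) : f a ≤ f b := by
  obtain ⟨K, h⟩ := h.lipschitzOnWith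
  rw [← uIcc_of_le hab] at h
  have := h.absolutelyContinuousOnInterval.integral_deriv_eq_sub
  have h0 : 0 ≤ ∫ x in a..b, deriv f x := by
    rw [intervalIntegral.integral_of_le hab, integral_Ioc_eq_integral_Ioo]
    refine integral_nonneg_of_ae ?_
    exact (ae_restrict_iff' measurableSet_Ioo).2 hd
  linarith

/-! ### Change of variables along monotone Lipschitz functions -/

theorem LipschitzWith.volume_image_eq_zero {f : ℝ → ℝ} {K : NNReal} (h : LipschitzWith K f)
    {N : Set ℝ} (hN : volume N = 0) : volume (f '' N) = 0 := by
  have := (h.lipschitzOnWith (s := N)).hausdorffMeasure_image_le (d := 1) zero_le_one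
  rw [hausdorffMeasure_real, hN, mul_zero] at this
  exact le_antisymm this zero_le

theorem lintegral_image_of_monotone {f : ℝ → ℝ} {K : NNReal} (h : LipschitzWith K f)
    (hm : Monotone f) {s : Set ℝ} (hs : MeasurableSet s) (G : ℝ → ENNReal) :
    ∫⁻ x in f '' s, G x = ∫⁻ t in s, ENNReal.ofReal (deriv f t) * G (f t) := by
  set D := {t | DifferentiableAt ℝ f t}
  have hD : MeasurableSet D := measurableSet_of_differentiableAt ℝ f
  have hDc : volume Dᶜ = 0 := h.ae_differentiableAt_real
  have h1 := lintegral_image_eq_lintegral_deriv_mul_of_monotoneOn (hs.inter hD)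
    (fun x hx => hx.2.hasDerivAt.hasDerivWithinAt) (hm.monotoneOn _) G
  have h2 : f '' s =ᵐ[volume] f '' (s ∩ D) := by
    have hsub : f '' s ⊆ f '' (s ∩ D) ∪ f '' Dᶜ := by
      rintro _ ⟨x, hx, rfl⟩
      by_cases hxD : x ∈ D
      · exact Or.inl ⟨x, ⟨hx, hxD⟩, rfl⟩
      · exact Or.inr ⟨x, hxD, rfl⟩
    refine (ae_le_set.2 ?_).antisymm (Eventually.of_forall (image_mono inter_subset_left))
    refine measure_mono_null ?_ (h.volume_image_eq_zero hDc)
    intro x hx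
    exact (hsub hx.1).resolve_left hx.2
  have h3 : (s ∩ D : Set ℝ) =ᵐ[volume] s := by
    refine inter_ae_eq_left_of_ae_eq_univ ?_
    exact ae_eq_univ.2 hDc
  rw [setLIntegral_congr h2, h1, setLIntegral_congr h3]

theorem ae_deriv_eq_zero_of_mem_null {f : ℝ → ℝ} {K : NNReal} (h : LipschitzWith K f)
    (hm : Monotone f) {P : ℝ → Prop} (hP : ∀ᵐ x, P x) : ∀ᵐ t, P (f t) ∨ deriv f t = 0 := by
  set N := toMeasurable volume {x | ¬ P x}
  have hN : volume N = 0 := by rw [measure_toMeasurable]; exact hP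
  have hNm : MeasurableSet N := measurableSet_toMeasurable _ _
  have h1 := lintegral_image_of_monotone h hm MeasurableSet.univ (N.indicator 1)
  have h0 : ∫⁻ x in f '' univ, N.indicator 1 x = 0 := by
    refine le_antisymm ((setLIntegral_le_lintegral _ _).trans ?_) zero_le
    rw [lintegral_indicator_one hNm, hN]
  rw [h0, Measure.restrict_univ, eq_comm, lintegral_eq_zero_iff] at h1
  · filter_upwards [h1] with t ht
    by_contra! hcon
    have hmem : f t ∈ N := subset_toMeasurable _ _ hcon.1
    have hd : 0 ≤ deriv f t := hm.deriv_nonneg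
    simp only [Pi.zero_apply, mul_eq_zero, ENNReal.ofReal_eq_zero, indicator_of_mem hmem,
      Pi.one_apply, one_ne_zero, or_false] at ht
    exact hcon.2 (le_antisymm ht hd)
  · exact (measurable_deriv f).ennreal_ofReal.mul
      ((measurable_one.indicator hNm).comp h.continuous.measurable)

theorem ae_deriv_comp {f g : ℝ → ℝ} {K K' : NNReal} (h : LipschitzWith K f)
    (hm : Monotone f) (hg : LipschitzWith K' g) :
    ∀ᵐ t, deriv (fun x => g (f x)) t = deriv g (f t) * deriv f t := by
  filter_upwards [ae_deriv_eq_zero_of_mem_null h hm hg.ae_differentiableAt_real,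
    h.ae_differentiableAt_real] with t ht hft
  rcases ht with ht | ht
  · exact deriv_comp t ht hft
  · rw [ht, mul_zero]
    refine HasDerivAt.deriv ?_
    have hf0 : HasDerivAt f 0 t := by simpa [ht] using hft.hasDerivAt
    rw [hasDerivAt_iff_isLittleO] at hf0 ⊢
    refine Asymptotics.IsBigO.trans_isLittleO (g := fun x => f x - f t - (x - t) • (0 : ℝ)) ?_ hf0
    refine Asymptotics.IsBigO.of_bound K' (Eventually.of_forall fun x => ?_)
    simpa [Real.dist_eq] using hg.dist_le_mul (f x) (f t)

/-! ### Running maxima -/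

/-- The running maximum of `f` on `[0,t]`. -/
def runMax (f : ℝ → ℝ) (t : ℝ) : ℝ := sSup (f '' Icc 0 t)

theorem LocLip.exists_runMax_eq {f : ℝ → ℝ} (hf : LocLip f) {t : ℝ} (ht : t ∈ Ico (0 : ℝ) 1) :
    ∃ s ∈ Icc 0 t, runMax f t = f s :=
  isCompact_Icc.exists_sSup_image_eq (nonempty_Icc.2 ht.1) (hf t ht).continuousOn

theorem LocLip.le_runMax {f : ℝ → ℝ} (hf : LocLip f) {s t : ℝ} (hs : s ∈ Icc 0 t) (ht : t < 1) :
    f s ≤ runMax f t :=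
  le_csSup (isCompact_Icc.bddAbove_image (hf t ⟨hs.1.trans hs.2, ht⟩).continuousOn)
    (mem_image_of_mem f hs)

theorem runMax_zero (f : ℝ → ℝ) : runMax f 0 = f 0 := by simp [runMax]

theorem LocLip.monotoneOn_runMax {f : ℝ → ℝ} (hf : LocLip f) :
    MonotoneOn (runMax f) (Ico 0 1) := by
  intro s hs t ht hst
  obtain ⟨x, hx, e⟩ := hf.exists_runMax_eq hs
  rw [e]
  exact hf.le_runMax ⟨hx.1, hx.2.trans hst⟩ ht.2

theorem LocLip.runMax {f : ℝ → ℝ} (hf : LocLip f) : LocLip (runMax f) := by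
  intro a ha
  obtain ⟨C, hC, h⟩ := hf a ha
  have key : ∀ s ∈ Icc 0 a, ∀ t ∈ Icc 0 a, s ≤ t →
      _root_.runMax f t ≤ _root_.runMax f s + C * (t - s) := by
    intro s hs t ht hst
    obtain ⟨x, hx, e⟩ := hf.exists_runMax_eq ⟨ht.1, ht.2.trans_lt ha.2⟩
    rw [e]
    rcases le_total x s with hxs | hxs
    · have := hf.le_runMax ⟨hx.1, hxs⟩ (hs.2.trans_lt ha.2)
      have : 0 ≤ C * (t - s) := mul_nonneg hC (sub_nonneg.2 hst)
      linarith
    · have h1 := hf.le_runMax ⟨hs.1, le_rfl⟩ (hs.2.trans_lt ha.2)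
      have h2 := (abs_le.1 (h x ⟨hx.1, hx.2.trans ht.2⟩ s hs)).2
      rw [abs_of_nonneg (sub_nonneg.2 hxs)] at h2
      have : C * (x - s) ≤ C * (t - s) := mul_le_mul_of_nonneg_left (by linarith [hx.2]) hC
      linarith
  have hm := hf.monotoneOn_runMax
  refine ⟨C, hC, fun s hs t ht => ?_⟩
  have hs' : s ∈ Ico (0 : ℝ) 1 := ⟨hs.1, hs.2.trans_lt ha.2⟩
  have ht' : t ∈ Ico (0 : ℝ) 1 := ⟨ht.1, ht.2.trans_lt ha.2⟩
  rcases le_total s t with hst | hst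
  · have := hm hs' ht' hst
    rw [abs_sub_comm, abs_of_nonneg (sub_nonneg.2 this), abs_sub_comm,
      abs_of_nonneg (sub_nonneg.2 hst)]
    linarith [key s hs t ht hst]
  · have := hm ht' hs' hst
    rw [abs_of_nonneg (sub_nonneg.2 this), abs_of_nonneg (sub_nonneg.2 hst)]
    linarith [key t ht s hs hst]

/-- At a common point of differentiability, either `f` equals its running maximum and the
derivatives agree, or the running maximum is stationary. -/
theorem LocLip.deriv_runMax {f : ℝ → ℝ} (hf : LocLip f) {t : ℝ} (ht : t ∈ Ioo (0 : ℝ) 1)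
    (hft : DifferentiableAt ℝ f t) (hmt : DifferentiableAt ℝ (_root_.runMax f) t) :
    (f t = _root_.runMax f t ∧ deriv (_root_.runMax f) t = deriv f t) ∨
      (f t < _root_.runMax f t ∧ deriv (_root_.runMax f) t = 0) := by
  have hnhds : Ioo (0 : ℝ) 1 ∈ 𝓝 t := Ioo_mem_nhds ht.1 ht.2
  have hle : ∀ s ∈ Ioo (0 : ℝ) 1, f s ≤ _root_.runMax f s := fun s hs =>
    hf.le_runMax ⟨hs.1.le, le_rfl⟩ hs.2
  rcases (hle t ht).eq_or_lt with h | h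
  · refine Or.inl ⟨h, ?_⟩
    have hmin : IsLocalMin (fun s => _root_.runMax f s - f s) t := by
      filter_upwards [hnhds] with s hs
      rw [← h]
      simpa using hle s hs
    have := hmin.deriv_eq_zero
    rw [deriv_fun_sub hmt hft] at this
    linarith
  · refine Or.inr ⟨h, ?_⟩
    have hcf : ∀ᶠ s in 𝓝 t, f s < _root_.runMax f t := hft.continuousAt.eventually_lt_const h
    obtain ⟨l, u, ⟨hl, hu⟩, hsub⟩ := mem_nhds_iff_exists_Ioo_subset.1 (hcf.and hnhds)
    have hconst : ∀ᶠ s in 𝓝 t, _root_.runMax f s = _root_.runMax f t := by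
      filter_upwards [Ioo_mem_nhds hl hu] with s hs
      have hs1 := (hsub hs).2
      rcases le_total s t with hst | hst
      · refine le_antisymm (hf.monotoneOn_runMax ⟨hs1.1.le, hs1.2⟩ ⟨ht.1.le, ht.2⟩ hst) ?_
        obtain ⟨x, hx, e⟩ := hf.exists_runMax_eq ⟨ht.1.le, ht.2⟩
        rcases le_or_gt x s with hxs | hxs
        · rw [e]; exact hf.le_runMax ⟨hx.1, hxs⟩ hs1.2
        · exact absurd e (hsub ⟨hs.1.trans hxs, hx.2.trans_lt hu⟩).1.ne'
      · refine le_antisymm ?_ (hf.monotoneOn_runMax ⟨ht.1.le, ht.2⟩ ⟨hs1.1.le, hs1.2⟩ hst)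
        obtain ⟨x, hx, e⟩ := hf.exists_runMax_eq ⟨hs1.1.le, hs1.2⟩
        rw [e]
        rcases le_or_gt x t with hxs | hxs
        · exact hf.le_runMax ⟨hx.1, hxs⟩ ht.2
        · exact (hsub ⟨hl.trans hxs, hx.2.trans_lt hs.2⟩).1.le
    rw [EventuallyEq.deriv_eq (f := fun _ => _root_.runMax f t) hconst, deriv_const]

/-- The running minimum of `f` on `[0,t]`. -/
def runMin (f : ℝ → ℝ) (t : ℝ) : ℝ := -runMax (fun s => -f s) t

theorem LocLip.neg {f : ℝ → ℝ} (hf : LocLip f) : LocLip (fun t => -f t) := fun a ha => (hf a ha).neg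

theorem LocLip.exists_runMin_eq {f : ℝ → ℝ} (hf : LocLip f) {t : ℝ} (ht : t ∈ Ico (0 : ℝ) 1) :
    ∃ s ∈ Icc 0 t, runMin f t = f s := by
  obtain ⟨s, hs, h⟩ := hf.neg.exists_runMax_eq ht
  exact ⟨s, hs, by rw [runMin, h, neg_neg]⟩

theorem LocLip.runMin_le {f : ℝ → ℝ} (hf : LocLip f) {s t : ℝ} (hs : s ∈ Icc 0 t) (ht : t < 1) :
    runMin f t ≤ f s := by
  have := hf.neg.le_runMax hs ht
  rw [runMin]
  linarith

theorem runMin_zero (f : ℝ → ℝ) : runMin f 0 = f 0 := by simp [runMin, runMax_zero]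

theorem LocLip.antitoneOn_runMin {f : ℝ → ℝ} (hf : LocLip f) :
    AntitoneOn (runMin f) (Ico 0 1) := fun _ hs _ ht hst =>
  neg_le_neg (hf.neg.monotoneOn_runMax hs ht hst)

theorem LocLip.runMin {f : ℝ → ℝ} (hf : LocLip f) : LocLip (runMin f) := hf.neg.runMax.neg

theorem LocLip.deriv_runMin {f : ℝ → ℝ} (hf : LocLip f) {t : ℝ} (ht : t ∈ Ioo (0 : ℝ) 1)
    (hft : DifferentiableAt ℝ f t) (hmt : DifferentiableAt ℝ (_root_.runMin f) t) :
    (f t = _root_.runMin f t ∧ deriv (_root_.runMin f) t = deriv f t) ∨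
      (_root_.runMin f t < f t ∧ deriv (_root_.runMin f) t = 0) := by
  have e : _root_.runMax (fun s => -f s) = fun s => -_root_.runMin f s := by
    ext s; simp [_root_.runMin]
  have hd : DifferentiableAt ℝ (_root_.runMax (fun s => -f s)) t := by rw [e]; exact hmt.neg
  have h := hf.neg.deriv_runMax ht hft.neg hd
  rw [e] at h
  simp only [deriv.fun_neg, neg_inj, neg_lt_neg_iff, neg_eq_zero] at h
  exact h

/-! ### The pointwise comparison of speeds -/

/-- The `h`-speed in the coordinates `(u,v)` with velocity `(a,b)`. -/
def hSp (n : ℕ) (cn u v a b : ℝ) : ℝ :=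
  cn * v ^ (n - 1) * √(a ^ 2 + b ^ 2) / √(2 * √(u ^ 2 + v ^ 2))

theorem hSp_nonneg {n : ℕ} {cn u v a b : ℝ} (hcn : 0 ≤ cn) (hv : 0 ≤ v) : 0 ≤ hSp n cn u v a b := by
  unfold hSp; positivity

/-- Radial projection onto a sphere or a smaller homothetic copy does not increase the speed by
more than the homothety ratio. -/
theorem sq_add_sq_le_of_scaling {U V a b R R' κ κ' : ℝ} (hRR : R ^ 2 = U ^ 2 + V ^ 2)
    (hR' : R * R' = U * a + V * b)
    (h : (κ = 1 ∧ κ' = 0) ∨ κ' * R + κ * R' = 0) :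
    (κ' * U + κ * a) ^ 2 + (κ' * V + κ * b) ^ 2 ≤ κ ^ 2 * (a ^ 2 + b ^ 2) := by
  rcases h with ⟨rfl, rfl⟩ | h
  · simp
  · have e : (κ' * U + κ * a) ^ 2 + (κ' * V + κ * b) ^ 2 =
        κ ^ 2 * (a ^ 2 + b ^ 2) - (κ * R') ^ 2 := by
      linear_combination (-κ' ^ 2) * hRR - 2 * κ * κ' * hR' + (κ' * R + κ * R') * h
    rw [e]
    linarith [sq_nonneg (R' * κ)]

/-- Comparison of weights: if `(ũ, Ṽ)` has velocity `(α, β)` controlled by the scaled velocity, then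
the new `h`-speed is smaller while the numerator weight is larger. -/
theorem hSp_compare {n : ℕ} (hn : 2 ≤ n) {cn p : ℝ} (hcn : 0 < cn) (hp : 2 * (n : ℝ) - 1 ≤ p)
    {κ V R g u' v' a b : ℝ} (hκ : 0 < κ) (hκ1 : κ ≤ 1) (hV : 0 < V) (hR : 0 < R) (hg : 0 ≤ g)
    (hv' : v' = κ * V) (hr : κ * R ≤ √(u' ^ 2 + v' ^ 2))
    (hq : a ^ 2 + b ^ 2 ≤ κ ^ 2 * (2 * R * g ^ 2)) :
    hSp n cn u' v' a b ≤ cn * V ^ (n - 1) * g ∧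
      (0 < hSp n cn u' v' a b →
        (cn * V ^ (n - 1)) ^ p * (cn * V ^ (n - 1) * g) ^ (1 - p) ≤
          (cn * v' ^ (n - 1)) ^ p * hSp n cn u' v' a b ^ (1 - p)) := by
  have hkR : 0 < κ * R := mul_pos hκ hR
  have hp1 : 1 < p := by
    have : (2 : ℝ) ≤ n := by exact_mod_cast hn
    linarith
  set F := cn * V ^ (n - 1) with hF
  have hFpos : 0 < F := by positivity
  have h1 : √(a ^ 2 + b ^ 2) / √(2 * √(u' ^ 2 + v' ^ 2)) ≤ √κ * g := by
    have hs : 0 < √(2 * √(u' ^ 2 + v' ^ 2)) := Real.sqrt_pos.2 (by linarith)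
    rw [div_le_iff₀ hs]
    refine Real.sqrt_le_iff.2 ⟨by positivity, hq.trans ?_⟩
    rw [mul_pow, mul_pow, Real.sq_sqrt hκ.le, Real.sq_sqrt (by linarith)]
    have : κ ^ 2 * (2 * R * g ^ 2) = κ * g ^ 2 * (2 * (κ * R)) := by ring
    rw [this]
    gcongr
  have h2 : hSp n cn u' v' a b ≤ κ ^ ((n : ℝ) - 1 / 2) * (F * g) := by
    have e : hSp n cn u' v' a b =
        κ ^ (n - 1) * F * (√(a ^ 2 + b ^ 2) / √(2 * √(u' ^ 2 + v' ^ 2))) := by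
      rw [hSp, hF, hv', mul_pow]; ring
    have e2 : κ ^ ((n : ℝ) - 1 / 2) = κ ^ (n - 1) * √κ := by
      rw [Real.sqrt_eq_rpow, ← Real.rpow_natCast, ← Real.rpow_add hκ, Nat.cast_sub (by omega)]
      congr 1; push_cast; ring
    rw [e, e2]
    calc κ ^ (n - 1) * F * (√(a ^ 2 + b ^ 2) / √(2 * √(u' ^ 2 + v' ^ 2)))
        ≤ κ ^ (n - 1) * F * (√κ * g) := by gcongr
      _ = _ := by ring
  have hn' : (2 : ℝ) ≤ n := by exact_mod_cast hn
  have hκe : κ ^ ((n : ℝ) - 1 / 2) ≤ 1 := Real.rpow_le_one hκ.le hκ1 (by linarith)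
  refine ⟨h2.trans (mul_le_of_le_one_left (by positivity) hκe), fun hpos => ?_⟩
  have hFg : 0 < F * g := by
    by_contra! hcon
    have : κ ^ ((n : ℝ) - 1 / 2) * (F * g) ≤ 0 :=
      mul_nonpos_of_nonneg_of_nonpos (by positivity) hcon
    linarith
  have h3 : (κ ^ ((n : ℝ) - 1 / 2) * (F * g)) ^ (1 - p) ≤ hSp n cn u' v' a b ^ (1 - p) :=
    Real.rpow_le_rpow_of_nonpos hpos h2 (by linarith)
  have e3 : cn * v' ^ (n - 1) = κ ^ ((n : ℝ) - 1) * F := by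
    have : κ ^ ((n : ℝ) - 1) = κ ^ (n - 1) := by
      rw [← Real.rpow_natCast, Nat.cast_sub (by omega)]; simp
    rw [hv', mul_pow, hF, this]; ring
  calc F ^ p * (F * g) ^ (1 - p)
      = 1 * (F ^ p * (F * g) ^ (1 - p)) := (one_mul _).symm
    _ ≤ κ ^ (((n : ℝ) - 1) * p + ((n : ℝ) - 1 / 2) * (1 - p)) * (F ^ p * (F * g) ^ (1 - p)) := by
        gcongr
        exact Real.one_le_rpow_of_pos_of_le_one_of_nonpos hκ hκ1 (by nlinarith)
    _ = (cn * v' ^ (n - 1)) ^ p * (κ ^ ((n : ℝ) - 1 / 2) * (F * g)) ^ (1 - p) := by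
        rw [e3, Real.mul_rpow (by positivity) hFpos.le, Real.mul_rpow (by positivity) hFg.le,
          ← Real.rpow_mul hκ.le, ← Real.rpow_mul hκ.le, Real.rpow_add hκ]
        ring
    _ ≤ _ := mul_le_mul_of_nonneg_left h3 (Real.rpow_nonneg (by rw [e3]; positivity) _)

/-! ### Curves in the coordinates `(|u|, v)` -/

/-- A curve in the closed half plane `v ≥ 0` with `u ≥ 0`, together with its radius `R` and a bound
`g` for its speed measured in the original quadrant. -/
structure FoldedCurve (n : ℕ) (cn u0 v0 : ℝ) (U V R g : ℝ → ℝ) : Prop where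
  locLip_u : LocLip U
  locLip_v : LocLip V
  locLip_r : LocLip R
  u_nonneg : ∀ t ∈ Ico (0 : ℝ) 1, 0 ≤ U t
  v_pos : ∀ t ∈ Ico (0 : ℝ) 1, 0 < V t
  r_pos : ∀ t ∈ Ico (0 : ℝ) 1, 0 < R t
  r_sq : ∀ t ∈ Ico (0 : ℝ) 1, R t ^ 2 = U t ^ 2 + V t ^ 2
  u_zero : U 0 = u0
  v_zero : V 0 = v0
  v_tendsto : Tendsto V (𝓝[<] 1) (𝓝 0)
  g_nonneg : ∀ t, 0 ≤ g t
  g_measurable : Measurable g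
  speed_le : ∀ᵐ t, t ∈ Ioo (0 : ℝ) 1 → deriv U t ^ 2 + deriv V t ^ 2 ≤ 2 * R t * g t ^ 2
  h_le : ∃ M, 0 ≤ M ∧ ∀ᵐ t, t ∈ Ioo (0 : ℝ) 1 → cn * V t ^ (n - 1) * g t ≤ M

theorem sq_deriv_abs_le {f : ℝ → ℝ} {t : ℝ} (hf : DifferentiableAt ℝ f t) :
    deriv (fun s => |f s|) t ^ 2 ≤ deriv f t ^ 2 := by
  rcases lt_trichotomy (f t) 0 with h | h | h
  · have : (fun s => |f s|) =ᶠ[𝓝 t] fun s => -f s := by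
      filter_upwards [hf.continuousAt.eventually_lt_const h] with s hs using abs_of_neg hs
    rw [this.deriv_eq, deriv.fun_neg, neg_sq]
  · have : IsLocalMin (fun s => |f s|) t := Eventually.of_forall fun s => by simp [h]
    rw [this.deriv_eq_zero, zero_pow two_ne_zero]
    positivity
  · have : (fun s => |f s|) =ᶠ[𝓝 t] f := by
      filter_upwards [hf.continuousAt.eventually_const_lt h] with s hs using abs_of_pos hs
    rw [this.deriv_eq]

theorem gSpeedOn_eq_of_mem_Ioo {S : Set ℝ} {γ : ℝ → ℝ × ℝ} {t : ℝ} (hS : S ∈ 𝓝 t) :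
    gSpeedOn S γ t = √(deriv (fun s => (γ s).1) t ^ 2 + deriv (fun s => (γ s).2) t ^ 2) := by
  rw [gSpeedOn, derivWithin_of_mem_nhds hS, derivWithin_of_mem_nhds hS]

theorem hSpeedOn_eq {n : ℕ} {cn : ℝ} {S : Set ℝ} {γ : ℝ → ℝ × ℝ} {t : ℝ} (hS : S ∈ 𝓝 t) :
    hSpeedOn n cn S γ t = cn * ((γ t).1 * (γ t).2) ^ (n - 1) *
      √(deriv (fun s => (γ s).1) t ^ 2 + deriv (fun s => (γ s).2) t ^ 2) := by
  rw [hSpeedOn, gSpeedOn_eq_of_mem_Ioo hS, Fvol, mul_pow, ← mul_assoc]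

theorem MemRh.locLip {n : ℕ} {cn x0 y0 : ℝ} {γ : ℝ → ℝ × ℝ} (hγ : MemRh n cn x0 y0 γ) :
    LocLip (fun t => (γ t).1) ∧ LocLip (fun t => (γ t).2) := by
  refine ⟨fun a ha => ?_, fun a ha => ?_⟩ <;> obtain ⟨K, hK⟩ := hγ.2.2.1 a ha
  · exact isLip_of_lipschitzOnWith (LipschitzWith.prod_fst.comp_lipschitzOnWith hK)
  · exact isLip_of_lipschitzOnWith (LipschitzWith.prod_snd.comp_lipschitzOnWith hK)

theorem MemRh.foldedCurve {n : ℕ} {cn x0 y0 : ℝ} (hxy : y0 ≤ x0) (hy0 : 0 < y0)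
    {γ : ℝ → ℝ × ℝ} (hγ : MemRh n cn x0 y0 γ) :
    FoldedCurve n cn (ucoord (x0, y0)) (vcoord (x0, y0)) (fun t => |ucoord (γ t)|)
      (fun t => vcoord (γ t)) (fun t => ((γ t).1 ^ 2 + (γ t).2 ^ 2) / 2)
      (fun t => √(deriv (fun s => (γ s).1) t ^ 2 + deriv (fun s => (γ s).2) t ^ 2)) := by
  obtain ⟨hx, hy⟩ := hγ.locLip
  have hxx : LocLip (fun t => (γ t).1 ^ 2) := fun a ha => by
    simpa only [sq] using (hx a ha).mul isCompact_Icc (hx a ha)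
  have hyy : LocLip (fun t => (γ t).2 ^ 2) := fun a ha => by
    simpa only [sq] using (hy a ha).mul isCompact_Icc (hy a ha)
  have hu : LocLip (fun t => ucoord (γ t)) := fun a ha => by
    simpa only [ucoord, div_eq_inv_mul] using ((hxx a ha).sub (hyy a ha)).const_mul (2⁻¹)
  have hpos := hγ.2.1
  refine ⟨fun a ha => (hu a ha).abs, fun a ha => (hx a ha).mul isCompact_Icc (hy a ha),
    fun a ha => ?_, fun t _ => abs_nonneg _, fun t ht => mul_pos (hpos t ht).1 (hpos t ht).2,
    fun t ht => ?_, fun t _ => ?_, ?_, ?_, hγ.2.2.2.2, fun t => Real.sqrt_nonneg _, ?_, ?_, ?_⟩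
  · simpa only [div_eq_inv_mul] using ((hxx a ha).add (hyy a ha)).const_mul (2⁻¹)
  · have := (hpos t ht).1
    have := (hpos t ht).2
    positivity
  · rw [sq_abs, ucoord, vcoord]; ring
  · rw [hγ.1, abs_of_nonneg]
    have : y0 ^ 2 ≤ x0 ^ 2 := by gcongr
    simp only [ucoord]; linarith
  · rw [hγ.1]
  · exact (((measurable_deriv _).pow_const 2).add ((measurable_deriv _).pow_const 2)).sqrt
  · filter_upwards [hx.ae_differentiableAt, hy.ae_differentiableAt, hu.ae_differentiableAt] with
      t hxt hyt hut ht
    specialize hxt ht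
    specialize hyt ht
    have e1 := ((hxt.hasDerivAt.pow 2).sub (hyt.hasDerivAt.pow 2)).div_const 2
    have e2 := hxt.hasDerivAt.mul hyt.hasDerivAt
    have h1 := sq_deriv_abs_le (hut ht)
    have e1' : deriv (fun t => ucoord (γ t)) t = _ := e1.deriv
    have e2' : deriv (fun t => vcoord (γ t)) t = _ := e2.deriv
    rw [e1'] at h1
    rw [e2', Real.sq_sqrt (by positivity)]
    refine (add_le_add_left h1 _).trans (le_of_eq ?_)
    simp only [Nat.cast_ofNat]
    ring
  · obtain ⟨M, hM⟩ := hγ.2.2.2.1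
    refine ⟨max M 0, le_max_right _ _, ?_⟩
    filter_upwards [hM] with t ht htI
    have h := ht ⟨htI.1.le, htI.2⟩
    rw [hSpeed, hSpeedOn_eq (Ico_mem_nhds htI.1 htI.2)] at h
    exact h.trans (le_max_left _ _)

/-! ### Monotone rearrangement of a folded curve -/

/-- The homothety factor bringing the radius down to its running minimum. -/
def shrink (R : ℝ → ℝ) (t : ℝ) : ℝ := runMin R t * (R t)⁻¹

/-- The monotone `u`-coordinate of the rearranged curve. -/
def sweepU (U R : ℝ → ℝ) : ℝ → ℝ := runMax (fun t => shrink R t * U t)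

/-- The monotone `v`-coordinate of the rearranged curve. -/
def sweepV (V R : ℝ → ℝ) : ℝ → ℝ := runMin (fun t => shrink R t * V t)

namespace FoldedCurve

variable {n : ℕ} {cn u0 v0 : ℝ} {U V R g : ℝ → ℝ}

theorem runMin_pos (h : FoldedCurve n cn u0 v0 U V R g) {t : ℝ} (ht : t ∈ Ico (0 : ℝ) 1) :
    0 < runMin R t := by
  obtain ⟨s, hs, e⟩ := h.locLip_r.exists_runMin_eq ht
  rw [e]
  exact h.r_pos s ⟨hs.1, hs.2.trans_lt ht.2⟩

theorem shrink_pos (h : FoldedCurve n cn u0 v0 U V R g) {t : ℝ} (ht : t ∈ Ico (0 : ℝ) 1) :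
    0 < shrink R t := mul_pos (h.runMin_pos ht) (inv_pos.2 (h.r_pos t ht))

theorem shrink_le_one (h : FoldedCurve n cn u0 v0 U V R g) {t : ℝ} (ht : t ∈ Ico (0 : ℝ) 1) :
    shrink R t ≤ 1 := by
  rw [shrink, mul_inv_le_iff₀ (h.r_pos t ht), one_mul]
  exact h.locLip_r.runMin_le ⟨ht.1, le_rfl⟩ ht.2

theorem shrink_mul_r (h : FoldedCurve n cn u0 v0 U V R g) {t : ℝ} (ht : t ∈ Ico (0 : ℝ) 1) :
    shrink R t * R t = runMin R t := by
  rw [shrink, inv_mul_cancel_right₀ (h.r_pos t ht).ne']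

theorem locLip_shrink (h : FoldedCurve n cn u0 v0 U V R g) : LocLip (shrink R) := fun a ha =>
  (h.locLip_r.runMin a ha).mul isCompact_Icc ((h.locLip_r a ha).inv isCompact_Icc fun s hs =>
    h.r_pos s ⟨hs.1, hs.2.trans_lt ha.2⟩)

theorem locLip_shrink_u (h : FoldedCurve n cn u0 v0 U V R g) :
    LocLip (fun t => shrink R t * U t) := fun a ha =>
  (h.locLip_shrink a ha).mul isCompact_Icc (h.locLip_u a ha)

theorem locLip_shrink_v (h : FoldedCurve n cn u0 v0 U V R g) :
    LocLip (fun t => shrink R t * V t) := fun a ha =>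
  (h.locLip_shrink a ha).mul isCompact_Icc (h.locLip_v a ha)

theorem locLip_sweepU (h : FoldedCurve n cn u0 v0 U V R g) : LocLip (sweepU U R) :=
  h.locLip_shrink_u.runMax

theorem locLip_sweepV (h : FoldedCurve n cn u0 v0 U V R g) : LocLip (sweepV V R) :=
  h.locLip_shrink_v.runMin

theorem shrink_zero (h : FoldedCurve n cn u0 v0 U V R g) : shrink R 0 = 1 := by
  rw [shrink, runMin_zero, mul_inv_cancel₀ (h.r_pos 0 ⟨le_rfl, one_pos⟩).ne']

theorem sweepU_zero (h : FoldedCurve n cn u0 v0 U V R g) : sweepU U R 0 = u0 := by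
  rw [sweepU, runMax_zero, h.shrink_zero, one_mul, h.u_zero]

theorem sweepV_zero (h : FoldedCurve n cn u0 v0 U V R g) : sweepV V R 0 = v0 := by
  rw [sweepV, runMin_zero, h.shrink_zero, one_mul, h.v_zero]

theorem shrink_sq (h : FoldedCurve n cn u0 v0 U V R g) {t : ℝ} (ht : t ∈ Ico (0 : ℝ) 1) :
    (shrink R t * U t) ^ 2 + (shrink R t * V t) ^ 2 = runMin R t ^ 2 := by
  rw [← h.shrink_mul_r ht, mul_pow, mul_pow, mul_pow, h.r_sq t ht]; ring

theorem sweepU_nonneg (h : FoldedCurve n cn u0 v0 U V R g) {t : ℝ} (ht : t ∈ Ico (0 : ℝ) 1) :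
    0 ≤ sweepU U R t :=
  (mul_nonneg (h.shrink_pos ht).le (h.u_nonneg t ht)).trans
    (h.locLip_shrink_u.le_runMax ⟨ht.1, le_rfl⟩ ht.2)

theorem sweepV_pos (h : FoldedCurve n cn u0 v0 U V R g) {t : ℝ} (ht : t ∈ Ico (0 : ℝ) 1) :
    0 < sweepV V R t := by
  obtain ⟨s, hs, e⟩ := h.locLip_shrink_v.exists_runMin_eq ht
  have hsI : s ∈ Ico (0 : ℝ) 1 := ⟨hs.1, hs.2.trans_lt ht.2⟩
  rw [sweepV, e]
  exact mul_pos (h.shrink_pos hsI) (h.v_pos s hsI)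

/-- The point where the minimum of `v` is attained bounds the radius. -/
theorem exists_runMin_sq_le (h : FoldedCurve n cn u0 v0 U V R g) {t : ℝ}
    (ht : t ∈ Ico (0 : ℝ) 1) :
    ∃ s ∈ Icc 0 t, sweepV V R t = shrink R s * V s ∧ runMin R t ^ 2 ≤ runMin R s ^ 2 ∧
      runMin R s ^ 2 ≤ sweepU U R t ^ 2 + sweepV V R t ^ 2 := by
  obtain ⟨s, hs, e⟩ := h.locLip_shrink_v.exists_runMin_eq ht
  have hs' : s ∈ Ico (0 : ℝ) 1 := ⟨hs.1, hs.2.trans_lt ht.2⟩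
  have h0 := (h.runMin_pos ht).le
  have h1 := h.locLip_r.antitoneOn_runMin hs' ht hs.2
  have h2 : shrink R s * U s ≤ sweepU U R t := h.locLip_shrink_u.le_runMax hs ht.2
  have h3 : 0 ≤ shrink R s * U s := mul_nonneg (h.shrink_pos hs').le (h.u_nonneg s hs')
  refine ⟨s, hs, e, by gcongr, ?_⟩
  rw [← h.shrink_sq hs', sweepV, e]
  gcongr

theorem runMin_le_sqrt (h : FoldedCurve n cn u0 v0 U V R g) {t : ℝ} (ht : t ∈ Ico (0 : ℝ) 1) :
    runMin R t ≤ √(sweepU U R t ^ 2 + sweepV V R t ^ 2) := by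
  obtain ⟨s, -, -, h1, h2⟩ := h.exists_runMin_sq_le ht
  exact Real.le_sqrt_of_sq_le (h1.trans h2)

theorem sweep_sq_le (h : FoldedCurve n cn u0 v0 U V R g) {s t : ℝ} (hs : s ∈ Ico (0 : ℝ) 1)
    (ht : t ∈ Ico (0 : ℝ) 1) (hst : s ≤ t) :
    sweepU U R t ^ 2 + sweepV V R t ^ 2 ≤ sweepU U R s ^ 2 + sweepV V R s ^ 2 := by
  have hV : sweepV V R t ≤ sweepV V R s := h.locLip_shrink_v.antitoneOn_runMin hs ht hst
  have hV0 := (h.sweepV_pos ht).le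
  obtain ⟨x, hx, e⟩ := h.locLip_shrink_u.exists_runMax_eq ht
  have hx' : x ∈ Ico (0 : ℝ) 1 := ⟨hx.1, hx.2.trans_lt ht.2⟩
  rcases le_total x s with hxs | hxs
  · have : sweepU U R t ≤ sweepU U R s := by
      rw [sweepU, e]; exact h.locLip_shrink_u.le_runMax ⟨hx.1, hxs⟩ hs.2
    have := h.sweepU_nonneg ht
    gcongr
  · have h1 : sweepV V R t ≤ shrink R x * V x := h.locLip_shrink_v.runMin_le hx ht.2
    have h2 : sweepU U R t ^ 2 + sweepV V R t ^ 2 ≤ runMin R x ^ 2 := by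
      rw [← h.shrink_sq hx', sweepU, e]
      gcongr
    obtain ⟨y, hy, -, h3, h4⟩ := h.exists_runMin_sq_le hs
    have h5 : runMin R x ≤ runMin R s := h.locLip_r.antitoneOn_runMin hs hx' hxs
    have h6 : runMin R x ^ 2 ≤ runMin R s ^ 2 := by
      have := (h.runMin_pos hx').le
      gcongr
    linarith

theorem shrink_v_eq_of_shrink_u_eq (h : FoldedCurve n cn u0 v0 U V R g) {t : ℝ}
    (ht : t ∈ Ico (0 : ℝ) 1) (hU : shrink R t * U t = sweepU U R t) :
    shrink R t * V t = sweepV V R t := by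
  refine le_antisymm ?_ (h.locLip_shrink_v.runMin_le ⟨ht.1, le_rfl⟩ ht.2)
  obtain ⟨s, -, -, h1, h2⟩ := h.exists_runMin_sq_le ht
  have h3 := h.shrink_sq ht
  rw [hU] at h3
  exact le_of_sq_le_sq (by linarith) (h.sweepV_pos ht).le

/-- The rearranged velocity either vanishes or is controlled by the scaled original velocity. -/
theorem deriv_sweep (h : FoldedCurve n cn u0 v0 U V R g) :
    ∀ᵐ t, t ∈ Ioo (0 : ℝ) 1 →
      (deriv (sweepU U R) t = 0 ∧ deriv (sweepV V R) t = 0) ∨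
      (sweepV V R t = shrink R t * V t ∧
        deriv (sweepU U R) t ^ 2 + deriv (sweepV V R) t ^ 2 ≤
          shrink R t ^ 2 * (2 * R t * g t ^ 2)) := by
  filter_upwards [h.locLip_u.ae_differentiableAt, h.locLip_v.ae_differentiableAt,
    h.locLip_r.ae_differentiableAt, h.locLip_r.runMin.ae_differentiableAt,
    h.locLip_sweepU.ae_differentiableAt, h.locLip_sweepV.ae_differentiableAt, h.speed_le] with
    t hU hV hR hr hsU hsV hsp ht
  specialize hU ht; specialize hV ht; specialize hR ht; specialize hr ht
  specialize hsU ht; specialize hsV ht; specialize hsp ht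
  have ht' : t ∈ Ico (0 : ℝ) 1 := ⟨ht.1.le, ht.2⟩
  have hRne := (h.r_pos t ht').ne'
  have hκ : DifferentiableAt ℝ (shrink R) t := hr.mul (hR.inv hRne)
  have hu1 : deriv (fun t => shrink R t * U t) t =
    deriv (shrink R) t * U t + shrink R t * deriv U t := deriv_fun_mul hκ hU
  have hv1 : deriv (fun t => shrink R t * V t) t =
    deriv (shrink R) t * V t + shrink R t * deriv V t := deriv_fun_mul hκ hV
  have hnhds : Ico (0 : ℝ) 1 ∈ 𝓝 t := Ico_mem_nhds ht.1 ht.2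
  have hRR' : R t * deriv R t = U t * deriv U t + V t * deriv V t := by
    have e : (fun s => R s ^ 2) =ᶠ[𝓝 t] fun s => U s ^ 2 + V s ^ 2 := by
      filter_upwards [hnhds] with s hs using h.r_sq s hs
    have e' := e.deriv_eq
    have d1 : deriv (fun s => R s ^ 2) t = _ := (hR.hasDerivAt.pow 2).deriv
    have d2 : deriv (fun s => U s ^ 2 + V s ^ 2) t = _ :=
      ((hU.hasDerivAt.pow 2).add (hV.hasDerivAt.pow 2)).deriv
    rw [d1, d2] at e'
    simp only [Nat.cast_ofNat] at e'
    linear_combination e' / 2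
  have hκR : deriv (shrink R) t * R t + shrink R t * deriv R t = deriv (runMin R) t := by
    rw [← deriv_fun_mul hκ hR]
    refine EventuallyEq.deriv_eq ?_
    filter_upwards [hnhds] with s hs using h.shrink_mul_r hs
  have hcase : (shrink R t = 1 ∧ deriv (shrink R) t = 0) ∨
      deriv (shrink R) t * R t + shrink R t * deriv R t = 0 := by
    rcases h.locLip_r.deriv_runMin ht hR hr with ⟨e1, e2⟩ | ⟨-, e2⟩
    · have hk : shrink R t = 1 := by rw [shrink, ← e1, mul_inv_cancel₀ hRne]
      rw [hk, e2, one_mul] at hκR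
      exact Or.inl ⟨hk, (mul_eq_zero.1 (by linarith : deriv (shrink R) t * R t = 0)).resolve_right
        hRne⟩
    · exact Or.inr (hκR.trans e2)
  have hw := sq_add_sq_le_of_scaling (h.r_sq t ht') hRR' hcase
  have hw' : deriv (fun t => shrink R t * U t) t ^ 2 + deriv (fun t => shrink R t * V t) t ^ 2 ≤
      shrink R t ^ 2 * (2 * R t * g t ^ 2) := by
    rw [hu1, hv1]
    exact hw.trans (by gcongr)
  have hdu := h.locLip_shrink_u.deriv_runMax ht (hκ.mul hU) hsU
  have hdv := h.locLip_shrink_v.deriv_runMin ht (hκ.mul hV) hsV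
  rcases hdu with ⟨e1, e2⟩ | ⟨-, e2⟩
  · have e3 := h.shrink_v_eq_of_shrink_u_eq ht' e1
    refine Or.inr ⟨e3.symm, le_trans ?_ hw'⟩
    rcases hdv with ⟨-, e4⟩ | ⟨e4, -⟩
    · exact (congrArg₂ (fun a b : ℝ => a ^ 2 + b ^ 2) e2 e4).le
    · exact absurd e3 e4.ne'
  · rcases hdv with ⟨e3, e4⟩ | ⟨-, e4⟩
    · refine Or.inr ⟨e3.symm, le_trans ?_ hw'⟩
      have e2' : deriv (sweepU U R) t = 0 := e2
      have e4' : deriv (sweepV V R) t = _ := e4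
      rw [e2', e4', zero_pow two_ne_zero, zero_add]
      linarith [sq_nonneg (deriv (fun t => shrink R t * U t) t)]
    · exact Or.inl ⟨e2, e4⟩

/-- The rearranged curve is slower, and where it moves its weight in the Rayleigh quotient is
larger. -/
theorem hSp_sweep_le (h : FoldedCurve n cn u0 v0 U V R g) (hn : 2 ≤ n) (hcn : 0 < cn) {p : ℝ}
    (hp : 2 * (n : ℝ) - 1 ≤ p) :
    ∀ᵐ t, t ∈ Ioo (0 : ℝ) 1 →
      hSp n cn (sweepU U R t) (sweepV V R t) (deriv (sweepU U R) t) (deriv (sweepV V R) t) ≤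
          cn * V t ^ (n - 1) * g t ∧
        (0 < hSp n cn (sweepU U R t) (sweepV V R t) (deriv (sweepU U R) t)
            (deriv (sweepV V R) t) →
          (cn * V t ^ (n - 1)) ^ p * (cn * V t ^ (n - 1) * g t) ^ (1 - p) ≤
            (cn * sweepV V R t ^ (n - 1)) ^ p * hSp n cn (sweepU U R t) (sweepV V R t)
              (deriv (sweepU U R) t) (deriv (sweepV V R) t) ^ (1 - p)) := by
  filter_upwards [h.deriv_sweep] with t hd ht
  have ht' : t ∈ Ico (0 : ℝ) 1 := ⟨ht.1.le, ht.2⟩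
  have hV := h.v_pos t ht'
  have hg := h.g_nonneg t
  rcases hd ht with ⟨e1, e2⟩ | ⟨e1, e2⟩
  · have : hSp n cn (sweepU U R t) (sweepV V R t) 0 0 = 0 := by simp [hSp]
    rw [e1, e2, this]
    exact ⟨by positivity, fun h => absurd h (lt_irrefl _)⟩
  · exact hSp_compare hn hcn hp (h.shrink_pos ht') (h.shrink_le_one ht') hV (h.r_pos t ht') hg e1
      (by rw [h.shrink_mul_r ht']; exact h.runMin_le_sqrt ht') e2

end FoldedCurve

/-! ### Arclength of monotone curves -/

/-- The `h`-speed of a curve given in the coordinates `(u,v)`. -/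
def hSpAlong (n : ℕ) (cn : ℝ) (A B : ℝ → ℝ) (t : ℝ) : ℝ :=
  hSp n cn (A t) (B t) (deriv A t) (deriv B t)

/-- A curve on `[0,1)` along which `u` increases while `v` and the radius decrease. -/
structure MonotoneCurve (n : ℕ) (cn u0 v0 : ℝ) (A B : ℝ → ℝ) : Prop where
  locLip_u : LocLip A
  locLip_v : LocLip B
  mono_u : MonotoneOn A (Ico 0 1)
  anti_v : AntitoneOn B (Ico 0 1)
  v_pos : ∀ t ∈ Ico (0 : ℝ) 1, 0 < B t
  sq_le : ∀ s ∈ Ico (0 : ℝ) 1, ∀ t ∈ Ico (0 : ℝ) 1, s ≤ t →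
    A t ^ 2 + B t ^ 2 ≤ A s ^ 2 + B s ^ 2
  u_zero : A 0 = u0
  v_zero : B 0 = v0
  v_tendsto : Tendsto B (𝓝[<] 1) (𝓝 0)
  h_le : ∃ M, 0 ≤ M ∧ ∀ᵐ t, t ∈ Ioo (0 : ℝ) 1 → hSpAlong n cn A B t ≤ M

theorem FoldedCurve.monotoneCurve {n : ℕ} {cn u0 v0 : ℝ} {U V R g : ℝ → ℝ}
    (h : FoldedCurve n cn u0 v0 U V R g) (hn : 2 ≤ n) (hcn : 0 < cn) :
    MonotoneCurve n cn u0 v0 (sweepU U R) (sweepV V R) where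
  locLip_u := h.locLip_sweepU
  locLip_v := h.locLip_sweepV
  mono_u := h.locLip_shrink_u.monotoneOn_runMax
  anti_v := h.locLip_shrink_v.antitoneOn_runMin
  v_pos _ ht := h.sweepV_pos ht
  sq_le _ hs _ ht hst := h.sweep_sq_le hs ht hst
  u_zero := h.sweepU_zero
  v_zero := h.sweepV_zero
  v_tendsto := by
    have hI : ∀ᶠ t in 𝓝[<] (1 : ℝ), t ∈ Ico (0 : ℝ) 1 := by
      filter_upwards [Ioo_mem_nhdsLT (zero_lt_one (α := ℝ))] with t ht using ⟨ht.1.le, ht.2⟩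
    refine tendsto_of_tendsto_of_tendsto_of_le_of_le' tendsto_const_nhds h.v_tendsto ?_ ?_
    · filter_upwards [hI] with t ht using (h.sweepV_pos ht).le
    · filter_upwards [hI] with t ht
      refine (h.locLip_shrink_v.runMin_le ⟨ht.1, le_rfl⟩ ht.2).trans ?_
      exact mul_le_of_le_one_left (h.v_pos t ht).le (h.shrink_le_one ht)
  h_le := by
    obtain ⟨M, hM0, hM⟩ := h.h_le
    refine ⟨M, hM0, ?_⟩
    filter_upwards [hM, h.hSp_sweep_le hn hcn le_rfl] with t h1 h2 ht
    exact (h2 ht).1.trans (h1 ht)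

theorem LocLip.aestronglyMeasurable {f : ℝ → ℝ} (hf : LocLip f) :
    AEStronglyMeasurable f (volume.restrict (Ioo 0 1)) :=
  (hf.continuousOn.mono Ioo_subset_Ico_self).aestronglyMeasurable measurableSet_Ioo

/-- Elementary bound of the `h`-speed. -/
theorem hSp_le {n : ℕ} (hn : 2 ≤ n) {cn u v v0 a b : ℝ} (hcn : 0 < cn) (hv : 0 < v)
    (hv0 : v ≤ v0) : hSp n cn u v a b ≤ cn * v0 ^ (n - 2) * √v0 * (|a| + |b|) := by
  have h1 : √(a ^ 2 + b ^ 2) ≤ |a| + |b| := by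
    refine Real.sqrt_le_iff.2 ⟨by positivity, ?_⟩
    nlinarith [abs_nonneg a, abs_nonneg b, sq_abs a, sq_abs b]
  have h2 : √v ≤ √(2 * √(u ^ 2 + v ^ 2)) := by
    refine Real.sqrt_le_sqrt ?_
    have : v ≤ √(u ^ 2 + v ^ 2) := Real.le_sqrt_of_sq_le (by nlinarith [sq_nonneg u])
    linarith
  have hsv : 0 < √v := Real.sqrt_pos.2 hv
  have e : v ^ (n - 1) = v ^ (n - 2) * √v * √v := by
    rw [mul_assoc, Real.mul_self_sqrt hv.le, ← pow_succ]; congr 1; omega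
  calc hSp n cn u v a b ≤ cn * v ^ (n - 1) * (|a| + |b|) / √v := by
        unfold hSp; gcongr
    _ = cn * v ^ (n - 2) * √v * (|a| + |b|) := by
        rw [e]; field_simp
    _ ≤ _ := by
        have : 0 < v0 := hv.trans_le hv0
        gcongr

namespace MonotoneCurve

variable {n : ℕ} {cn u0 v0 : ℝ} {A B : ℝ → ℝ}

/-- The `h`-arclength, extended constantly outside `[0,1]`. -/
def arc (n : ℕ) (cn : ℝ) (A B : ℝ → ℝ) (t : ℝ) : ℝ :=
  ∫ s in (0 : ℝ)..t, (Ioo (0 : ℝ) 1).indicator (hSpAlong n cn A B) s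

theorem hSpAlong_nonneg (h : MonotoneCurve n cn u0 v0 A B) (hcn : 0 < cn) {t : ℝ}
    (ht : t ∈ Ico (0 : ℝ) 1) : 0 ≤ hSpAlong n cn A B t := hSp_nonneg hcn.le (h.v_pos t ht).le

theorem indicator_nonneg (h : MonotoneCurve n cn u0 v0 A B) (hcn : 0 < cn) (t : ℝ) :
    0 ≤ (Ioo (0 : ℝ) 1).indicator (hSpAlong n cn A B) t :=
  Set.indicator_nonneg (fun _ ht => h.hSpAlong_nonneg hcn ⟨ht.1.le, ht.2⟩) t

theorem aestronglyMeasurable_hSpAlong (h : MonotoneCurve n cn u0 v0 A B) :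
    AEStronglyMeasurable (hSpAlong n cn A B) (volume.restrict (Ioo 0 1)) := by
  have hA := h.locLip_u.aestronglyMeasurable.aemeasurable
  have hB := h.locLip_v.aestronglyMeasurable.aemeasurable
  have hA' := (measurable_deriv A).aemeasurable (μ := volume.restrict (Ioo 0 1))
  have hB' := (measurable_deriv B).aemeasurable (μ := volume.restrict (Ioo 0 1))
  refine AEMeasurable.aestronglyMeasurable ?_
  exact (((hB.pow_const _).const_mul cn).mul ((hA'.pow_const 2).add (hB'.pow_const 2)).sqrt).div
    (((hA.pow_const 2).add (hB.pow_const 2)).sqrt.const_mul 2).sqrt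

theorem exists_ae_indicator_le (h : MonotoneCurve n cn u0 v0 A B) (hcn : 0 < cn) :
    ∃ M, 0 ≤ M ∧ ∀ᵐ t, ‖(Ioo (0 : ℝ) 1).indicator (hSpAlong n cn A B) t‖ ≤ M := by
  obtain ⟨M, hM0, hM⟩ := h.h_le
  refine ⟨M, hM0, ?_⟩
  filter_upwards [hM] with t ht
  rw [Real.norm_of_nonneg (h.indicator_nonneg hcn t)]
  by_cases hI : t ∈ Ioo (0 : ℝ) 1
  · rw [indicator_of_mem hI]; exact ht hI
  · rwa [indicator_of_notMem hI]

theorem intervalIntegrable (h : MonotoneCurve n cn u0 v0 A B) (hcn : 0 < cn) (a b : ℝ) :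
    IntervalIntegrable ((Ioo (0 : ℝ) 1).indicator (hSpAlong n cn A B)) volume a b := by
  obtain ⟨M, -, hM⟩ := h.exists_ae_indicator_le hcn
  refine (intervalIntegrable_const (c := M)).mono_fun ?_ ?_
  · exact ((aestronglyMeasurable_indicator_iff measurableSet_Ioo).2
      h.aestronglyMeasurable_hSpAlong).restrict
  · refine ae_restrict_of_ae ?_
    filter_upwards [hM] with t ht using ht.trans (le_abs_self M)

theorem arc_sub (h : MonotoneCurve n cn u0 v0 A B) (hcn : 0 < cn) (s t : ℝ) :
    arc n cn A B t - arc n cn A B s =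
      ∫ x in s..t, (Ioo (0 : ℝ) 1).indicator (hSpAlong n cn A B) x :=
  intervalIntegral.integral_interval_sub_left (h.intervalIntegrable hcn _ _)
    (h.intervalIntegrable hcn _ _)

theorem monotone_arc (h : MonotoneCurve n cn u0 v0 A B) (hcn : 0 < cn) :
    Monotone (arc n cn A B) := fun s t hst => by
  rw [← sub_nonneg, h.arc_sub hcn]
  exact intervalIntegral.integral_nonneg hst fun x _ => h.indicator_nonneg hcn x

theorem exists_lipschitzWith_arc (h : MonotoneCurve n cn u0 v0 A B) (hcn : 0 < cn) :
    ∃ K, LipschitzWith K (arc n cn A B) := by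
  obtain ⟨M, hM0, hM⟩ := h.exists_ae_indicator_le hcn
  refine ⟨⟨M, hM0⟩, LipschitzWith.of_dist_le_mul fun s t => ?_⟩
  rw [Real.dist_eq, h.arc_sub hcn, ← Real.norm_eq_abs, Real.dist_eq]
  refine intervalIntegral.norm_integral_le_of_norm_le_const_ae ?_
  filter_upwards [hM] with x hx _ using hx

theorem arc_zero : arc n cn A B 0 = 0 := intervalIntegral.integral_same

theorem ae_hasDerivAt_arc (h : MonotoneCurve n cn u0 v0 A B) (hcn : 0 < cn) :
    ∀ᵐ t, t ∈ Ioo (0 : ℝ) 1 → HasDerivAt (arc n cn A B) (hSpAlong n cn A B t) t := by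
  filter_upwards [(h.intervalIntegrable hcn 0 1).ae_hasDerivAt_integral] with t ht hI
  have := ht (by rw [uIcc_of_le zero_le_one]; exact Ioo_subset_Icc_self hI) 0 left_mem_uIcc
  rwa [indicator_of_mem hI] at this

theorem isLip_arc (h : MonotoneCurve n cn u0 v0 A B) (hcn : 0 < cn) (S : Set ℝ) :
    IsLip (arc n cn A B) S := by
  obtain ⟨K, hK⟩ := h.exists_lipschitzWith_arc hcn
  exact isLip_of_lipschitzOnWith (hK.lipschitzOnWith (s := S))

theorem chord_le (h : MonotoneCurve n cn u0 v0 A B) (hcn : 0 < cn) {s t : ℝ}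
    (hs : s ∈ Ico (0 : ℝ) 1) (ht : t ∈ Ico (0 : ℝ) 1) (hst : s ≤ t) :
    cn * B t ^ (n - 1) * √((A t - A s) ^ 2 + (B t - B s) ^ 2) ≤
      √(2 * √(A s ^ 2 + B s ^ 2)) * (arc n cn A B t - arc n cn A B s) := by
  set D := √((A t - A s) ^ 2 + (B t - B s) ^ 2) with hD
  set Q := √(2 * √(A s ^ 2 + B s ^ 2)) with hQ
  set C := cn * B t ^ (n - 1) with hC
  have hBt := h.v_pos t ht
  have hC0 : 0 ≤ C := by positivity
  have hDD : D * D = (A t - A s) ^ 2 + (B t - B s) ^ 2 := Real.mul_self_sqrt (by positivity)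
  have harc := h.monotone_arc hcn hst
  rcases (Real.sqrt_nonneg _ : 0 ≤ D).eq_or_lt' with h0 | h0
  · rw [show D = 0 from h0, mul_zero]
    exact mul_nonneg (Real.sqrt_nonneg _) (by linarith)
  have hA := (h.locLip_u t ht).mono (Icc_subset_Icc_left hs.1)
  have hB := (h.locLip_v t ht).mono (Icc_subset_Icc_left hs.1)
  have hlip := ((h.isLip_arc hcn (Icc s t)).const_mul (Q * D)).sub
    (((hA.const_mul (A t - A s)).add (hB.const_mul (B t - B s))).const_mul C)
  have key := hlip.le_of_deriv_nonneg hst ?_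
  · have : C * (D * D) ≤ Q * D * (arc n cn A B t - arc n cn A B s) := by
      rw [hDD]; linarith
    refine le_of_mul_le_mul_right ?_ h0
    linarith
  · filter_upwards [h.ae_hasDerivAt_arc hcn, h.locLip_u.ae_differentiableAt,
      h.locLip_v.ae_differentiableAt] with x h1 h2 h3 hx
    have hxI : x ∈ Ioo (0 : ℝ) 1 := ⟨hs.1.trans_lt hx.1, hx.2.trans ht.2⟩
    have hxI' : x ∈ Ico (0 : ℝ) 1 := ⟨hxI.1.le, hxI.2⟩
    have hder := ((h1 hxI).const_mul (Q * D)).sub ((((h2 hxI).hasDerivAt.const_mul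
      (A t - A s)).add ((h3 hxI).hasDerivAt.const_mul (B t - B s))).const_mul C)
    have e : deriv (fun x => Q * D * arc n cn A B x -
      C * ((A t - A s) * A x + (B t - B s) * B x)) x = _ := hder.deriv
    rw [e, sub_nonneg]
    set a := deriv A x
    set b := deriv B x
    have hcs : (A t - A s) * a + (B t - B s) * b ≤ D * √(a ^ 2 + b ^ 2) := by
      rw [hD, ← Real.sqrt_mul (by positivity)]
      refine Real.le_sqrt_of_sq_le ?_
      nlinarith [sq_nonneg ((A t - A s) * b - (B t - B s) * a)]
    have hBx : B t ≤ B x := h.anti_v hxI' ht hx.2.le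
    have hBx0 := h.v_pos x hxI'
    have hr : √(2 * √(A x ^ 2 + B x ^ 2)) ≤ Q :=
      Real.sqrt_le_sqrt (mul_le_mul_of_nonneg_left
        (Real.sqrt_le_sqrt (h.sq_le s hs x hxI' hx.1.le)) zero_le_two)
    have hr0 : 0 < √(2 * √(A x ^ 2 + B x ^ 2)) := by positivity
    have e2 : cn * B x ^ (n - 1) * √(a ^ 2 + b ^ 2) =
        √(2 * √(A x ^ 2 + B x ^ 2)) * hSpAlong n cn A B x := by
      rw [hSpAlong, hSp, mul_div_cancel₀ _ hr0.ne']
    calc C * ((A t - A s) * a + (B t - B s) * b) ≤ C * (D * √(a ^ 2 + b ^ 2)) := by gcongr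
      _ = D * (C * √(a ^ 2 + b ^ 2)) := by ring
      _ ≤ D * (cn * B x ^ (n - 1) * √(a ^ 2 + b ^ 2)) := by rw [hC]; gcongr
      _ ≤ D * (Q * hSpAlong n cn A B x) := by
          rw [e2]
          have := h.hSpAlong_nonneg hcn hxI'
          gcongr
      _ = _ := by ring

theorem modulus_le (h : MonotoneCurve n cn u0 v0 A B) (hn : 2 ≤ n) (hcn : 0 < cn) {s t : ℝ}
    (hs : s ∈ Ico (0 : ℝ) 1) (ht : t ∈ Ico (0 : ℝ) 1) (hst : s ≤ t) :
    cn * ((B s - B t) / 2) ^ n ≤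
      √(2 * √(u0 ^ 2 + v0 ^ 2)) * (arc n cn A B t - arc n cn A B s) := by
  have hBst : B t ≤ B s := h.anti_v hs ht hst
  have hBt := h.v_pos t ht
  obtain ⟨m, hm, e⟩ := intermediate_value_Icc' hst (h.locLip_v.continuousOn.mono
    (Icc_subset_Ico hs.1 ht.2)) (⟨by linarith, by linarith⟩ : (B s + B t) / 2 ∈ Icc (B t) (B s))
  have hmI : m ∈ Ico (0 : ℝ) 1 := ⟨hs.1.trans hm.1, hm.2.trans_lt ht.2⟩
  have h1 := h.chord_le hcn hs hmI hm.1
  have h0 := h.sq_le 0 ⟨le_rfl, one_pos⟩ s hs hs.1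
  rw [h.u_zero, h.v_zero] at h0
  have hm1 := h.monotone_arc hcn hm.1
  have hm2 := h.monotone_arc hcn hm.2
  have hd : (B s - B t) / 2 ≤ √((A m - A s) ^ 2 + (B m - B s) ^ 2) := by
    refine Real.le_sqrt_of_sq_le ?_
    rw [e]
    nlinarith [sq_nonneg (A m - A s)]
  have hd0 : 0 ≤ (B s - B t) / 2 := by linarith
  have hBm : (B s - B t) / 2 ≤ B m := by rw [e]; linarith
  calc cn * ((B s - B t) / 2) ^ n = cn * ((B s - B t) / 2) ^ (n - 1) * ((B s - B t) / 2) := by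
        rw [mul_assoc, ← pow_succ]; congr 2; omega
    _ ≤ cn * B m ^ (n - 1) * √((A m - A s) ^ 2 + (B m - B s) ^ 2) := by
        have := h.v_pos m hmI
        gcongr
    _ ≤ _ := h1
    _ ≤ _ := by
        have : 0 ≤ arc n cn A B m - arc n cn A B s := by linarith
        gcongr

theorem u_le (h : MonotoneCurve n cn u0 v0 A B) {s t : ℝ}
    (hs : s ∈ Ico (0 : ℝ) 1) (ht : t ∈ Ico (0 : ℝ) 1) (hst : s ≤ t) :
    A t ≤ √(A s ^ 2 + B s ^ 2) := by
  refine Real.le_sqrt_of_sq_le ?_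
  nlinarith [h.sq_le s hs t ht hst, sq_nonneg (B t)]

theorem arc_le (h : MonotoneCurve n cn u0 v0 A B) (hn : 2 ≤ n) (hcn : 0 < cn) (hu0 : 0 ≤ u0)
    {t : ℝ} (ht : t ∈ Ico (0 : ℝ) 1) :
    arc n cn A B t ≤ cn * v0 ^ (n - 2) * √v0 * (√(u0 ^ 2 + v0 ^ 2) + v0) := by
  have h00 : (0 : ℝ) ∈ Ico (0 : ℝ) 1 := ⟨le_rfl, one_pos⟩
  set C := cn * v0 ^ (n - 2) * √v0 with hC
  have hv0 : 0 < v0 := by rw [← h.v_zero]; exact h.v_pos 0 h00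
  have hC0 : 0 ≤ C := by positivity
  have hlip := ((h.locLip_u t ht).sub (h.locLip_v t ht)).const_mul C |>.sub
    (h.isLip_arc hcn (Icc 0 t))
  have key := hlip.le_of_deriv_nonneg ht.1 ?_
  · rw [arc_zero, h.u_zero, h.v_zero] at key
    have h1 : A t ≤ √(u0 ^ 2 + v0 ^ 2) := by
      have := h.u_le h00 ht ht.1
      rwa [h.u_zero, h.v_zero] at this
    have h2 := h.v_pos t ht
    have : C * (A t - B t - (u0 - v0)) ≤ C * (√(u0 ^ 2 + v0 ^ 2) + v0) :=
      mul_le_mul_of_nonneg_left (by linarith) hC0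
    linarith
  · filter_upwards [h.ae_hasDerivAt_arc hcn, h.locLip_u.ae_differentiableAt,
      h.locLip_v.ae_differentiableAt] with x h1 h2 h3 hx
    have hxI : x ∈ Ioo (0 : ℝ) 1 := ⟨hx.1, hx.2.trans ht.2⟩
    have hxI' : x ∈ Ico (0 : ℝ) 1 := ⟨hxI.1.le, hxI.2⟩
    have hder := (((h2 hxI).hasDerivAt.sub (h3 hxI).hasDerivAt).const_mul C).sub (h1 hxI)
    have e : deriv (fun x => C * (A x - B x) - arc n cn A B x) x = _ := hder.deriv
    have hnh : Ico (0 : ℝ) 1 ∈ 𝓝 x := Ico_mem_nhds hxI.1 hxI.2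
    have ha : 0 ≤ deriv A x := by
      rw [← derivWithin_of_mem_nhds hnh]; exact h.mono_u.derivWithin_nonneg
    have hb : deriv B x ≤ 0 := by
      rw [← derivWithin_of_mem_nhds hnh]; exact h.anti_v.derivWithin_nonpos
    have := hSp_le hn (u := A x) (a := deriv A x) (b := deriv B x)
      (v0 := v0) hcn (h.v_pos x hxI')
      (by rw [← h.v_zero]; exact h.anti_v h00 hxI' hxI'.1)
    rw [abs_of_nonneg ha, abs_of_nonpos hb] at this
    rw [e, sub_nonneg]
    exact this

theorem arc_lt (h : MonotoneCurve n cn u0 v0 A B) (hn : 2 ≤ n) (hcn : 0 < cn)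
    {t : ℝ} (ht : t ∈ Ico (0 : ℝ) 1) : arc n cn A B t < arc n cn A B 1 := by
  refine (h.monotone_arc hcn ht.2.le).lt_of_ne fun heq => ?_
  have hconst : ∀ᶠ s in 𝓝[<] (1 : ℝ), B s = B t := by
    filter_upwards [Ioo_mem_nhdsLT ht.2] with s hs
    have hsI : s ∈ Ico (0 : ℝ) 1 := ⟨ht.1.trans hs.1.le, hs.2⟩
    have h1 := h.modulus_le hn hcn ht hsI hs.1.le
    have h2 : arc n cn A B s = arc n cn A B t :=
      le_antisymm (heq ▸ h.monotone_arc hcn hs.2.le) (h.monotone_arc hcn hs.1.le)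
    rw [h2, sub_self, mul_zero] at h1
    have h3 : B s ≤ B t := h.anti_v ht hsI hs.1.le
    by_contra hne
    have : 0 < (B t - B s) / 2 := by
      have := lt_of_le_of_ne h3 hne
      linarith
    have : 0 < cn * ((B t - B s) / 2) ^ n := by positivity
    linarith
  have := tendsto_nhds_unique (h.v_tendsto.congr' hconst) tendsto_const_nhds
  exact (h.v_pos t ht).ne this

end MonotoneCurve

/-! ### Profiles -/

/-- Monotone curves parametrized proportionally to `h`-arclength, in a form stable under pointwise
convergence. -/
structure Profile (n : ℕ) (cn u0 v0 : ℝ) (u v : ℝ → ℝ) (L : ℝ) : Prop where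
  u_zero : u 0 = u0
  v_zero : v 0 = v0
  v_one : v 1 = 0
  mono : ∀ s ∈ Icc (0 : ℝ) 1, ∀ t ∈ Icc (0 : ℝ) 1, s ≤ t → u s ≤ u t
  anti : ∀ s ∈ Icc (0 : ℝ) 1, ∀ t ∈ Icc (0 : ℝ) 1, s ≤ t → v t ≤ v s
  sq_le : ∀ s ∈ Icc (0 : ℝ) 1, ∀ t ∈ Icc (0 : ℝ) 1, s ≤ t → u t ^ 2 + v t ^ 2 ≤ u s ^ 2 + v s ^ 2
  chord : ∀ s ∈ Icc (0 : ℝ) 1, ∀ t ∈ Icc (0 : ℝ) 1, s ≤ t →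
    cn * v t ^ (n - 1) * √((u t - u s) ^ 2 + (v t - v s) ^ 2) ≤
      √(2 * √(u s ^ 2 + v s ^ 2)) * (L * (t - s))
  modulus : ∀ s ∈ Icc (0 : ℝ) 1, ∀ t ∈ Icc (0 : ℝ) 1, s ≤ t →
    cn * ((v s - v t) / 2) ^ n ≤ √(2 * √(u0 ^ 2 + v0 ^ 2)) * (L * (t - s))
  length_nonneg : 0 ≤ L
  length_le : L ≤ cn * v0 ^ (n - 2) * √v0 * (√(u0 ^ 2 + v0 ^ 2) + v0)

namespace MonotoneCurve

variable {n : ℕ} {cn u0 v0 : ℝ} {A B : ℝ → ℝ}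

theorem arc_one_pos (h : MonotoneCurve n cn u0 v0 A B) (hn : 2 ≤ n) (hcn : 0 < cn) :
    0 < arc n cn A B 1 := by
  have := h.arc_lt hn hcn ⟨le_rfl, one_pos⟩
  rwa [arc_zero] at this

theorem eq_of_arc_eq (h : MonotoneCurve n cn u0 v0 A B) (hcn : 0 < cn) {s t : ℝ}
    (hs : s ∈ Ico (0 : ℝ) 1) (ht : t ∈ Ico (0 : ℝ) 1) (hst : arc n cn A B s = arc n cn A B t) :
    A s = A t ∧ B s = B t := by
  wlog hle : s ≤ t
  · obtain ⟨h1, h2⟩ := this h hcn ht hs hst.symm (le_of_not_ge hle)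
    exact ⟨h1.symm, h2.symm⟩
  have h1 := h.chord_le hcn hs ht hle
  rw [hst, sub_self, mul_zero] at h1
  have hBt := h.v_pos t ht
  have h2 : √((A t - A s) ^ 2 + (B t - B s) ^ 2) ≤ 0 :=
    nonpos_of_mul_nonpos_right h1 (by positivity)
  have h3 := Real.sqrt_eq_zero'.1 (le_antisymm h2 (Real.sqrt_nonneg _))
  have h4 : (A t - A s) ^ 2 = 0 := by
    nlinarith [sq_nonneg (A t - A s), sq_nonneg (B t - B s)]
  have h5 : (B t - B s) ^ 2 = 0 := by
    nlinarith [sq_nonneg (A t - A s), sq_nonneg (B t - B s)]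
  exact ⟨by linarith [pow_eq_zero_iff two_ne_zero |>.1 h4],
    by linarith [pow_eq_zero_iff two_ne_zero |>.1 h5]⟩

theorem continuous_arc (h : MonotoneCurve n cn u0 v0 A B) (hcn : 0 < cn) :
    Continuous (arc n cn A B) := (h.exists_lipschitzWith_arc hcn).choose_spec.continuous

theorem exists_profile (h : MonotoneCurve n cn u0 v0 A B) (hn : 2 ≤ n) (hcn : 0 < cn)
    (hu0 : 0 ≤ u0) :
    ∃ u v, Profile n cn u0 v0 u v (arc n cn A B 1) ∧
      ∀ t ∈ Ico (0 : ℝ) 1, v (arc n cn A B t / arc n cn A B 1) = B t := by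
  have h00 : (0 : ℝ) ∈ Ico (0 : ℝ) 1 := ⟨le_rfl, one_pos⟩
  have hL := h.arc_one_pos hn hcn
  set L := arc n cn A B 1 with hLdef
  have hex : ∀ s, ∃ t, s ∈ Ico (0 : ℝ) 1 → t ∈ Ico (0 : ℝ) 1 ∧ arc n cn A B t = L * s := by
    intro s
    by_cases hs : s ∈ Ico (0 : ℝ) 1
    · obtain ⟨t, ht, e⟩ := intermediate_value_Icc zero_le_one (h.continuous_arc hcn).continuousOn
        (⟨by rw [arc_zero]; exact mul_nonneg hL.le hs.1, by nlinarith [hs.2]⟩ :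
          L * s ∈ Icc (arc n cn A B 0) (arc n cn A B 1))
      refine ⟨t, fun _ => ⟨⟨ht.1, ht.2.lt_of_ne ?_⟩, e⟩⟩
      rintro rfl
      have : L * s < L := by nlinarith [hs.2]
      linarith
    · exact ⟨0, fun h => absurd h hs⟩
  choose τ hτ' using hex
  have hτ : ∀ s ∈ Ico (0 : ℝ) 1, τ s ∈ Ico (0 : ℝ) 1 := fun s hs => (hτ' s hs).1
  have harc : ∀ s ∈ Ico (0 : ℝ) 1, arc n cn A B (τ s) = L * s := fun s hs => (hτ' s hs).2
  have hτm : ∀ s ∈ Ico (0 : ℝ) 1, ∀ t ∈ Ico (0 : ℝ) 1, s ≤ t → τ s ≤ τ t := by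
    intro s hs t ht hst
    by_contra! hlt
    have h1 := h.monotone_arc hcn hlt.le
    rw [harc s hs, harc t ht] at h1
    have : t ≤ s := le_of_mul_le_mul_left h1 hL
    rw [le_antisymm hst this] at hlt
    exact lt_irrefl _ hlt
  have hτ0 : arc n cn A B (τ 0) = arc n cn A B 0 := by rw [harc 0 h00, arc_zero, mul_zero]
  set S := sSup (A '' Ico 0 1) with hS
  have hbdd : BddAbove (A '' Ico 0 1) := by
    refine ⟨√(A 0 ^ 2 + B 0 ^ 2), ?_⟩
    rintro _ ⟨t, ht, rfl⟩
    exact h.u_le h00 ht ht.1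
  have hleS : ∀ t ∈ Ico (0 : ℝ) 1, A t ≤ S := fun t ht => le_csSup hbdd (mem_image_of_mem A ht)
  have hS0 : 0 ≤ S := by
    have := hleS 0 h00
    rw [h.u_zero] at this
    exact hu0.trans this
  have hSle : ∀ t ∈ Ico (0 : ℝ) 1, S ^ 2 ≤ A t ^ 2 + B t ^ 2 := by
    intro t ht
    rw [← Real.le_sqrt hS0 (by positivity)]
    refine csSup_le ((nonempty_Ico.2 one_pos).image A) ?_
    rintro _ ⟨x, hx, rfl⟩
    rcases le_total t x with htx | htx
    · exact h.u_le ht hx htx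
    · exact (h.mono_u hx ht htx).trans (h.u_le ht ht le_rfl)
  have hAB0 := h.eq_of_arc_eq hcn (hτ 0 h00) h00 hτ0
  have hI : ∀ {s : ℝ}, s ∈ Icc (0 : ℝ) 1 → s < 1 → s ∈ Ico (0 : ℝ) 1 := fun hs h => ⟨hs.1, h⟩
  refine ⟨fun s => if s < 1 then A (τ s) else S, fun s => if s < 1 then B (τ s) else 0,
    ⟨?_, ?_, ?_, ?_, ?_, ?_, ?_, ?_, hL.le, ?_⟩, ?_⟩
  · simp [hAB0.1, h.u_zero]
  · simp [hAB0.2, h.v_zero]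
  · simp
  · intro s hs t ht hst
    by_cases h1 : t < 1
    · have h2 := hst.trans_lt h1
      simp only [h1, h2, if_true]
      exact h.mono_u (hτ s (hI hs h2)) (hτ t (hI ht h1)) (hτm s (hI hs h2) t (hI ht h1) hst)
    · by_cases h2 : s < 1
      · simp only [h1, h2, if_true, if_false]
        exact hleS _ (hτ s (hI hs h2))
      · simp [h1, h2]
  · intro s hs t ht hst
    by_cases h1 : t < 1
    · have h2 := hst.trans_lt h1
      simp only [h1, h2, if_true]
      exact h.anti_v (hτ s (hI hs h2)) (hτ t (hI ht h1)) (hτm s (hI hs h2) t (hI ht h1) hst)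
    · by_cases h2 : s < 1
      · simp only [h1, h2, if_true, if_false]
        exact (h.v_pos _ (hτ s (hI hs h2))).le
      · simp [h1, h2]
  · intro s hs t ht hst
    by_cases h1 : t < 1
    · have h2 := hst.trans_lt h1
      simp only [h1, h2, if_true]
      exact h.sq_le _ (hτ s (hI hs h2)) _ (hτ t (hI ht h1)) (hτm s (hI hs h2) t (hI ht h1) hst)
    · by_cases h2 : s < 1
      · simp only [h1, h2, if_true, if_false]
        have := hSle _ (hτ s (hI hs h2))
        linarith
      · simp [h1, h2]
  · intro s hs t ht hst
    by_cases h1 : t < 1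
    · have h2 := hst.trans_lt h1
      simp only [h1, h2, if_true]
      rw [mul_sub, ← harc s (hI hs h2), ← harc t (hI ht h1)]
      exact h.chord_le hcn (hτ s (hI hs h2)) (hτ t (hI ht h1)) (hτm s (hI hs h2) t (hI ht h1) hst)
    · simp only [h1, if_false]
      rw [zero_pow (by omega), mul_zero, zero_mul]
      have := sub_nonneg.2 hst
      positivity
  · intro s hs t ht hst
    by_cases h1 : t < 1
    · have h2 := hst.trans_lt h1
      simp only [h1, h2, if_true]
      rw [mul_sub, ← harc s (hI hs h2), ← harc t (hI ht h1)]
      exact h.modulus_le hn hcn (hτ s (hI hs h2)) (hτ t (hI ht h1))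
        (hτm s (hI hs h2) t (hI ht h1) hst)
    · by_cases h2 : s < 1
      · simp only [h1, h2, if_true, if_false]
        have ht1 : t = 1 := le_antisymm ht.2 (not_lt.1 h1)
        rw [mul_sub, ← harc s (hI hs h2), ht1, mul_one]
        have l1 : Tendsto (fun t => cn * ((B (τ s) - B t) / 2) ^ n) (𝓝[<] 1)
            (𝓝 (cn * ((B (τ s) - 0) / 2) ^ n)) :=
          (((tendsto_const_nhds.sub h.v_tendsto).div_const 2).pow n).const_mul cn
        have l2 : Tendsto (fun t => √(2 * √(u0 ^ 2 + v0 ^ 2)) *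
            (arc n cn A B t - arc n cn A B (τ s))) (𝓝[<] 1)
            (𝓝 (√(2 * √(u0 ^ 2 + v0 ^ 2)) * (L - arc n cn A B (τ s)))) :=
          (((h.continuous_arc hcn).tendsto 1).mono_left nhdsWithin_le_nhds |>.sub
            tendsto_const_nhds).const_mul _
        refine le_of_tendsto_of_tendsto l1 l2 ?_
        have hs' := hτ s (hI hs h2)
        filter_upwards [Ioo_mem_nhdsLT hs'.2] with x hx
        exact h.modulus_le hn hcn hs' ⟨hs'.1.trans hx.1.le, hx.2⟩ hx.1.le
      · simp only [h1, h2, if_false, sub_zero, zero_div]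
        rw [zero_pow (by omega), mul_zero]
        have := sub_nonneg.2 hst
        positivity
  · refine le_of_tendsto (((h.continuous_arc hcn).tendsto 1).mono_left
      (nhdsWithin_le_nhds (s := Iio 1))) ?_
    filter_upwards [Ioo_mem_nhdsLT (zero_lt_one (α := ℝ))] with t ht
    exact h.arc_le hn hcn hu0 ⟨ht.1.le, ht.2⟩
  · intro t ht
    have h1 : arc n cn A B t / L < 1 := (div_lt_one hL).2 (h.arc_lt hn hcn ht)
    have h2 : 0 ≤ arc n cn A B t / L := by
      refine div_nonneg ?_ hL.le
      rw [← arc_zero (n := n) (cn := cn) (A := A) (B := B)]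
      exact h.monotone_arc hcn ht.1
    simp only [h1, if_true]
    refine (h.eq_of_arc_eq hcn (hτ _ ⟨h2, h1⟩) ht ?_).2
    rw [harc _ ⟨h2, h1⟩, mul_div_cancel₀ _ hL.ne']

end MonotoneCurve

/-! ### Comparison of Rayleigh quotients with those of profiles -/

theorem lintegral_comp_mul_deriv_of_monotone {ψ : ℝ → ℝ} {K : NNReal} (h : LipschitzWith K ψ)
    (hm : Monotone ψ) {a b : ℝ} (hab : a ≤ b) (G : ℝ → ℝ) :
    ∫⁻ t in Ioo a b, ENNReal.ofReal (deriv ψ t * G (ψ t)) =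
      ∫⁻ s in Ioo (ψ a) (ψ b), ENNReal.ofReal (G s) := by
  have himg : ψ '' Icc a b = Icc (ψ a) (ψ b) := by
    refine Subset.antisymm ?_ (intermediate_value_Icc hab h.continuous.continuousOn)
    rintro _ ⟨x, hx, rfl⟩
    exact ⟨hm hx.1, hm hx.2⟩
  rw [setLIntegral_congr (Ioo_ae_eq_Icc (a := a) (b := b)),
    setLIntegral_congr (Ioo_ae_eq_Icc (a := ψ a) (b := ψ b)), ← himg,
    lintegral_image_of_monotone h hm measurableSet_Icc]
  simp_rw [ENNReal.ofReal_mul hm.deriv_nonneg]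

theorem LipschitzWith.abs_deriv_le {f : ℝ → ℝ} {K : NNReal} (h : LipschitzWith K f) (t : ℝ) :
    |deriv f t| ≤ K := by
  simpa using norm_deriv_le_of_lipschitz (x₀ := t) h

/-- The numerator of the Rayleigh quotient along a profile. -/
def profNum (n : ℕ) (cn p : ℝ) (v ω : ℝ → ℝ) : ℝ :=
  ∫ s in Ioo (0 : ℝ) 1, |deriv ω s| ^ p * (cn * v s ^ (n - 1)) ^ p

/-- The denominator of the Rayleigh quotient along a profile. -/
def profDen (p : ℝ) (ω : ℝ → ℝ) : ℝ := ∫ s in Ioo (0 : ℝ) 1, |ω s| ^ p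

/-- Lipschitz test functions vanishing at `0`. -/
def IsTest (p : ℝ) (ω : ℝ → ℝ) : Prop :=
  (∃ K, LipschitzWith K ω) ∧ ω 0 = 0 ∧ 0 < profDen p ω

/-- The values of the Rayleigh quotient along a curve. -/
def rayleighSet (n : ℕ) (cn p : ℝ) (γ : ℝ → ℝ × ℝ) : Set ℝ :=
  {q | ∃ w : ℝ → ℝ, (∃ K, LipschitzOnWith K w (Icc 0 1)) ∧ w 0 = 0 ∧
    IntervalIntegrable (numH n cn p 0 1 (Ico 0 1) γ w) volume 0 1 ∧
    IntervalIntegrable (denH n cn p (Ico 0 1) γ w) volume 0 1 ∧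
    (0 < ∫ t in (0:ℝ)..1, denH n cn p (Ico 0 1) γ w t) ∧
    q = (∫ t in (0:ℝ)..1, numH n cn p 0 1 (Ico 0 1) γ w t) /
      (∫ t in (0:ℝ)..1, denH n cn p (Ico 0 1) γ w t)}

theorem intervalIntegral_eq_Ioo (f : ℝ → ℝ) :
    ∫ t in (0 : ℝ)..1, f t = ∫ t in Ioo (0 : ℝ) 1, f t := by
  rw [intervalIntegral.integral_of_le zero_le_one, integral_Ioc_eq_integral_Ioo]

theorem intervalIntegrable_iff_Ioo {f : ℝ → ℝ} :
    IntervalIntegrable f volume 0 1 ↔ IntegrableOn f (Ioo 0 1) :=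
  intervalIntegrable_iff_integrableOn_Ioo_of_le zero_le_one

theorem nonneg_of_mem_rayleighSet {n : ℕ} {cn p x0 y0 : ℝ} (hcn : 0 < cn) {γ : ℝ → ℝ × ℝ}
    (hγ : MemRh n cn x0 y0 γ) {q : ℝ} (hq : q ∈ rayleighSet n cn p γ) : 0 ≤ q := by
  obtain ⟨w, -, -, -, -, hden, rfl⟩ := hq
  refine div_nonneg ?_ hden.le
  rw [intervalIntegral_eq_Ioo]
  refine setIntegral_nonneg measurableSet_Ioo fun t ht => ?_
  have h1 := (hγ.2.1 t ⟨ht.1.le, ht.2⟩).1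
  have h2 := (hγ.2.1 t ⟨ht.1.le, ht.2⟩).2
  have hF : 0 ≤ Fvol n cn (γ t) := by unfold Fvol; positivity
  have hh : 0 ≤ hSpeedOn n cn (Ico 0 1) γ t := mul_nonneg hF (Real.sqrt_nonneg _)
  unfold numH
  positivity

theorem lambdaH_le_of_mem {n : ℕ} {cn p x0 y0 : ℝ} (hcn : 0 < cn) {γ : ℝ → ℝ × ℝ}
    (hγ : MemRh n cn x0 y0 γ) {q : ℝ} (hq : q ∈ rayleighSet n cn p γ) : lambdaH n cn p γ ≤ q :=
  csInf_le ⟨0, fun _ h => nonneg_of_mem_rayleighSet hcn hγ h⟩ hq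

theorem lambdaH_nonneg {n : ℕ} {cn p x0 y0 : ℝ} (hcn : 0 < cn) {γ : ℝ → ℝ × ℝ}
    (hγ : MemRh n cn x0 y0 γ) : 0 ≤ lambdaH n cn p γ :=
  Real.sInf_nonneg fun _ h => nonneg_of_mem_rayleighSet hcn hγ h

theorem Profile.v_mem {n : ℕ} {cn u0 v0 L : ℝ} {u v : ℝ → ℝ} (h : Profile n cn u0 v0 u v L)
    {s : ℝ} (hs : s ∈ Icc (0 : ℝ) 1) : v s ∈ Icc 0 v0 :=
  ⟨h.v_one ▸ h.anti s hs 1 ⟨zero_le_one, le_rfl⟩ hs.2,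
    h.v_zero ▸ h.anti 0 ⟨le_rfl, zero_le_one⟩ s hs hs.1⟩

theorem Profile.aemeasurable_v {n : ℕ} {cn u0 v0 L : ℝ} {u v : ℝ → ℝ}
    (h : Profile n cn u0 v0 u v L) : AEMeasurable v (volume.restrict (Ioo 0 1)) :=
  (aemeasurable_restrict_of_antitoneOn measurableSet_Icc
    fun _ hs _ ht hst => h.anti _ hs _ ht hst).mono_measure
      (Measure.restrict_mono Ioo_subset_Icc_self le_rfl)

theorem Profile.num_nonneg {n : ℕ} {cn p u0 v0 L : ℝ} {u v ω : ℝ → ℝ} (hcn : 0 < cn)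
    (h : Profile n cn u0 v0 u v L) {s : ℝ} (hs : s ∈ Ioo (0 : ℝ) 1) :
    0 ≤ |deriv ω s| ^ p * (cn * v s ^ (n - 1)) ^ p := by
  have := (h.v_mem (Ioo_subset_Icc_self hs)).1
  positivity

theorem Profile.num_le {n : ℕ} {cn p u0 v0 L : ℝ} {u v ω : ℝ → ℝ} {K : NNReal} (hcn : 0 < cn)
    (hp : 0 ≤ p) (h : Profile n cn u0 v0 u v L) (hω : LipschitzWith K ω) {s : ℝ}
    (hs : s ∈ Ioo (0 : ℝ) 1) :
    |deriv ω s| ^ p * (cn * v s ^ (n - 1)) ^ p ≤ (K : ℝ) ^ p * (cn * v0 ^ (n - 1)) ^ p := by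
  have hv := h.v_mem (Ioo_subset_Icc_self hs)
  have h1 : 0 ≤ v s := hv.1
  have h2 : v s ≤ v0 := hv.2
  gcongr
  exact hω.abs_deriv_le s

theorem Profile.integrable_num {n : ℕ} {cn p u0 v0 L : ℝ} {u v ω : ℝ → ℝ} {K : NNReal}
    (hcn : 0 < cn) (hp : 0 ≤ p) (h : Profile n cn u0 v0 u v L) (hω : LipschitzWith K ω) :
    IntegrableOn (fun s => |deriv ω s| ^ p * (cn * v s ^ (n - 1)) ^ p) (Ioo 0 1) := by
  refine IntegrableOn.of_bound (by simp) ?_ ((K : ℝ) ^ p * (cn * v0 ^ (n - 1)) ^ p) ?_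
  · exact ((((measurable_deriv ω).norm.pow_const p).aemeasurable).mul
      (((h.aemeasurable_v.pow_const _).const_mul cn).pow_const p)).aestronglyMeasurable
  · refine (ae_restrict_iff' measurableSet_Ioo).2 (Eventually.of_forall fun s hs => ?_)
    rw [Real.norm_of_nonneg (h.num_nonneg hcn hs)]
    exact h.num_le hcn hp hω hs

theorem integrable_den {p : ℝ} {ω : ℝ → ℝ} (hp : 0 ≤ p) (hω : Continuous ω) :
    IntegrableOn (fun s => |ω s| ^ p) (Ioo 0 1) :=
  ((hω.abs.rpow_const fun _ => Or.inr hp).integrableOn_Icc (a := 0) (b := 1)).mono_set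
    Ioo_subset_Icc_self

/-- Every curve of `R_h` is dominated by a profile, uniformly over test functions. -/
theorem MemRh.exists_profile {n : ℕ} (hn : 2 ≤ n) {cn p x0 y0 : ℝ} (hcn : 0 < cn) (hy0 : 0 < y0)
    (hxy : y0 ≤ x0) (hp : 2 * (n : ℝ) - 1 ≤ p) {γ : ℝ → ℝ × ℝ} (hγ : MemRh n cn x0 y0 γ) :
    ∃ u v L, Profile n cn (ucoord (x0, y0)) (vcoord (x0, y0)) u v L ∧
      ∀ ω, IsTest p ω → lambdaH n cn p γ ≤ profNum n cn p v ω / (L ^ p * profDen p ω) := by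
  have hp1 : 1 < p := by
    have : (2 : ℝ) ≤ n := by exact_mod_cast hn
    linarith
  have hf := hγ.foldedCurve hxy hy0
  set U := fun t => |ucoord (γ t)|
  set V := fun t => vcoord (γ t)
  set R := fun t => ((γ t).1 ^ 2 + (γ t).2 ^ 2) / 2
  set g := fun t => √(deriv (fun s => (γ s).1) t ^ 2 + deriv (fun s => (γ s).2) t ^ 2)
  have hm := hf.monotoneCurve hn hcn
  set A := sweepU U R
  set B := sweepV V R
  have hu0 : 0 ≤ ucoord (x0, y0) := by rw [← hf.u_zero]; exact abs_nonneg _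
  obtain ⟨u, v, hprof, hv⟩ := hm.exists_profile hn hcn hu0
  have hL := hm.arc_one_pos hn hcn
  obtain ⟨M, hM⟩ := hm.exists_lipschitzWith_arc hcn
  have hmono := hm.monotone_arc hcn
  set σ := MonotoneCurve.arc n cn A B with hσ
  set L := σ 1
  refine ⟨u, v, L, hprof, fun ω hω => ?_⟩
  obtain ⟨⟨K, hK⟩, hω0, hden⟩ := hω
  set ψ := fun t => σ t / L with hψ
  have hψm : Monotone ψ := fun s t hst => div_le_div_of_nonneg_right (hmono hst) hL.le
  obtain ⟨Kψ, hψL⟩ : ∃ K', LipschitzWith K' ψ :=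
    ⟨_, (LipschitzWith.of_dist_le_mul (K := ⟨L⁻¹, (inv_pos.2 hL).le⟩) fun a b => by
      rw [Real.dist_eq, Real.dist_eq, div_sub_div_same, abs_div, abs_of_pos hL, div_eq_inv_mul]
      rfl : LipschitzWith _ fun x => x / L).comp hM⟩
  have hψ0 : ψ 0 = 0 := by simp [hψ, hσ, MonotoneCurve.arc_zero]
  have hψ1 : ψ 1 = 1 := div_self hL.ne'
  have hcv : ∀ G : ℝ → ℝ, ∫⁻ t in Ioo 0 1, ENNReal.ofReal (deriv ψ t * G (ψ t)) =
      ∫⁻ s in Ioo 0 1, ENNReal.ofReal (G s) := fun G => by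
    rw [lintegral_comp_mul_deriv_of_monotone hψL hψm zero_le_one, hψ0, hψ1]
  set W := fun t => ω (ψ t) with hW
  have hWL := hK.comp hψL
  have hFV : ∀ t, Fvol n cn (γ t) = cn * V t ^ (n - 1) := fun t => by
    simp only [Fvol, V, vcoord, mul_pow, mul_assoc]
  have hH : ∀ t ∈ Ioo (0 : ℝ) 1, hSpeedOn n cn (Ico 0 1) γ t = cn * V t ^ (n - 1) * g t :=
    fun t ht => hSpeedOn_eq (Ico_mem_nhds ht.1 ht.2)
  have hnum : ∀ t ∈ Ioo (0 : ℝ) 1, numH n cn p 0 1 (Ico 0 1) γ W t =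
      |deriv W t| ^ p * (cn * V t ^ (n - 1)) ^ p * (cn * V t ^ (n - 1) * g t) ^ (1 - p) := by
    intro t ht
    rw [numH, derivWithin_of_mem_nhds (Icc_mem_nhds ht.1 ht.2), hFV, hH t ht]
  have hdenH : ∀ t ∈ Ioo (0 : ℝ) 1, denH n cn p (Ico 0 1) γ W t =
      |ω (ψ t)| ^ p * (cn * V t ^ (n - 1) * g t) := fun t ht => by rw [denH, hH t ht]
  have hVpos : ∀ t ∈ Ioo (0 : ℝ) 1, 0 < V t := fun t ht => hf.v_pos t ⟨ht.1.le, ht.2⟩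
  have hder : ∀ᵐ t, t ∈ Ioo (0 : ℝ) 1 → deriv ψ t = hSpAlong n cn A B t / L := by
    filter_upwards [hm.ae_hasDerivAt_arc hcn] with t h1 ht using ((h1 ht).div_const L).deriv
  have hVm : AEMeasurable V (volume.restrict (Ioo 0 1)) :=
    hf.locLip_v.aestronglyMeasurable.aemeasurable
  have hgm : AEMeasurable g (volume.restrict (Ioo 0 1)) := hf.g_measurable.aemeasurable
  have hhm : AEMeasurable (fun t => cn * V t ^ (n - 1) * g t) (volume.restrict (Ioo 0 1)) :=
    ((hVm.pow_const _).const_mul cn).mul hgm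
  set G := fun s => |deriv ω s| ^ p * (cn * v s ^ (n - 1)) ^ p with hG
  have hnum_le : ∀ᵐ t, t ∈ Ioo (0 : ℝ) 1 →
      numH n cn p 0 1 (Ico 0 1) γ W t ≤ L ^ (1 - p) * (deriv ψ t * G (ψ t)) := by
    filter_upwards [hder, ae_deriv_comp hψL hψm hK, hf.hSp_sweep_le hn hcn hp] with t h1 h2 h3 ht
    have ht' : t ∈ Ico (0 : ℝ) 1 := ⟨ht.1.le, ht.2⟩
    have hB := hm.v_pos t ht'
    have hvB : v (ψ t) = B t := hv t ht'
    rw [hnum t ht]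
    have e : deriv W t = _ := h2
    rw [e, h1 ht, hG]
    simp only [hvB]
    have h4 := (h3 ht).2
    change 0 < hSpAlong n cn A B t → _ ≤ _ * hSpAlong n cn A B t ^ (1 - p) at h4
    rcases (hm.hSpAlong_nonneg hcn ht').eq_or_lt with h0 | h0
    · rw [← h0]
      simp [Real.zero_rpow (by linarith : p ≠ 0)]
    · set y := hSpAlong n cn A B t
      rw [abs_mul, Real.mul_rpow (abs_nonneg _) (abs_nonneg _),
        abs_of_nonneg (div_nonneg h0.le hL.le),
        Real.div_rpow h0.le hL.le]
      have e1 : y ^ p * y ^ (1 - p) = y := by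
        rw [← Real.rpow_add h0, add_sub_cancel, Real.rpow_one]
      have e2 : L ^ (1 - p) = L / L ^ p := by rw [Real.rpow_sub hL, Real.rpow_one]
      have e3 : 0 < L ^ p := by positivity
      calc |deriv ω (ψ t)| ^ p * (y ^ p / L ^ p) * (cn * V t ^ (n - 1)) ^ p *
            (cn * V t ^ (n - 1) * g t) ^ (1 - p)
          = |deriv ω (ψ t)| ^ p * (y ^ p / L ^ p) * ((cn * V t ^ (n - 1)) ^ p *
            (cn * V t ^ (n - 1) * g t) ^ (1 - p)) := by ring
        _ ≤ |deriv ω (ψ t)| ^ p * (y ^ p / L ^ p) *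
            ((cn * B t ^ (n - 1)) ^ p * y ^ (1 - p)) :=
              mul_le_mul_of_nonneg_left (h4 h0) (by positivity)
        _ = |deriv ω (ψ t)| ^ p * ((cn * B t ^ (n - 1)) ^ p) * (y ^ p * y ^ (1 - p)) / L ^ p := by
            ring
        _ = _ := by rw [e1, e2]; field_simp
  have hGint := hprof.integrable_num hcn (by linarith : 0 ≤ p) hK
  have hGnn : ∀ s ∈ Ioo (0 : ℝ) 1, 0 ≤ G s := fun s hs => hprof.num_nonneg hcn hs
  have hnum_nn : ∀ t ∈ Ioo (0 : ℝ) 1, 0 ≤ numH n cn p 0 1 (Ico 0 1) γ W t := fun t ht => by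
    rw [hnum t ht]
    have := hVpos t ht
    have := hf.g_nonneg t
    positivity
  have hnum_lint : ∫⁻ t in Ioo 0 1, ENNReal.ofReal (numH n cn p 0 1 (Ico 0 1) γ W t) ≤
      ENNReal.ofReal (L ^ (1 - p) * profNum n cn p v ω) := by
    rw [ENNReal.ofReal_mul (by positivity), profNum,
      ofReal_integral_eq_lintegral_ofReal hGint
        ((ae_restrict_iff' measurableSet_Ioo).2 (Eventually.of_forall hGnn)), ← hcv G,
      ← lintegral_const_mul' _ _ ENNReal.ofReal_ne_top]
    refine lintegral_mono_ae ((ae_restrict_iff' measurableSet_Ioo).2 ?_)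
    filter_upwards [hnum_le] with t h1 ht
    rw [← ENNReal.ofReal_mul (by positivity)]
    exact ENNReal.ofReal_le_ofReal (h1 ht)
  have hnum_int : IntegrableOn (numH n cn p 0 1 (Ico 0 1) γ W) (Ioo 0 1) := by
    refine ⟨?_, ?_⟩
    · refine AEStronglyMeasurable.congr (f := fun t => |deriv W t| ^ p *
        (cn * V t ^ (n - 1)) ^ p * (cn * V t ^ (n - 1) * g t) ^ (1 - p)) ?_
        ((ae_restrict_iff' measurableSet_Ioo).2 (Eventually.of_forall fun t ht => (hnum t ht).symm))
      exact (((((measurable_deriv W).norm.pow_const p).aemeasurable).mul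
        (((hVm.pow_const _).const_mul cn).pow_const p)).mul
          (hhm.pow_const _)).aestronglyMeasurable
    · refine (hasFiniteIntegral_iff_ofReal
        ((ae_restrict_iff' measurableSet_Ioo).2 (Eventually.of_forall hnum_nn))).2 ?_
      exact hnum_lint.trans_lt ENNReal.ofReal_lt_top
  have hN0 : 0 ≤ profNum n cn p v ω := setIntegral_nonneg measurableSet_Ioo hGnn
  have hnum_final : ∫ t in Ioo 0 1, numH n cn p 0 1 (Ico 0 1) γ W t ≤
      L ^ (1 - p) * profNum n cn p v ω := by
    rw [← ENNReal.ofReal_le_ofReal_iff (by positivity),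
      ofReal_integral_eq_lintegral_ofReal hnum_int
        ((ae_restrict_iff' measurableSet_Ioo).2 (Eventually.of_forall hnum_nn))]
    exact hnum_lint
  have hWc : Continuous fun t => |ω (ψ t)| ^ p :=
    hWL.continuous.abs.rpow_const fun _ => Or.inr (by linarith)
  have hden_nn : ∀ t ∈ Ioo (0 : ℝ) 1, 0 ≤ denH n cn p (Ico 0 1) γ W t := fun t ht => by
    rw [hdenH t ht]
    have := hVpos t ht
    have := hf.g_nonneg t
    positivity
  have hden_int : IntegrableOn (denH n cn p (Ico 0 1) γ W) (Ioo 0 1) := by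
    refine IntegrableOn.congr_fun (f := fun t => |ω (ψ t)| ^ p * (cn * V t ^ (n - 1) * g t)) ?_
      (fun t ht => (hdenH t ht).symm) measurableSet_Ioo
    obtain ⟨M', hM'0, hM'⟩ := hf.h_le
    obtain ⟨D, hD⟩ := isCompact_Icc.exists_bound_of_continuousOn (hWc.continuousOn (s := Icc 0 1))
    refine IntegrableOn.of_bound (by simp)
      (hWc.aemeasurable.mul hhm).aestronglyMeasurable (D * M') ?_
    refine (ae_restrict_iff' measurableSet_Ioo).2 ?_
    filter_upwards [hM'] with t h1 ht
    have := hVpos t ht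
    have hg := hf.g_nonneg t
    have h2 := hD t (Ioo_subset_Icc_self ht)
    rw [norm_mul]
    refine mul_le_mul h2 ?_ (norm_nonneg _) ((norm_nonneg _).trans h2)
    rw [Real.norm_of_nonneg (by positivity)]
    exact h1 ht
  have hden_final : L * profDen p ω ≤ ∫ t in Ioo 0 1, denH n cn p (Ico 0 1) γ W t := by
    have hdi := integrable_den (p := p) (by linarith) hK.continuous
    rw [← ENNReal.ofReal_le_ofReal_iff (setIntegral_nonneg measurableSet_Ioo hden_nn),
      ofReal_integral_eq_lintegral_ofReal hden_int
        ((ae_restrict_iff' measurableSet_Ioo).2 (Eventually.of_forall hden_nn)),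
      ENNReal.ofReal_mul hL.le, profDen, ofReal_integral_eq_lintegral_ofReal hdi
        (Eventually.of_forall fun s => by positivity), ← hcv,
      ← lintegral_const_mul' _ _ ENNReal.ofReal_ne_top]
    refine lintegral_mono_ae ((ae_restrict_iff' measurableSet_Ioo).2 ?_)
    filter_upwards [hder, hf.hSp_sweep_le hn hcn hp] with t h1 h2 ht
    rw [← ENNReal.ofReal_mul hL.le, hdenH t ht, h1 ht]
    refine ENNReal.ofReal_le_ofReal ?_
    rw [← mul_assoc, mul_div_cancel₀ _ hL.ne', mul_comm]
    exact mul_le_mul_of_nonneg_left (h2 ht).1 (by positivity)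
  have hLD : 0 < L * profDen p ω := mul_pos hL hden
  have hmem : (∫ t in (0:ℝ)..1, numH n cn p 0 1 (Ico 0 1) γ W t) /
      (∫ t in (0:ℝ)..1, denH n cn p (Ico 0 1) γ W t) ∈ rayleighSet n cn p γ := by
    refine ⟨W, ⟨_, hWL.lipschitzOnWith⟩, by simp [hW, hψ0, hω0], intervalIntegrable_iff_Ioo.2
      hnum_int, intervalIntegrable_iff_Ioo.2 hden_int, ?_, rfl⟩
    rw [intervalIntegral_eq_Ioo]
    exact hLD.trans_le hden_final
  refine (lambdaH_le_of_mem hcn hγ hmem).trans ?_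
  rw [intervalIntegral_eq_Ioo, intervalIntegral_eq_Ioo]
  calc _ ≤ L ^ (1 - p) * profNum n cn p v ω / (L * profDen p ω) := by gcongr
    _ = _ := by
      rw [Real.rpow_sub hL, Real.rpow_one]
      have : 0 < L ^ p := by positivity
      field_simp

/-! ### Compactness of the set of profiles -/

section Compactness

open BoundedContinuousFunction

variable {n : ℕ} {cn p u0 v0 L : ℝ} {u v : ℝ → ℝ}

theorem Profile.congr (h : Profile n cn u0 v0 u v L) {u' v' : ℝ → ℝ}
    (hu : EqOn u' u (Icc 0 1)) (hv : EqOn v' v (Icc 0 1)) : Profile n cn u0 v0 u' v' L where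
  u_zero := by rw [hu ⟨le_rfl, zero_le_one⟩, h.u_zero]
  v_zero := by rw [hv ⟨le_rfl, zero_le_one⟩, h.v_zero]
  v_one := by rw [hv ⟨zero_le_one, le_rfl⟩, h.v_one]
  mono s hs t ht hst := by rw [hu hs, hu ht]; exact h.mono s hs t ht hst
  anti s hs t ht hst := by rw [hv hs, hv ht]; exact h.anti s hs t ht hst
  sq_le s hs t ht hst := by rw [hu hs, hu ht, hv hs, hv ht]; exact h.sq_le s hs t ht hst
  chord s hs t ht hst := by rw [hu hs, hu ht, hv hs, hv ht]; exact h.chord s hs t ht hst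
  modulus s hs t ht hst := by rw [hv hs, hv ht]; exact h.modulus s hs t ht hst
  length_nonneg := h.length_nonneg
  length_le := h.length_le

theorem Profile.length_pos (h : Profile n cn u0 v0 u v L) (hcn : 0 < cn) (hv0 : 0 < v0) :
    0 < L := by
  have h1 := h.modulus 0 ⟨le_rfl, zero_le_one⟩ 1 ⟨zero_le_one, le_rfl⟩ zero_le_one
  rw [h.v_zero, h.v_one] at h1
  rcases h.length_nonneg.eq_or_lt with h0 | h0
  · rw [← h0] at h1
    have : 0 < cn * ((v0 - 0) / 2) ^ n := by
      rw [sub_zero]; positivity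
    simp only [zero_mul, mul_zero] at h1
    linarith
  · exact h0

theorem Profile.u_mem (h : Profile n cn u0 v0 u v L) {s : ℝ} (hs : s ∈ Icc (0 : ℝ) 1) :
    u s ∈ Icc u0 (√(u0 ^ 2 + v0 ^ 2)) := by
  have h0 : (0 : ℝ) ∈ Icc (0 : ℝ) 1 := ⟨le_rfl, zero_le_one⟩
  refine ⟨h.u_zero ▸ h.mono 0 h0 s hs hs.1, Real.le_sqrt_of_sq_le ?_⟩
  have := h.sq_le 0 h0 s hs hs.1
  rw [h.u_zero, h.v_zero] at this
  nlinarith [sq_nonneg (v s)]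

theorem Profile.sq_sub_le (h : Profile n cn u0 v0 u v L) (hu0 : 0 ≤ u0) {s t : ℝ}
    (hs : s ∈ Icc (0 : ℝ) 1) (ht : t ∈ Icc (0 : ℝ) 1) (hst : s ≤ t) :
    (u t - u s) ^ 2 ≤ 2 * v0 * (v s - v t) := by
  have h1 := h.sq_le s hs t ht hst
  have h2 := h.mono s hs t ht hst
  have h3 := (h.u_mem hs).1
  have h4 := h.anti s hs t ht hst
  have h5 := h.v_mem hs
  have h6 := h.v_mem ht
  have h7 : (u t - u s) * (2 * u s) ≥ 0 := mul_nonneg (by linarith) (by linarith)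
  have h8 : (v s - v t) * (2 * v0 - v s - v t) ≥ 0 :=
    mul_nonneg (by linarith) (by linarith [h5.2, h6.2])
  nlinarith

/-- A common modulus of continuity for all profiles. -/
def profileModulus (n : ℕ) (cn u0 v0 d : ℝ) : ℝ :=
  let β := 2 * (√(2 * √(u0 ^ 2 + v0 ^ 2)) *
    (cn * v0 ^ (n - 2) * √v0 * (√(u0 ^ 2 + v0 ^ 2) + v0)) / cn * d) ^ ((n : ℝ)⁻¹)
  max (√(2 * v0 * β)) β

theorem tendsto_profileModulus (hn : 2 ≤ n) (cn u0 v0 : ℝ) :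
    Tendsto (profileModulus n cn u0 v0) (𝓝 0) (𝓝 0) := by
  have hn' : ((n : ℝ)⁻¹) ≠ 0 := by positivity
  have hc : Continuous (profileModulus n cn u0 v0) := by
    have := Real.continuous_rpow_const (q := (n : ℝ)⁻¹) (by positivity)
    unfold profileModulus
    fun_prop
  have := hc.tendsto 0
  rwa [show profileModulus n cn u0 v0 0 = 0 by simp [profileModulus, Real.zero_rpow hn']] at this

theorem Profile.sub_le_modulus (h : Profile n cn u0 v0 u v L) (hn : 2 ≤ n) (hcn : 0 < cn)
    (hu0 : 0 ≤ u0) (hv0 : 0 < v0) {s t : ℝ} (hs : s ∈ Icc (0 : ℝ) 1) (ht : t ∈ Icc (0 : ℝ) 1)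
    (hst : s ≤ t) :
    max |u s - u t| |v s - v t| ≤ profileModulus n cn u0 v0 (t - s) := by
  set Λ := cn * v0 ^ (n - 2) * √v0 * (√(u0 ^ 2 + v0 ^ 2) + v0) with hΛ
  have h1 := h.anti s hs t ht hst
  have h2 : ((v s - v t) / 2) ^ n ≤ √(2 * √(u0 ^ 2 + v0 ^ 2)) * Λ / cn * (t - s) := by
    rw [div_mul_eq_mul_div, le_div_iff₀ hcn, mul_comm]
    refine (h.modulus s hs t ht hst).trans ?_
    rw [mul_assoc]
    have := h.length_le
    have : 0 ≤ t - s := by linarith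
    gcongr
  have h3 : v s - v t ≤ 2 * (√(2 * √(u0 ^ 2 + v0 ^ 2)) * Λ / cn * (t - s)) ^ ((n : ℝ)⁻¹) := by
    have h0 : 0 ≤ (v s - v t) / 2 := by linarith
    have := Real.rpow_le_rpow (by positivity) h2 (z := (n : ℝ)⁻¹) (by positivity)
    rw [Real.pow_rpow_inv_natCast h0 (by omega)] at this
    linarith
  unfold profileModulus
  refine max_le_max ?_ ?_
  · refine Real.abs_le_sqrt ?_
    have h4 := h.sq_sub_le hu0 hs ht hst
    calc (u s - u t) ^ 2 = (u t - u s) ^ 2 := by ring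
      _ ≤ _ := h4
      _ ≤ _ := by gcongr
  · rwa [abs_of_nonneg (by linarith)]

theorem Profile.dist_le_modulus (h : Profile n cn u0 v0 u v L) (hn : 2 ≤ n) (hcn : 0 < cn)
    (hu0 : 0 ≤ u0) (hv0 : 0 < v0) {s t : ℝ} (hs : s ∈ Icc (0 : ℝ) 1) (ht : t ∈ Icc (0 : ℝ) 1) :
    dist (u s, v s) (u t, v t) ≤ profileModulus n cn u0 v0 (dist s t) := by
  rw [Prod.dist_eq, Real.dist_eq, Real.dist_eq, Real.dist_eq]
  rcases le_total s t with hst | hst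
  · rw [abs_of_nonpos (sub_nonpos.2 hst : s - t ≤ 0), neg_sub]
    exact h.sub_le_modulus hn hcn hu0 hv0 hs ht hst
  · rw [abs_of_nonneg (sub_nonneg.2 hst : 0 ≤ s - t), abs_sub_comm (u s), abs_sub_comm (v s)]
    exact h.sub_le_modulus hn hcn hu0 hv0 ht hs hst

theorem Profile.continuousOn (h : Profile n cn u0 v0 u v L) (hn : 2 ≤ n) (hcn : 0 < cn)
    (hu0 : 0 ≤ u0) (hv0 : 0 < v0) : ContinuousOn (fun s => (u s, v s)) (Icc 0 1) := by
  rw [continuousOn_iff_continuous_domRestrict]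
  exact (Metric.equicontinuous_of_continuity_modulus _ (tendsto_profileModulus hn cn u0 v0)
    (fun _ : Unit => (Icc (0 : ℝ) 1).domRestrict fun s => (u s, v s))
    fun x y _ => h.dist_le_modulus hn hcn hu0 hv0 x.2 y.2).continuous ()

/-- The first component of a function on `[0,1]`, extended to the line. -/
def extFst (f : Icc (0 : ℝ) 1 →ᵇ ℝ × ℝ) (s : ℝ) : ℝ := (f (projIcc 0 1 zero_le_one s)).1

/-- The second component of a function on `[0,1]`, extended to the line. -/
def extSnd (f : Icc (0 : ℝ) 1 →ᵇ ℝ × ℝ) (s : ℝ) : ℝ := (f (projIcc 0 1 zero_le_one s)).2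

theorem extFst_apply (f : Icc (0 : ℝ) 1 →ᵇ ℝ × ℝ) {s : ℝ} (hs : s ∈ Icc (0 : ℝ) 1) :
    extFst f s = (f ⟨s, hs⟩).1 := by rw [extFst, projIcc_of_mem _ hs]

theorem extSnd_apply (f : Icc (0 : ℝ) 1 →ᵇ ℝ × ℝ) {s : ℝ} (hs : s ∈ Icc (0 : ℝ) 1) :
    extSnd f s = (f ⟨s, hs⟩).2 := by rw [extSnd, projIcc_of_mem _ hs]

/-- The set of all profiles with given initial data. -/
def profileSet (n : ℕ) (cn u0 v0 : ℝ) : Set ((Icc (0 : ℝ) 1 →ᵇ ℝ × ℝ) × ℝ) :=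
  {P | Profile n cn u0 v0 (extFst P.1) (extSnd P.1) P.2}

theorem continuous_extFst (s : ℝ) :
    Continuous fun P : (Icc (0 : ℝ) 1 →ᵇ ℝ × ℝ) × ℝ => extFst P.1 s :=
  ((continuous_eval_const (F := Icc (0 : ℝ) 1 →ᵇ ℝ × ℝ) _).comp continuous_fst).fst

theorem continuous_extSnd (s : ℝ) :
    Continuous fun P : (Icc (0 : ℝ) 1 →ᵇ ℝ × ℝ) × ℝ => extSnd P.1 s :=
  ((continuous_eval_const (F := Icc (0 : ℝ) 1 →ᵇ ℝ × ℝ) _).comp continuous_fst).snd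

theorem Profile.exists_mem_profileSet (h : Profile n cn u0 v0 u v L) (hn : 2 ≤ n) (hcn : 0 < cn)
    (hu0 : 0 ≤ u0) (hv0 : 0 < v0) : ∃ f : Icc (0 : ℝ) 1 →ᵇ ℝ × ℝ, (f, L) ∈ profileSet n cn u0 v0 ∧
      EqOn (extSnd f) v (Icc 0 1) := by
  refine ⟨mkOfCompact ⟨_, (h.continuousOn hn hcn hu0 hv0).domRestrict⟩, ?_, fun s hs => ?_⟩
  · refine h.congr (fun s hs => ?_) fun s hs => ?_
    · rw [extFst_apply _ hs]; rfl
    · rw [extSnd_apply _ hs]; rfl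
  · rw [extSnd_apply _ hs]; rfl

theorem isClosed_profileSet (n : ℕ) (cn u0 v0 : ℝ) : IsClosed (profileSet n cn u0 v0) := by
  have e : profileSet n cn u0 v0 = {P | extFst P.1 0 = u0} ∩ {P | extSnd P.1 0 = v0} ∩
      {P | extSnd P.1 1 = 0} ∩
      {P | ∀ s ∈ Icc (0 : ℝ) 1, ∀ t ∈ Icc (0 : ℝ) 1, s ≤ t → extFst P.1 s ≤ extFst P.1 t} ∩
      {P | ∀ s ∈ Icc (0 : ℝ) 1, ∀ t ∈ Icc (0 : ℝ) 1, s ≤ t → extSnd P.1 t ≤ extSnd P.1 s} ∩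
      {P | ∀ s ∈ Icc (0 : ℝ) 1, ∀ t ∈ Icc (0 : ℝ) 1, s ≤ t →
        extFst P.1 t ^ 2 + extSnd P.1 t ^ 2 ≤ extFst P.1 s ^ 2 + extSnd P.1 s ^ 2} ∩
      {P | ∀ s ∈ Icc (0 : ℝ) 1, ∀ t ∈ Icc (0 : ℝ) 1, s ≤ t →
        cn * extSnd P.1 t ^ (n - 1) *
          √((extFst P.1 t - extFst P.1 s) ^ 2 + (extSnd P.1 t - extSnd P.1 s) ^ 2) ≤
        √(2 * √(extFst P.1 s ^ 2 + extSnd P.1 s ^ 2)) * (P.2 * (t - s))} ∩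
      {P | ∀ s ∈ Icc (0 : ℝ) 1, ∀ t ∈ Icc (0 : ℝ) 1, s ≤ t →
        cn * ((extSnd P.1 s - extSnd P.1 t) / 2) ^ n ≤
          √(2 * √(u0 ^ 2 + v0 ^ 2)) * (P.2 * (t - s))} ∩
      {P | 0 ≤ P.2} ∩ {P | P.2 ≤ cn * v0 ^ (n - 2) * √v0 * (√(u0 ^ 2 + v0 ^ 2) + v0)} := by
    ext P
    constructor
    · intro h
      exact ⟨⟨⟨⟨⟨⟨⟨⟨⟨h.u_zero, h.v_zero⟩, h.v_one⟩, h.mono⟩, h.anti⟩, h.sq_le⟩, h.chord⟩,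
        h.modulus⟩, h.length_nonneg⟩, h.length_le⟩
    · rintro ⟨⟨⟨⟨⟨⟨⟨⟨⟨h1, h2⟩, h3⟩, h4⟩, h5⟩, h6⟩, h7⟩, h8⟩, h9⟩, h10⟩
      exact ⟨h1, h2, h3, h4, h5, h6, h7, h8, h9, h10⟩
  rw [e]
  have hu := continuous_extFst
  have hv := continuous_extSnd
  refine ((((((((((isClosed_eq (hu 0) continuous_const).inter
    (isClosed_eq (hv 0) continuous_const)).inter (isClosed_eq (hv 1) continuous_const)).inter
    ?_).inter ?_).inter ?_).inter ?_).inter ?_).inter ?_).inter ?_)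
  · simp only [ofPred_forall]
    exact isClosed_iInter fun s => isClosed_iInter fun _ => isClosed_iInter fun t =>
      isClosed_iInter fun _ => isClosed_iInter fun _ => isClosed_le (hu s) (hu t)
  · simp only [ofPred_forall]
    exact isClosed_iInter fun s => isClosed_iInter fun _ => isClosed_iInter fun t =>
      isClosed_iInter fun _ => isClosed_iInter fun _ => isClosed_le (hv t) (hv s)
  · simp only [ofPred_forall]
    refine isClosed_iInter fun s => isClosed_iInter fun _ => isClosed_iInter fun t =>
      isClosed_iInter fun _ => isClosed_iInter fun _ => isClosed_le ?_ ?_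
    all_goals have := hu s; have := hu t; have := hv s; have := hv t; fun_prop
  · simp only [ofPred_forall]
    refine isClosed_iInter fun s => isClosed_iInter fun _ => isClosed_iInter fun t =>
      isClosed_iInter fun _ => isClosed_iInter fun _ => isClosed_le ?_ ?_
    all_goals have := hu s; have := hu t; have := hv s; have := hv t; fun_prop
  · simp only [ofPred_forall]
    refine isClosed_iInter fun s => isClosed_iInter fun _ => isClosed_iInter fun t =>
      isClosed_iInter fun _ => isClosed_iInter fun _ => isClosed_le ?_ ?_
    all_goals have := hv s; have := hv t; fun_prop
  · exact isClosed_le continuous_const continuous_snd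
  · exact isClosed_le continuous_snd continuous_const

theorem isCompact_profileSet (hn : 2 ≤ n) (hcn : 0 < cn) (hu0 : 0 ≤ u0) (hv0 : 0 < v0) :
    IsCompact (profileSet n cn u0 v0) := by
  set A : Set (Icc (0 : ℝ) 1 →ᵇ ℝ × ℝ) := Prod.fst '' profileSet n cn u0 v0 with hA
  have hAc : IsCompact (closure A) := by
    refine arzela_ascoli (Icc u0 (√(u0 ^ 2 + v0 ^ 2)) ×ˢ Icc 0 v0)
      (isCompact_Icc.prod isCompact_Icc)
      A ?_ ?_
    · rintro _ x ⟨P, hP, rfl⟩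
      have hP' : Profile n cn u0 v0 (extFst P.1) (extSnd P.1) P.2 := hP
      exact ⟨extFst_apply P.1 x.2 ▸ hP'.u_mem x.2, extSnd_apply P.1 x.2 ▸ hP'.v_mem x.2⟩
    · refine Metric.equicontinuous_of_continuity_modulus _ (tendsto_profileModulus hn cn u0 v0) _ ?_
      rintro x y ⟨_, P, hP, rfl⟩
      have hP' : Profile n cn u0 v0 (extFst P.1) (extSnd P.1) P.2 := hP
      have := hP'.dist_le_modulus hn hcn hu0 hv0 x.2 y.2
      rwa [extFst_apply P.1 x.2, extFst_apply P.1 y.2, extSnd_apply P.1 x.2,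
        extSnd_apply P.1 y.2] at this
  refine (hAc.prod (isCompact_Icc (a := (0 : ℝ))
    (b := cn * v0 ^ (n - 2) * √v0 * (√(u0 ^ 2 + v0 ^ 2) + v0)))).of_isClosed_subset
    (isClosed_profileSet n cn u0 v0) fun P hP => ?_
  have hP' : Profile n cn u0 v0 (extFst P.1) (extSnd P.1) P.2 := hP
  exact ⟨subset_closure ⟨P, hP, rfl⟩, hP'.length_nonneg, hP'.length_le⟩

theorem continuousOn_profNum (hcn : 0 < cn) (hp : 0 ≤ p) {ω : ℝ → ℝ} {K : NNReal}
    (hω : LipschitzWith K ω) :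
    ContinuousOn (fun P : (Icc (0 : ℝ) 1 →ᵇ ℝ × ℝ) × ℝ => profNum n cn p (extSnd P.1) ω)
      (profileSet n cn u0 v0) := by
  refine continuousOn_of_dominated (bound := fun _ => (K : ℝ) ^ p * (cn * v0 ^ (n - 1)) ^ p)
    (fun P hP => (Profile.integrable_num hcn hp hP hω).aestronglyMeasurable) (fun P hP => ?_)
    (integrable_const _) (Eventually.of_forall fun s => ?_)
  · refine (ae_restrict_iff' measurableSet_Ioo).2 (Eventually.of_forall fun s hs => ?_)
    rw [Real.norm_of_nonneg (Profile.num_nonneg hcn hP hs)]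
    exact Profile.num_le hcn hp hP hω hs
  · have h1 := continuous_extSnd s
    have h2 := Real.continuous_rpow_const hp
    exact (continuous_const.mul (h2.comp (continuous_const.mul (h1.pow _)))).continuousOn

theorem profNum_congr {v v' ω : ℝ → ℝ} (h : EqOn v v' (Icc 0 1)) :
    profNum n cn p v ω = profNum n cn p v' ω :=
  setIntegral_congr_fun measurableSet_Ioo fun s hs => by
    simp only [h (Ioo_subset_Icc_self hs)]

theorem Profile.profNum_nonneg {ω : ℝ → ℝ} (hcn : 0 < cn) (h : Profile n cn u0 v0 u v L) :
    0 ≤ profNum n cn p v ω :=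
  setIntegral_nonneg measurableSet_Ioo fun _ hs => h.num_nonneg hcn hs

/-- A profile maximizing the infimum of the Rayleigh quotients. -/
theorem exists_isMax_profile (hn : 2 ≤ n) (hcn : 0 < cn) (hp : 0 ≤ p) (hu0 : 0 ≤ u0) (hv0 : 0 < v0)
    (hne : ∃ u v L, Profile n cn u0 v0 u v L) :
    ∃ u v L, Profile n cn u0 v0 u v L ∧ ∀ u' v' L', Profile n cn u0 v0 u' v' L' →
      ∀ b, (∀ ω, IsTest p ω → b ≤ profNum n cn p v' ω / (L' ^ p * profDen p ω)) →
        ∀ ω, IsTest p ω → b ≤ profNum n cn p v ω / (L ^ p * profDen p ω) := by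
  set J : {ω // IsTest p ω} → (Icc (0 : ℝ) 1 →ᵇ ℝ × ℝ) × ℝ → ENNReal := fun ω P =>
    ENNReal.ofReal (profNum n cn p (extSnd P.1) ω / (P.2 ^ p * profDen p ω)) with hJ
  have husc : UpperSemicontinuousOn (fun P => ⨅ ω, J ω P) (profileSet n cn u0 v0) := by
    refine upperSemicontinuousOn_iInf fun ω => ContinuousOn.upperSemicontinuousOn ?_
    obtain ⟨ω, ⟨K, hK⟩, -, hpos⟩ := ω
    refine ENNReal.continuous_ofReal.comp_continuousOn
      ((continuousOn_profNum hcn hp hK).div ?_ fun P hP => ?_)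
    · exact (((Real.continuous_rpow_const hp).comp continuous_snd).mul
        continuous_const).continuousOn
    · exact (mul_pos (Real.rpow_pos_of_pos (Profile.length_pos hP hcn hv0) _) hpos).ne'
  obtain ⟨u₁, v₁, L₁, h₁⟩ := hne
  obtain ⟨f₁, hf₁, -⟩ := h₁.exists_mem_profileSet hn hcn hu0 hv0
  obtain ⟨P, hP, hmax⟩ := husc.exists_isMaxOn ⟨_, hf₁⟩ (isCompact_profileSet hn hcn hu0 hv0)
  refine ⟨_, _, _, hP, fun u' v' L' h' b hb ω hω => ?_⟩
  obtain ⟨f, hf, hfv⟩ := h'.exists_mem_profileSet hn hcn hu0 hv0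
  have h2 : ENNReal.ofReal b ≤ ⨅ ω, J ω (f, L') := le_iInf fun ω => by
    refine ENNReal.ofReal_le_ofReal ?_
    rw [profNum_congr hfv]
    exact hb _ ω.2
  have h3 := (h2.trans (hmax hf)).trans (iInf_le _ ⟨ω, hω⟩)
  refine (ENNReal.ofReal_le_ofReal_iff (div_nonneg (Profile.profNum_nonneg hcn hP) ?_)).1 h3
  have := Profile.length_pos hP hcn hv0
  have := hω.2.2
  positivity

end Compactness

theorem memRh_vertical {n : ℕ} {cn x0 y0 : ℝ} (hcn : 0 < cn) (hy0 : 0 < y0) (hx0 : 0 < x0) :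
    MemRh n cn x0 y0 fun t => (x0, y0 * (1 - t)) := by
  refine ⟨by simp, fun t ht => ⟨hx0, mul_pos hy0 (by linarith [ht.2])⟩, fun a _ => ?_,
    ⟨cn * (x0 * y0) ^ (n - 1) * y0, ?_⟩, ?_⟩
  · have : ContDiff ℝ 1 fun t : ℝ => (x0, y0 * (1 - t)) := by fun_prop
    exact this.contDiffOn.exists_lipschitzOnWith one_ne_zero (convex_Icc _ _) isCompact_Icc
  · filter_upwards [compl_mem_ae_iff.2 (measure_singleton (0 : ℝ))] with t h0 ht
    have ht' : t ∈ Ioo (0 : ℝ) 1 := ⟨lt_of_le_of_ne ht.1 (Ne.symm h0), ht.2⟩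
    have hd : deriv (fun s : ℝ => y0 * (1 - s)) t = -y0 := by simp
    rw [hSpeed, hSpeedOn_eq (Ico_mem_nhds ht'.1 ht'.2), hd]
    have h1 : √(deriv (fun _ : ℝ => x0) t ^ 2 + (-y0) ^ 2) = y0 := by
      simp [Real.sqrt_sq hy0.le]
    rw [h1]
    have : 0 ≤ 1 - t := by linarith [ht.2]
    have : y0 * (1 - t) ≤ y0 := by nlinarith [ht.1]
    gcongr
  · have : Tendsto (fun t : ℝ => x0 * (y0 * (1 - t))) (𝓝 1) (𝓝 (x0 * (y0 * (1 - 1)))) :=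
      Continuous.tendsto (by fun_prop) 1
    simp only [sub_self, mul_zero] at this
    exact this.mono_left nhdsWithin_le_nhds

/-- There is a profile whose Rayleigh quotients dominate `λ_{1,p}` of all curves of `R_h`. -/
theorem exists_maximal_profile {n : ℕ} (hn : 2 ≤ n) {cn p x0 y0 : ℝ} (hcn : 0 < cn) (hy0 : 0 < y0)
    (hxy : y0 ≤ x0) (hp : 2 * (n : ℝ) - 1 ≤ p) :
    ∃ u v L, Profile n cn (ucoord (x0, y0)) (vcoord (x0, y0)) u v L ∧
      ∀ γ, MemRh n cn x0 y0 γ → ∀ ω, IsTest p ω →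
        lambdaH n cn p γ ≤ profNum n cn p v ω / (L ^ p * profDen p ω) := by
  have hp0 : 0 ≤ p := by
    have : (2 : ℝ) ≤ n := by exact_mod_cast hn
    linarith
  have hx0 : 0 < x0 := by linarith
  have hu0 : 0 ≤ ucoord (x0, y0) := by simp only [ucoord]; nlinarith
  have hv0 : 0 < vcoord (x0, y0) := mul_pos hx0 hy0
  obtain ⟨u₁, v₁, L₁, h₁, -⟩ := MemRh.exists_profile hn hcn hy0 hxy hp (memRh_vertical hcn hy0 hx0)
  obtain ⟨u, v, L, h, hmax⟩ := exists_isMax_profile hn hcn hp0 hu0 hv0 ⟨u₁, v₁, L₁, h₁⟩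
  refine ⟨u, v, L, h, fun γ hγ => ?_⟩
  obtain ⟨u', v', L', h', hb⟩ := MemRh.exists_profile hn hcn hy0 hxy hp hγ
  exact hmax u' v' L' h' _ hb

/-! ### Curves parametrized by the total variation of `(u, v)` -/

/-- Continuous monotone curves in the coordinates `(u, v)`, parametrized proportionally to the
variation of `u - v`. -/
structure BalancedCurve (u0 v0 T : ℝ) (U V : ℝ → ℝ) : Prop where
  speed_pos : 0 < T
  mono : Monotone U
  anti : Antitone V
  increment : ∀ s ∈ Icc (0 : ℝ) 1, ∀ t ∈ Icc (0 : ℝ) 1, U t - U s + (V s - V t) = T * (t - s)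
  v_pos : ∀ t ∈ Ico (0 : ℝ) 1, 0 < V t
  v_nonneg : ∀ t, 0 ≤ V t
  v_le : ∀ t, V t ≤ v0
  sq_anti : Antitone fun t => U t ^ 2 + V t ^ 2
  u_zero : U 0 = u0
  v_zero : V 0 = v0
  v_one : V 1 = 0

theorem Profile.exists_balancedCurve {n : ℕ} {cn u0 v0 L : ℝ} {u v : ℝ → ℝ}
    (h : Profile n cn u0 v0 u v L) (hn : 2 ≤ n) (hcn : 0 < cn) (hu0 : 0 ≤ u0) (hv0 : 0 < v0) :
    ∃ T U V τ, BalancedCurve u0 v0 T U V ∧ ContinuousOn τ (Icc 0 1) ∧ MonotoneOn τ (Icc 0 1) ∧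
      τ 0 = 0 ∧ τ 1 = 1 ∧ ∀ s ∈ Icc (0 : ℝ) 1, U (τ s) = u s ∧ V (τ s) = v s := by
  have h0 : (0 : ℝ) ∈ Icc (0 : ℝ) 1 := ⟨le_rfl, zero_le_one⟩
  have h1 : (1 : ℝ) ∈ Icc (0 : ℝ) 1 := ⟨zero_le_one, le_rfl⟩
  set T := v0 + u 1 - u0 with hTdef
  have hT : 0 < T := by linarith [(h.u_mem h1).1]
  set τ := fun s => (v0 - v s + u s - u0) / T with hτ
  have hc := h.continuousOn hn hcn hu0 hv0
  have hτc : ContinuousOn τ (Icc 0 1) :=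
    (((continuousOn_const.sub hc.snd).add hc.fst).sub continuousOn_const).div_const T
  have hsub : ∀ s t, T * (τ t - τ s) = u t - u s + (v s - v t) := fun s t => by
    simp only [hτ]; field_simp; ring
  have hτm : MonotoneOn τ (Icc 0 1) := fun s hs t ht hst => by
    have := hsub s t
    have h2 : 0 ≤ T * (τ t - τ s) := by linarith [h.mono s hs t ht hst, h.anti s hs t ht hst]
    linarith [nonneg_of_mul_nonneg_right h2 hT]
  have hτ0 : τ 0 = 0 := by simp [hτ, h.u_zero, h.v_zero]
  have hτ1 : τ 1 = 1 := by
    simp only [hτ, h.v_one]; rw [div_eq_one_iff_eq hT.ne']; ring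
  have heq : ∀ s ∈ Icc (0 : ℝ) 1, ∀ t ∈ Icc (0 : ℝ) 1, τ s = τ t → u s = u t ∧ v s = v t := by
    intro s hs t ht hst
    wlog hle : s ≤ t
    · obtain ⟨e1, e2⟩ := this h hn hcn hu0 hv0 h0 h1 hTdef hT hτ hc hτc hsub hτm hτ0 hτ1 t ht s hs
        hst.symm (le_of_not_ge hle)
      exact ⟨e1.symm, e2.symm⟩
    have h2 := hsub s t
    rw [hst, sub_self, mul_zero] at h2
    have := h.mono s hs t ht hle
    have := h.anti s hs t ht hle
    constructor <;> linarith
  have hsurj : ∀ x : ℝ, ∃ s ∈ Icc (0 : ℝ) 1, τ s = projIcc 0 1 zero_le_one x := fun x => by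
    have := intermediate_value_Icc zero_le_one hτc
    rw [hτ0, hτ1] at this
    exact this (projIcc 0 1 zero_le_one x).2
  choose σ hσI hσ using hsurj
  have hσm : ∀ x y, x ≤ y → σ x ≤ σ y ∨ (u (σ x) = u (σ y) ∧ v (σ x) = v (σ y)) := by
    intro x y hxy
    rcases le_or_gt (σ x) (σ y) with hle | hlt
    · exact Or.inl hle
    · refine Or.inr (heq _ (hσI x) _ (hσI y) (le_antisymm ?_ (hτm (hσI y) (hσI x) hlt.le)))
      rw [hσ, hσ]
      exact monotone_projIcc zero_le_one hxy
  have hστ : ∀ s ∈ Icc (0 : ℝ) 1, u (σ (τ s)) = u s ∧ v (σ (τ s)) = v s := by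
    intro s hs
    refine heq _ (hσI _) _ hs ?_
    rw [hσ, projIcc_of_mem]
    exact ⟨hτ0 ▸ hτm h0 hs hs.1, hτ1 ▸ hτm hs h1 hs.2⟩
  refine ⟨T, fun x => u (σ x), fun x => v (σ x), τ, ⟨hT, fun x y hxy => ?_, fun x y hxy => ?_,
    fun s hs t ht => ?_, fun t ht => ?_, fun t => (h.v_mem (hσI t)).1, fun t => (h.v_mem (hσI t)).2,
    fun x y hxy => ?_, ?_, ?_, ?_⟩, hτc, hτm, hτ0, hτ1, hστ⟩
  · rcases hσm x y hxy with h2 | h2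
    · exact h.mono _ (hσI x) _ (hσI y) h2
    · exact h2.1.le
  · rcases hσm x y hxy with h2 | h2
    · exact h.anti _ (hσI x) _ (hσI y) h2
    · exact h2.2.ge
  · rw [← hsub, hσ, hσ, projIcc_of_mem _ hs, projIcc_of_mem _ ht]
  · refine lt_of_le_of_ne (h.v_mem (hσI t)).1 fun hv => ?_
    have h2 := h.sq_le _ (hσI t) 1 h1 (hσI t).2
    have h3 := h.mono _ (hσI t) 1 h1 (hσI t).2
    have h4 := (h.u_mem (hσI t)).1
    have h5 : u 1 = u (σ t) := by
      rw [← hv, h.v_one] at h2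
      refine le_antisymm (abs_le_of_sq_le_sq' ?_ (hu0.trans h4)).2 h3
      linarith
    have h6 := hsub (σ t) 1
    rw [h5, h.v_one, ← hv, hτ1, hσ, projIcc_of_mem _ (Ico_subset_Icc_self ht)] at h6
    have : T * (1 - t) > 0 := mul_pos hT (by linarith [ht.2])
    simp only [sub_self, add_zero] at h6
    linarith
  · rcases hσm x y hxy with h2 | h2
    · exact h.sq_le _ (hσI x) _ (hσI y) h2
    · simp only [h2.1, h2.2, le_refl]
  · have := (hστ 0 h0).1
    rwa [hτ0, h.u_zero] at this
  · have := (hστ 0 h0).2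
    rwa [hτ0, h.v_zero] at this
  · have := (hστ 1 h1).2
    rwa [hτ1, h.v_one] at this

namespace BalancedCurve

variable {n : ℕ} {cn u0 v0 T : ℝ} {U V : ℝ → ℝ}

theorem abs_sub_le (h : BalancedCurve u0 v0 T U V) {s t : ℝ} (hs : s ∈ Icc (0 : ℝ) 1)
    (ht : t ∈ Icc (0 : ℝ) 1) : |U s - U t| ≤ T * |s - t| ∧ |V s - V t| ≤ T * |s - t| := by
  have h1 := h.increment s hs t ht
  rcases le_total s t with hst | hst
  · have h2 := h.mono hst
    have h3 := h.anti hst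
    rw [abs_sub_comm s t, abs_of_nonneg (sub_nonneg.2 hst), ← h1, abs_of_nonpos (by linarith),
      abs_of_nonneg (by linarith)]
    constructor <;> linarith
  · have h2 := h.mono hst
    have h3 := h.anti hst
    rw [abs_of_nonneg (sub_nonneg.2 hst), abs_of_nonneg (by linarith),
      abs_of_nonpos (by linarith)]
    constructor <;> linarith

theorem isLip_u (h : BalancedCurve u0 v0 T U V) : IsLip U (Icc 0 1) :=
  ⟨T, h.speed_pos.le, fun _ hs _ ht => (h.abs_sub_le hs ht).1⟩

theorem isLip_v (h : BalancedCurve u0 v0 T U V) : IsLip V (Icc 0 1) :=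
  ⟨T, h.speed_pos.le, fun _ hs _ ht => (h.abs_sub_le hs ht).2⟩

theorem deriv_sub_deriv (h : BalancedCurve u0 v0 T U V) {t : ℝ} (ht : t ∈ Ioo (0 : ℝ) 1)
    (hU : DifferentiableAt ℝ U t) (hV : DifferentiableAt ℝ V t) : deriv U t - deriv V t = T := by
  have h1 : (fun s => U s - V s) =ᶠ[𝓝 t] fun s => T * s + (u0 - v0) := by
    filter_upwards [Ioo_mem_nhds ht.1 ht.2] with s hs
    have := h.increment 0 ⟨le_rfl, zero_le_one⟩ s (Ioo_subset_Icc_self hs)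
    rw [h.u_zero, h.v_zero] at this
    linarith
  have h2 := h1.deriv_eq
  rw [deriv_fun_sub hU hV] at h2
  simpa using h2

theorem monotoneCurve (h : BalancedCurve u0 v0 T U V) (hn : 2 ≤ n) (hcn : 0 < cn) :
    MonotoneCurve n cn u0 v0 U V where
  locLip_u _ ha := h.isLip_u.mono (Icc_subset_Icc_right ha.2.le)
  locLip_v _ ha := h.isLip_v.mono (Icc_subset_Icc_right ha.2.le)
  mono_u := h.mono.monotoneOn _
  anti_v := h.anti.antitoneOn _
  v_pos := h.v_pos
  sq_le _ _ _ _ hst := h.sq_anti hst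
  u_zero := h.u_zero
  v_zero := h.v_zero
  v_tendsto := by
    have := (h.isLip_v.continuousOn 1 ⟨zero_le_one, le_rfl⟩).mono_left
      (nhdsWithin_mono _ Ioo_subset_Icc_self)
    rwa [h.v_one, nhdsWithin_Ioo_eq_nhdsLT one_pos] at this
  h_le := by
    have hv0 : 0 ≤ v0 := h.v_zero ▸ h.v_nonneg 0
    refine ⟨cn * v0 ^ (n - 2) * √v0 * T, by have := h.speed_pos; positivity, ?_⟩
    filter_upwards [h.isLip_u.ae_differentiableAt, h.isLip_v.ae_differentiableAt] with t h1 h2 ht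
    refine (hSp_le hn hcn (h.v_pos t ⟨ht.1.le, ht.2⟩) (h.v_le t)).trans_eq ?_
    rw [← h.deriv_sub_deriv ht (h1 ht) (h2 ht), abs_of_nonneg h.mono.deriv_nonneg,
      abs_of_nonpos h.anti.deriv_nonpos, sub_eq_add_neg]

end BalancedCurve

/-- The curve in the quarter plane with given coordinates `(u, v)`. -/
def planeCurve (U V : ℝ → ℝ) (t : ℝ) : ℝ × ℝ :=
  (√(√(U t ^ 2 + V t ^ 2) + U t), √(√(U t ^ 2 + V t ^ 2) - U t))

theorem abs_le_sqrt_sq_add_sq (a b : ℝ) : |a| ≤ √(a ^ 2 + b ^ 2) :=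
  Real.abs_le_sqrt (by nlinarith [sq_nonneg b])

theorem ucoord_planeCurve (U V : ℝ → ℝ) (t : ℝ) : ucoord (planeCurve U V t) = U t := by
  have h := abs_le.1 (abs_le_sqrt_sq_add_sq (U t) (V t))
  simp only [ucoord, planeCurve]
  rw [Real.sq_sqrt (by linarith), Real.sq_sqrt (by linarith)]
  ring

theorem vcoord_planeCurve {U V : ℝ → ℝ} {t : ℝ} (hV : 0 ≤ V t) :
    vcoord (planeCurve U V t) = V t := by
  have h := abs_le.1 (abs_le_sqrt_sq_add_sq (U t) (V t))
  simp only [vcoord, planeCurve]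
  rw [← Real.sqrt_mul (by linarith), ← sq_sub_sq, Real.sq_sqrt (by positivity),
    add_sub_cancel_left, Real.sqrt_sq hV]

theorem hSpeedOn_planeCurve {n : ℕ} {cn : ℝ} {U V : ℝ → ℝ} {S : Set ℝ} {t : ℝ} (hS : S ∈ 𝓝 t)
    (hV : ∀ t, 0 ≤ V t) (hVt : 0 < V t) (hU' : DifferentiableAt ℝ U t)
    (hV' : DifferentiableAt ℝ V t) :
    hSpeedOn n cn S (planeCurve U V) t = hSpAlong n cn U V t := by
  have hr : |U t| < √(U t ^ 2 + V t ^ 2) := Real.lt_sqrt_of_sq_lt (by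
    rw [sq_abs]; nlinarith [pow_pos hVt 2])
  obtain ⟨hr1, hr2⟩ := abs_lt.1 hr
  have hsq : U t ^ 2 + V t ^ 2 ≠ 0 := by positivity
  have hrd : DifferentiableAt ℝ (fun t => √(U t ^ 2 + V t ^ 2)) t :=
    ((hU'.pow 2).add (hV'.pow 2)).sqrt hsq
  have hx : DifferentiableAt ℝ (fun s => (planeCurve U V s).1) t :=
    (hrd.add hU').sqrt (by simp only [Pi.add_apply]; linarith)
  have hy : DifferentiableAt ℝ (fun s => (planeCurve U V s).2) t :=
    (hrd.sub hU').sqrt (by simp only [Pi.sub_apply]; linarith)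
  rw [hSpeedOn_eq hS, hSpAlong, hSp]
  set x := fun s => (planeCurve U V s).1 with hxdef
  set y := fun s => (planeCurve U V s).2 with hydef
  have hUeq : U = fun s => (x s ^ 2 - y s ^ 2) / 2 :=
    funext fun s => (ucoord_planeCurve U V s).symm
  have hVeq : V = fun s => x s * y s := funext fun s => (vcoord_planeCurve (hV s)).symm
  have hU1 : deriv U t = x t * deriv x t - y t * deriv y t := by
    have := (((hx.hasDerivAt.pow 2).sub (hy.hasDerivAt.pow 2)).div_const 2).deriv
    rw [hUeq]
    refine Eq.trans this ?_
    push_cast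
    ring
  have hV1 : deriv V t = deriv x t * y t + x t * deriv y t := by
    rw [hVeq]
    exact (hx.hasDerivAt.mul hy.hasDerivAt).deriv
  have hsum : x t ^ 2 + y t ^ 2 = 2 * √(U t ^ 2 + V t ^ 2) := by
    simp only [hxdef, hydef, planeCurve]
    rw [Real.sq_sqrt (by linarith), Real.sq_sqrt (by linarith)]
    ring
  have hV2 : (planeCurve U V t).1 * (planeCurve U V t).2 = V t := vcoord_planeCurve (hV t)
  have hsq2 : deriv U t ^ 2 + deriv V t ^ 2 =
      2 * √(U t ^ 2 + V t ^ 2) * (deriv x t ^ 2 + deriv y t ^ 2) := by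
    rw [hU1, hV1, ← hsum]; ring
  have hpos : 0 < √(2 * √(U t ^ 2 + V t ^ 2)) := by positivity
  rw [hV2, hsq2, Real.sqrt_mul (by positivity), mul_left_comm, mul_div_cancel_left₀ _ hpos.ne']

namespace BalancedCurve

variable {n : ℕ} {cn p x0 y0 u0 v0 T : ℝ} {U V : ℝ → ℝ}

theorem ae_hSpeedOn_planeCurve (h : BalancedCurve u0 v0 T U V) (n : ℕ) (cn : ℝ) :
    ∀ᵐ t, t ∈ Ioo (0 : ℝ) 1 →
      hSpeedOn n cn (Ico 0 1) (planeCurve U V) t = hSpAlong n cn U V t := by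
  filter_upwards [h.isLip_u.ae_differentiableAt, h.isLip_v.ae_differentiableAt] with t h1 h2 ht
  exact hSpeedOn_planeCurve (Ico_mem_nhds ht.1 ht.2) h.v_nonneg (h.v_pos t ⟨ht.1.le, ht.2⟩) (h1 ht)
    (h2 ht)

theorem memRhPlus (h : BalancedCurve (ucoord (x0, y0)) (vcoord (x0, y0)) T U V) (hn : 2 ≤ n)
    (hcn : 0 < cn) (hx0 : 0 < x0) (hy0 : 0 < y0) :
    MemRhPlus n cn x0 y0 (planeCurve U V) := by
  have hm := h.monotoneCurve hn hcn
  have hUc := h.isLip_u.continuousOn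
  have hVc := h.isLip_v.continuousOn
  have hr : ∀ t ∈ Ico (0 : ℝ) 1, |U t| < √(U t ^ 2 + V t ^ 2) := fun t ht =>
    Real.lt_sqrt_of_sq_lt (by rw [sq_abs]; nlinarith [pow_pos (h.v_pos t ht) 2])
  refine ⟨?_, fun t _ => ⟨Real.sqrt_nonneg _, Real.sqrt_nonneg _⟩,
    ⟨⟨Real.sqrt_nonneg _, Real.sqrt_nonneg _⟩, ?_⟩, ?_, fun t ht => ?_, fun a ha => ?_, ?_, ?_⟩
  · unfold planeCurve; fun_prop
  · refine mul_eq_zero.1 ((vcoord_planeCurve (h.v_nonneg 1)).trans h.v_one)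
  · have e : ucoord (x0, y0) ^ 2 + vcoord (x0, y0) ^ 2 = ((x0 ^ 2 + y0 ^ 2) / 2) ^ 2 := by
      simp only [ucoord, vcoord]; ring
    rw [planeCurve, h.u_zero, h.v_zero, e, Real.sqrt_sq (by positivity), Prod.mk.injEq]
    constructor <;> simp only [ucoord]
    · rw [← add_div, add_add_sub_cancel, ← two_mul, mul_div_cancel_left₀ _ two_ne_zero,
        Real.sqrt_sq hx0.le]
    · rw [← sub_div, add_sub_sub_cancel, ← two_mul, mul_div_cancel_left₀ _ two_ne_zero,
        Real.sqrt_sq hy0.le]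
  · have := abs_lt.1 (hr t ht)
    exact ⟨Real.sqrt_pos.2 (by linarith), Real.sqrt_pos.2 (by linarith)⟩
  · have hU := hm.locLip_u a ha
    have hV := hm.locLip_v a ha
    have hr' : ∀ t ∈ Icc 0 a, |U t| < √(U t ^ 2 + V t ^ 2) := fun t ht =>
      hr t ⟨ht.1, ht.2.trans_lt ha.2⟩
    have hR : IsLip (fun t => √(U t ^ 2 + V t ^ 2)) (Icc 0 a) := by
      have : IsLip (fun t => U t * U t + V t * V t) (Icc 0 a) :=
        (hU.mul isCompact_Icc hU).add (hV.mul isCompact_Icc hV)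
      simp only [← sq] at this
      refine this.sqrt isCompact_Icc fun t ht => ?_
      have := h.v_pos t ⟨ht.1, ht.2.trans_lt ha.2⟩
      positivity
    obtain ⟨K1, h1⟩ := ((hR.add hU).sqrt isCompact_Icc fun t ht => by
      linarith [abs_lt.1 (hr' t ht)]).lipschitzOnWith
    obtain ⟨K2, h2⟩ := ((hR.sub hU).sqrt isCompact_Icc fun t ht => by
      linarith [abs_lt.1 (hr' t ht)]).lipschitzOnWith
    exact ⟨max K1 K2, h1.prodMk h2⟩
  · obtain ⟨M, -, hM⟩ := hm.h_le
    refine ⟨M, ?_⟩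
    filter_upwards [hM, h.ae_hSpeedOn_planeCurve n cn,
      compl_mem_ae_iff.2 (measure_singleton (0 : ℝ))] with t h1 h2 h0 ht
    have ht' : t ∈ Ioo (0 : ℝ) 1 := ⟨lt_of_le_of_ne ht.1 (Ne.symm h0), ht.2⟩
    exact (h2 ht').trans_le (h1 ht')
  · refine hm.v_tendsto.congr fun t => ?_
    exact (vcoord_planeCurve (h.v_nonneg t)).symm

theorem hSpAlong_ge (h : BalancedCurve u0 v0 T U V) (hcn : 0 < cn) {t : ℝ}
    (ht : t ∈ Ioo (0 : ℝ) 1) (hU : DifferentiableAt ℝ U t) (hV : DifferentiableAt ℝ V t) :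
    cn * V t ^ (n - 1) * (T / (2 * √(2 * √(u0 ^ 2 + v0 ^ 2)))) ≤ hSpAlong n cn U V t := by
  have h1 := h.deriv_sub_deriv ht hU hV
  have hT := h.speed_pos
  have hVt := h.v_pos t ⟨ht.1.le, ht.2⟩
  have h2 : T / 2 ≤ √(deriv U t ^ 2 + deriv V t ^ 2) :=
    Real.le_sqrt_of_sq_le (by
      rw [← h1]
      nlinarith [sq_nonneg (deriv U t + deriv V t), sq_nonneg (deriv U t), sq_nonneg (deriv V t)])
  have h3 : √(2 * √(U t ^ 2 + V t ^ 2)) ≤ √(2 * √(u0 ^ 2 + v0 ^ 2)) := by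
    have := h.sq_anti ht.1.le
    simp only [h.u_zero, h.v_zero] at this
    gcongr
  have h4 : 0 < √(2 * √(U t ^ 2 + V t ^ 2)) := by positivity
  rw [hSpAlong, hSp, ← div_div, ← mul_div_assoc]
  gcongr

theorem ae_hSpAlong_pos (h : BalancedCurve u0 v0 T U V) (n : ℕ) (hcn : 0 < cn) :
    ∀ᵐ t, t ∈ Ioo (0 : ℝ) 1 → 0 < hSpAlong n cn U V t := by
  filter_upwards [h.isLip_u.ae_differentiableAt, h.isLip_v.ae_differentiableAt] with t h1 h2 ht
  refine lt_of_lt_of_le ?_ (h.hSpAlong_ge (n := n) hcn ht (h1 ht) (h2 ht))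
  have := h.v_pos t ⟨ht.1.le, ht.2⟩
  have hv0 : 0 < v0 := this.trans_le (h.v_le t)
  have := h.speed_pos
  positivity

theorem Fvol_planeCurve (h : BalancedCurve u0 v0 T U V) (n : ℕ) (cn t : ℝ) :
    Fvol n cn (planeCurve U V t) = cn * V t ^ (n - 1) := by
  rw [Fvol, mul_assoc, ← mul_pow]
  exact congrArg (fun z => cn * z ^ (n - 1)) (vcoord_planeCurve (h.v_nonneg t))

/-- The Rayleigh integrands along the plane curve. -/
theorem ae_num_den_eq (h : BalancedCurve u0 v0 T U V) (n : ℕ) (cn p : ℝ) (w : ℝ → ℝ) :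
    ∀ᵐ t, t ∈ Ioo (0 : ℝ) 1 → numH n cn p 0 1 (Ico 0 1) (planeCurve U V) w t =
        |deriv w t| ^ p * (cn * V t ^ (n - 1)) ^ p * hSpAlong n cn U V t ^ (1 - p) ∧
      denH n cn p (Ico 0 1) (planeCurve U V) w t = |w t| ^ p * hSpAlong n cn U V t := by
  filter_upwards [h.ae_hSpeedOn_planeCurve n cn] with t h1 ht
  rw [numH, denH, h1 ht, h.Fvol_planeCurve,
    derivWithin_of_mem_nhds (Icc_mem_nhds ht.1 ht.2)]
  exact ⟨rfl, rfl⟩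

theorem rayleighSet_nonempty (h : BalancedCurve u0 v0 T U V) (hn : 2 ≤ n) (hcn : 0 < cn)
    (hp : 1 < p) : (rayleighSet n cn p (planeCurve U V)).Nonempty := by
  have hm := h.monotoneCurve hn hcn
  have hT := h.speed_pos
  have hv0 : 0 < v0 := h.v_zero ▸ h.v_pos 0 ⟨le_rfl, one_pos⟩
  have hVm : AEMeasurable V (volume.restrict (Ioo 0 1)) :=
    hm.locLip_v.aestronglyMeasurable.aemeasurable
  have hhm : AEMeasurable (hSpAlong n cn U V) (volume.restrict (Ioo 0 1)) :=
    hm.aestronglyMeasurable_hSpAlong.aemeasurable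
  have heq := (ae_restrict_iff' measurableSet_Ioo).2 (h.ae_num_den_eq n cn p id)
  set c := T / (2 * √(2 * √(u0 ^ 2 + v0 ^ 2))) with hc
  have hc0 : 0 < c := by positivity
  have hnum : IntegrableOn (numH n cn p 0 1 (Ico 0 1) (planeCurve U V) id) (Ioo 0 1) := by
    refine IntegrableOn.of_bound (by simp) ?_ (cn * v0 ^ (n - 1) * c ^ (1 - p)) ?_
    · refine AEMeasurable.aestronglyMeasurable
        (AEMeasurable.congr ?_ (heq.mono fun t ht => ht.1.symm))
      exact ((((measurable_deriv id).norm.pow_const p).aemeasurable).mul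
        (((hVm.pow_const _).const_mul cn).pow_const p)).mul (hhm.pow_const _)
    · filter_upwards [heq, ae_restrict_mem measurableSet_Ioo,
        ae_restrict_of_ae h.isLip_u.ae_differentiableAt,
        ae_restrict_of_ae h.isLip_v.ae_differentiableAt] with t h1 ht h2 h3
      have hVt := h.v_pos t ⟨ht.1.le, ht.2⟩
      have h4 := h.hSpAlong_ge (n := n) hcn ht (h2 ht) (h3 ht)
      rw [h1.1, deriv_id, abs_one, Real.one_rpow, one_mul]
      set F := cn * V t ^ (n - 1) with hF
      have hF0 : 0 < F := by positivity
      have h5 := (mul_pos hF0 hc0).trans_le h4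
      rw [Real.norm_of_nonneg (by positivity)]
      calc F ^ p * hSpAlong n cn U V t ^ (1 - p) ≤ F ^ p * (F * c) ^ (1 - p) := by
            refine mul_le_mul_of_nonneg_left ?_ (by positivity)
            exact Real.rpow_le_rpow_of_nonpos (by positivity) h4 (by linarith)
        _ = F * c ^ (1 - p) := by
            rw [Real.mul_rpow hF0.le hc0.le, ← mul_assoc, ← Real.rpow_add hF0, add_sub_cancel,
              Real.rpow_one]
        _ ≤ cn * v0 ^ (n - 1) * c ^ (1 - p) := by
            have := h.v_le t
            rw [hF]
            gcongr
  obtain ⟨M, hM0, hM⟩ := hm.h_le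
  have hden : IntegrableOn (denH n cn p (Ico 0 1) (planeCurve U V) id) (Ioo 0 1) := by
    refine IntegrableOn.of_bound (by simp) ?_ M ?_
    · refine AEMeasurable.aestronglyMeasurable
        (AEMeasurable.congr ?_ (heq.mono fun t ht => ht.2.symm))
      exact (measurable_id.norm.pow_const p).aemeasurable.mul hhm
    · filter_upwards [heq, ae_restrict_mem measurableSet_Ioo, ae_restrict_of_ae hM] with t h1 ht h2
      have h3 := hm.hSpAlong_nonneg hcn ⟨ht.1.le, ht.2⟩
      rw [h1.2, Real.norm_of_nonneg (by positivity), id, abs_of_pos ht.1]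
      have h4 : t ^ p ≤ 1 := Real.rpow_le_one ht.1.le ht.2.le (by linarith)
      exact (mul_le_of_le_one_left h3 h4).trans (h2 ht)
  refine ⟨_, id, ⟨1, LipschitzWith.id.lipschitzOnWith⟩, rfl, intervalIntegrable_iff_Ioo.2 hnum,
    intervalIntegrable_iff_Ioo.2 hden, ?_, rfl⟩
  have hpos : ∀ᵐ t ∂volume.restrict (Ioo 0 1),
      0 < denH n cn p (Ico 0 1) (planeCurve U V) id t := by
    filter_upwards [heq, ae_restrict_mem measurableSet_Ioo,
      ae_restrict_of_ae (h.ae_hSpAlong_pos n hcn)] with t h1 ht h2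
    rw [h1.2]
    exact mul_pos (Real.rpow_pos_of_pos (abs_pos.2 ht.1.ne') _) (h2 ht)
  rw [intervalIntegral_eq_Ioo,
    setIntegral_pos_iff_support_of_nonneg_ae (hpos.mono fun t ht => ht.le) hden]
  refine lt_of_lt_of_le (b := volume (Ioo (0 : ℝ) 1)) (by simp) (measure_mono_ae ?_)
  filter_upwards [(ae_restrict_iff' measurableSet_Ioo).1 hpos] with t h1 ht
  exact ⟨(h1 ht).ne', ht⟩

end BalancedCurve

/-! ### Comparison of a profile with the associated curve -/

theorem Profile.exists_reparametrization {n : ℕ} {cn u0 v0 T L : ℝ} {u v U V τ : ℝ → ℝ}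
    (h : Profile n cn u0 v0 u v L) (hb : BalancedCurve u0 v0 T U V) (hcn : 0 < cn)
    (hτc : ContinuousOn τ (Icc 0 1)) (hτm : MonotoneOn τ (Icc 0 1)) (hτ0 : τ 0 = 0) (hτ1 : τ 1 = 1)
    (hτ : ∀ s ∈ Icc (0 : ℝ) 1, U (τ s) = u s ∧ V (τ s) = v s) {a : ℝ} (ha : a ∈ Ioo (0 : ℝ) 1) :
    ∃ (ψ : ℝ → ℝ) (K : NNReal), LipschitzWith K ψ ∧ Monotone ψ ∧ ψ 0 = 0 ∧ ψ 1 = a ∧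
      (∀ s ∈ Icc (0 : ℝ) 1, v s ≤ V (ψ s)) ∧
      ∀ᵐ s, deriv ψ s * hSpAlong n cn U V (ψ s) ≤ L := by
  have h1 : (1 : ℝ) ∈ Icc (0 : ℝ) 1 := ⟨zero_le_one, le_rfl⟩
  obtain ⟨σ, hσ, hσa⟩ : a ∈ τ '' Icc 0 1 := by
    have := intermediate_value_Icc zero_le_one hτc
    rw [hτ0, hτ1] at this
    exact this (Ioo_subset_Icc_self ha)
  set c : ℝ → ℝ := fun s => projIcc 0 σ hσ.1 s with hc
  have hcI : ∀ s, c s ∈ Icc (0 : ℝ) 1 := fun s =>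
    ⟨(projIcc 0 σ hσ.1 s).2.1, (projIcc 0 σ hσ.1 s).2.2.trans hσ.2⟩
  have hcm : Monotone c := fun s t hst => monotone_projIcc hσ.1 hst
  have hcL : ∀ s t, s ≤ t → c t - c s ≤ t - s := fun s t hst => by
    have := (LipschitzWith.projIcc hσ.1).dist_le_mul t s
    rw [NNReal.coe_one, one_mul, Subtype.dist_eq, Real.dist_eq, Real.dist_eq] at this
    rw [← abs_of_nonneg (sub_nonneg.2 hst)]
    exact (le_abs_self _).trans this
  set ψ := fun s => τ (c s) with hψ
  have hψm : Monotone ψ := fun s t hst => hτm (hcI s) (hcI t) (hcm hst)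
  have hψa : ∀ s, ψ s ≤ a := fun s => hσa ▸ hτm (hcI s) hσ (projIcc 0 σ hσ.1 s).2.2
  have hψ0 : ψ 0 = 0 := by simp [hψ, hc, hτ0]
  have hψnn : ∀ s, 0 ≤ ψ s := fun s =>
    hτ0 ▸ hτm ⟨le_rfl, zero_le_one⟩ (hcI s) (hcI s).1
  have hψ1 : ψ 1 = a := by
    simp only [hψ, hc]; rw [projIcc_of_right_le _ hσ.2]; exact hσa
  have hψI : ∀ s, ψ s ∈ Icc (0 : ℝ) 1 := fun s => ⟨hψnn s, (hψa s).trans ha.2.le⟩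
  have hT := hb.speed_pos
  have hVa : 0 < V a := hb.v_pos a ⟨ha.1.le, ha.2⟩
  have hVψ : ∀ s, V a ≤ V (ψ s) := fun s => hb.anti (hψa s)
  have hchord : ∀ s t, s ≤ t → cn * V (ψ t) ^ (n - 1) *
      √((U (ψ t) - U (ψ s)) ^ 2 + (V (ψ t) - V (ψ s)) ^ 2) ≤
      √(2 * √(U (ψ s) ^ 2 + V (ψ s) ^ 2)) * (L * (t - s)) := fun s t hst => by
    have h2 := h.chord _ (hcI s) _ (hcI t) (hcm hst)
    simp only [hψ, (hτ _ (hcI _)).1, (hτ _ (hcI _)).2]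
    refine h2.trans ?_
    have := h.length_nonneg
    have := hcL s t hst
    gcongr
  set R := √(2 * √(u0 ^ 2 + v0 ^ 2)) with hR
  set C := 2 * R * L / (cn * V a ^ (n - 1) * T) with hC
  have hC0 : 0 ≤ C := by have := h.length_nonneg; positivity
  have hψL : LipschitzWith ⟨C, hC0⟩ ψ := by
    refine LipschitzWith.of_le_add_mul _ fun t s => ?_
    rcases le_total t s with hts | hst
    · have := hψm hts
      have : 0 ≤ C * dist t s := by positivity
      change ψ t ≤ ψ s + C * dist t s
      linarith
    · have h2 := hchord s t hst
      have h3 := hb.increment _ (hψI s) _ (hψI t)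
      have h4 := abs_le_sqrt_sq_add_sq (U (ψ t) - U (ψ s)) (V (ψ t) - V (ψ s))
      have h5 := abs_le_sqrt_sq_add_sq (V (ψ t) - V (ψ s)) (U (ψ t) - U (ψ s))
      rw [add_comm ((V (ψ t) - V (ψ s)) ^ 2)] at h5
      set S := √((U (ψ t) - U (ψ s)) ^ 2 + (V (ψ t) - V (ψ s)) ^ 2) with hS
      have h6 : T * (ψ t - ψ s) ≤ 2 * S := by
        linarith [le_abs_self (U (ψ t) - U (ψ s)), neg_abs_le (V (ψ t) - V (ψ s))]
      have h7 : √(2 * √(U (ψ s) ^ 2 + V (ψ s) ^ 2)) ≤ R := by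
        have := hb.sq_anti (hψnn s)
        simp only [hb.u_zero, hb.v_zero] at this
        rw [hR]
        gcongr
      have h8 : cn * V a ^ (n - 1) * S ≤ R * (L * (t - s)) := by
        have e1 : cn * V a ^ (n - 1) * S ≤ cn * V (ψ t) ^ (n - 1) * S := by
          have := hVψ t
          gcongr
        refine (e1.trans h2).trans (mul_le_mul_of_nonneg_right h7 ?_)
        exact mul_nonneg h.length_nonneg (sub_nonneg.2 hst)
      have h9 : ψ t - ψ s ≤ C * (t - s) := by
        rw [hC, div_mul_eq_mul_div, le_div_iff₀ (by positivity)]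
        have : cn * V a ^ (n - 1) * (T * (ψ t - ψ s)) ≤ cn * V a ^ (n - 1) * (2 * S) := by gcongr
        linarith
      rw [Real.dist_eq, abs_of_nonneg (sub_nonneg.2 hst)]
      change ψ t ≤ ψ s + C * (t - s)
      linarith
  refine ⟨ψ, _, hψL, hψm, hψ0, hψ1, fun s hs => ?_, ?_⟩
  · simp only [hψ, (hτ _ (hcI s)).2]
    refine h.anti _ (hcI s) _ hs ?_
    rcases le_total s σ with h2 | h2
    · simp only [hc]; rw [projIcc_of_mem _ ⟨hs.1, h2⟩]
    · simp only [hc]; rw [projIcc_of_right_le _ h2]; exact h2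
  have hP : ∀ᵐ x, x ≠ 0 ∧ (x ∈ Ioo (0 : ℝ) 1 → DifferentiableAt ℝ U x) ∧
      (x ∈ Ioo (0 : ℝ) 1 → DifferentiableAt ℝ V x) := by
    filter_upwards [compl_mem_ae_iff.2 (measure_singleton (0 : ℝ)), hb.isLip_u.ae_differentiableAt,
      hb.isLip_v.ae_differentiableAt] with x h0 h2 h3 using ⟨h0, h2, h3⟩
  filter_upwards [ae_deriv_eq_zero_of_mem_null hψL hψm hP, hψL.ae_differentiableAt_real]
    with s hs hd
  rcases hs with ⟨hs0, hsU, hsV⟩ | hs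
  swap
  · rw [hs, zero_mul]; exact h.length_nonneg
  have hsI : ψ s ∈ Ioo (0 : ℝ) 1 :=
    ⟨lt_of_le_of_ne (hψnn s) (Ne.symm hs0), (hψa s).trans_lt ha.2⟩
  have hUs := (hsU hsI).hasDerivAt.comp s hd.hasDerivAt
  have hVs := (hsV hsI).hasDerivAt.comp s hd.hasDerivAt
  have hlim : Tendsto (fun t => cn * V (ψ t) ^ (n - 1) *
      √(slope (U ∘ ψ) s t ^ 2 + slope (V ∘ ψ) s t ^ 2)) (𝓝[>] s)
      (𝓝 (cn * V (ψ s) ^ (n - 1) *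
        √((deriv U (ψ s) * deriv ψ s) ^ 2 + (deriv V (ψ s) * deriv ψ s) ^ 2))) := by
    have hsub : Ioi s ⊆ {s}ᶜ := fun x hx => (ne_of_gt hx : x ≠ s)
    have e1 := (hasDerivAt_iff_tendsto_slope.1 hUs).mono_left (nhdsWithin_mono _ hsub)
    have e2 := (hasDerivAt_iff_tendsto_slope.1 hVs).mono_left (nhdsWithin_mono _ hsub)
    have e3 : Tendsto (fun t => V (ψ t)) (𝓝[>] s) (𝓝 (V (ψ s))) :=
      hVs.continuousAt.tendsto.mono_left nhdsWithin_le_nhds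
    exact ((e3.pow _).const_mul cn).mul ((e1.pow 2).add (e2.pow 2)).sqrt
  have hle : cn * V (ψ s) ^ (n - 1) *
      √((deriv U (ψ s) * deriv ψ s) ^ 2 + (deriv V (ψ s) * deriv ψ s) ^ 2) ≤
      √(2 * √(U (ψ s) ^ 2 + V (ψ s) ^ 2)) * L := by
    refine le_of_tendsto hlim ?_
    filter_upwards [self_mem_nhdsWithin] with t ht
    have ht0 : 0 < t - s := sub_pos.2 ht
    have e : slope (U ∘ ψ) s t ^ 2 + slope (V ∘ ψ) s t ^ 2 =
        ((U (ψ t) - U (ψ s)) ^ 2 + (V (ψ t) - V (ψ s)) ^ 2) / (t - s) ^ 2 := by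
      simp only [slope_def_field, Function.comp]
      field_simp
    rw [e, Real.sqrt_div (by positivity), Real.sqrt_sq ht0.le, ← mul_div_assoc, div_le_iff₀ ht0,
      mul_assoc _ L]
    exact hchord s t (le_of_lt ht)
  have hVs0 := hb.v_pos (ψ s) ⟨hsI.1.le, hsI.2⟩
  have hpos : 0 < √(2 * √(U (ψ s) ^ 2 + V (ψ s) ^ 2)) := by positivity
  have e : (deriv U (ψ s) * deriv ψ s) ^ 2 + (deriv V (ψ s) * deriv ψ s) ^ 2 =
      deriv ψ s ^ 2 * (deriv U (ψ s) ^ 2 + deriv V (ψ s) ^ 2) := by ring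
  rw [e, Real.sqrt_mul (sq_nonneg _), Real.sqrt_sq hψm.deriv_nonneg] at hle
  rw [hSpAlong, hSp, ← mul_div_assoc, div_le_iff₀ hpos]
  linarith

theorem rpow_mul_le_of_mul_le {p x A F₁ F₂ H L : ℝ} (hp : 1 < p) (hx : 0 ≤ x) (hA : 0 ≤ A)
    (hF₁ : 0 ≤ F₁) (hF : F₁ ≤ F₂) (hH : 0 < H) (hxH : x * H ≤ L) :
    (A * x) ^ p * F₁ ^ p ≤ L ^ (p - 1) * (x * (A ^ p * F₂ ^ p * H ^ (1 - p))) := by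
  have hL : 0 ≤ L := (mul_nonneg hx hH.le).trans hxH
  rcases hx.eq_or_lt with rfl | hx
  · simp [Real.zero_rpow (by linarith : p ≠ 0)]
  have h1 : x ^ (p - 1) ≤ L ^ (p - 1) * H ^ (1 - p) := by
    rw [← neg_sub p 1, Real.rpow_neg hH.le, ← div_eq_mul_inv, le_div_iff₀ (by positivity),
      ← Real.mul_rpow hx.le hH.le]
    exact Real.rpow_le_rpow (by positivity) hxH (by linarith)
  have h2 : x ^ p = x * x ^ (p - 1) := by rw [Real.rpow_sub_one hx.ne']; field_simp
  have h3 : F₁ ^ p ≤ F₂ ^ p := Real.rpow_le_rpow hF₁ hF (by linarith)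
  rw [Real.mul_rpow hA hx.le, h2]
  calc A ^ p * (x * x ^ (p - 1)) * F₁ ^ p
      ≤ A ^ p * (x * (L ^ (p - 1) * H ^ (1 - p))) * F₂ ^ p := by gcongr
    _ = _ := by ring

theorem Profile.mul_integral_le {n : ℕ} {cn p u0 v0 T L : ℝ} {u v U V τ : ℝ → ℝ}
    (h : Profile n cn u0 v0 u v L) (hb : BalancedCurve u0 v0 T U V) (hcn : 0 < cn)
    (hp : 1 < p) (hv0 : 0 < v0)
    (hτc : ContinuousOn τ (Icc 0 1)) (hτm : MonotoneOn τ (Icc 0 1)) (hτ0 : τ 0 = 0) (hτ1 : τ 1 = 1)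
    (hτ : ∀ s ∈ Icc (0 : ℝ) 1, U (τ s) = u s ∧ V (τ s) = v s) {a : ℝ} (ha : a ∈ Ioo (0 : ℝ) 1)
    {b : ℝ} (hb0 : 0 ≤ b)
    (hbound : ∀ ω, IsTest p ω → b ≤ profNum n cn p v ω / (L ^ p * profDen p ω))
    {w : ℝ → ℝ} {K : NNReal} (hw : LipschitzOnWith K w (Icc 0 1)) (hw0 : w 0 = 0)
    (hnum : IntegrableOn (numH n cn p 0 1 (Ico 0 1) (planeCurve U V) w) (Ioo 0 1))
    (hden : IntegrableOn (denH n cn p (Ico 0 1) (planeCurve U V) w) (Ioo 0 1)) :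
    b * ∫ t in Ioo 0 a, denH n cn p (Ico 0 1) (planeCurve U V) w t ≤
      ∫ t in Ioo 0 1, numH n cn p 0 1 (Ico 0 1) (planeCurve U V) w t := by
  have hp0 : 0 ≤ p := by linarith
  obtain ⟨ψ, Kψ, hψL, hψm, hψ0, hψ1, hψv, hψh⟩ :=
    h.exists_reparametrization hb hcn hτc hτm hτ0 hτ1 hτ ha
  have hL := h.length_pos hcn hv0
  set N := numH n cn p 0 1 (Ico 0 1) (planeCurve U V) w with hN
  set D := denH n cn p (Ico 0 1) (planeCurve U V) w with hD
  set H := hSpAlong n cn U V with hH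
  set W : ℝ → ℝ := fun t => w (projIcc 0 1 zero_le_one t) with hW
  have hWL : LipschitzWith K W := by
    refine LipschitzWith.of_dist_le_mul fun s t => ?_
    refine (hw.dist_le_mul _ (projIcc 0 1 zero_le_one s).2 _ (projIcc 0 1 zero_le_one t).2).trans ?_
    have := (LipschitzWith.projIcc (zero_le_one (α := ℝ))).dist_le_mul s t
    rw [NNReal.coe_one, one_mul, Subtype.dist_eq] at this
    gcongr
  have hWeq : ∀ t ∈ Icc (0 : ℝ) 1, W t = w t := fun t ht => by
    simp only [hW]; rw [projIcc_of_mem _ ht]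
  have hWd : ∀ t ∈ Ioo (0 : ℝ) 1, deriv W t = deriv w t := fun t ht =>
    EventuallyEq.deriv_eq (by
      filter_upwards [Icc_mem_nhds ht.1 ht.2] with s hs using hWeq s hs)
  set ω := fun s => W (ψ s) with hω
  have hωL : LipschitzWith (K * Kψ) ω := hWL.comp hψL
  have hF0 : ∀ t, 0 ≤ Fvol n cn (planeCurve U V t) := fun t => by
    unfold Fvol planeCurve; positivity
  have hh0 : ∀ t, 0 ≤ hSpeedOn n cn (Ico 0 1) (planeCurve U V) t := fun t =>
    mul_nonneg (hF0 t) (Real.sqrt_nonneg _)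
  have hN0 : ∀ t, 0 ≤ N t := fun t => by
    have := hF0 t
    have := hh0 t
    rw [hN]; unfold numH; positivity
  have hD0 : ∀ t, 0 ≤ D t := fun t => mul_nonneg (by positivity) (hh0 t)
  have hψI : ∀ s ∈ Icc (0 : ℝ) 1, ψ s ∈ Icc 0 a := fun s hs =>
    ⟨hψ0 ▸ hψm hs.1, hψ1 ▸ hψm hs.2⟩
  have hP : ∀ᵐ x, x ≠ 0 ∧ (x ∈ Ioo (0 : ℝ) 1 → (N x = |deriv w x| ^ p *
      (cn * V x ^ (n - 1)) ^ p * H x ^ (1 - p) ∧ D x = |w x| ^ p * H x) ∧ 0 < H x) := by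
    filter_upwards [compl_mem_ae_iff.2 (measure_singleton (0 : ℝ)), hb.ae_num_den_eq n cn p w,
      hb.ae_hSpAlong_pos n hcn] with x h0 h1 h2 using ⟨h0, fun hx => ⟨h1 hx, h2 hx⟩⟩
  have hpt : ∀ᵐ s, s ∈ Ioo (0 : ℝ) 1 →
      |deriv ω s| ^ p * (cn * v s ^ (n - 1)) ^ p ≤ L ^ (p - 1) * (deriv ψ s * N (ψ s)) ∧
      deriv ψ s * D (ψ s) ≤ L * |ω s| ^ p := by
    filter_upwards [ae_deriv_eq_zero_of_mem_null hψL hψm hP, ae_deriv_comp hψL hψm hWL, hψh]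
      with s h1 h2 h3 hs
    have hsI := hψI s (Ioo_subset_Icc_self hs)
    have h4 : deriv ω s = deriv W (ψ s) * deriv ψ s := h2
    rcases h1 with ⟨h0, h1⟩ | h1
    · have hsO : ψ s ∈ Ioo (0 : ℝ) 1 :=
        ⟨lt_of_le_of_ne hsI.1 (Ne.symm h0), hsI.2.trans_lt ha.2⟩
      obtain ⟨⟨hNe, hDe⟩, hHpos⟩ := h1 hsO
      have hx : 0 ≤ deriv ψ s := hψm.deriv_nonneg
      have hvs := (h.v_mem (Ioo_subset_Icc_self hs)).1
      have hvV := hψv s (Ioo_subset_Icc_self hs)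
      constructor
      · rw [hNe, h4, abs_mul, abs_of_nonneg hx, hWd _ hsO]
        refine rpow_mul_le_of_mul_le hp hx (abs_nonneg _) (by positivity) ?_ hHpos h3
        gcongr
      · have h5 : ω s = w (ψ s) := hWeq _ (Ioo_subset_Icc_self hsO)
        rw [hDe, h5]
        calc deriv ψ s * (|w (ψ s)| ^ p * H (ψ s)) = deriv ψ s * H (ψ s) * |w (ψ s)| ^ p := by ring
          _ ≤ _ := by gcongr
    · rw [h4, h1, mul_zero, abs_zero, Real.zero_rpow (by linarith), zero_mul, zero_mul, mul_zero,
        zero_mul]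
      exact ⟨le_rfl, by positivity⟩
  have hpt' := (ae_restrict_iff' (μ := volume) measurableSet_Ioo).2 hpt
  have hsub : Ioo 0 a ⊆ Ioo (0 : ℝ) 1 := Ioo_subset_Ioo_right ha.2.le
  have hchange : ∀ G : ℝ → ℝ, ∫⁻ s in Ioo 0 1, ENNReal.ofReal (deriv ψ s * G (ψ s)) =
      ∫⁻ t in Ioo 0 a, ENNReal.ofReal (G t) := fun G => by
    rw [lintegral_comp_mul_deriv_of_monotone hψL hψm zero_le_one, hψ0, hψ1]
  have hnum_le : profNum n cn p v ω ≤ L ^ (p - 1) * ∫ t in Ioo 0 1, N t := by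
    have hI0 : 0 ≤ ∫ t in Ioo 0 1, N t := setIntegral_nonneg measurableSet_Ioo fun t _ => hN0 t
    rw [← ENNReal.ofReal_le_ofReal_iff (by positivity), profNum,
      ofReal_integral_eq_lintegral_ofReal (h.integrable_num hcn hp0 hωL)
        ((ae_restrict_iff' measurableSet_Ioo).2 (Eventually.of_forall fun s hs =>
          h.num_nonneg hcn hs)),
      ENNReal.ofReal_mul (by positivity), ofReal_integral_eq_lintegral_ofReal hnum
        (Eventually.of_forall hN0)]
    calc _ ≤ ∫⁻ s in Ioo 0 1, ENNReal.ofReal (L ^ (p - 1)) *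
          ENNReal.ofReal (deriv ψ s * N (ψ s)) := by
          refine lintegral_mono_ae ?_
          filter_upwards [hpt'] with s hs
          rw [← ENNReal.ofReal_mul (by positivity)]
          exact ENNReal.ofReal_le_ofReal hs.1
      _ = ENNReal.ofReal (L ^ (p - 1)) * ∫⁻ t in Ioo 0 a, ENNReal.ofReal (N t) := by
          rw [lintegral_const_mul' _ _ ENNReal.ofReal_ne_top, hchange]
      _ ≤ _ := by gcongr
  have hden_le : ∫ t in Ioo 0 a, D t ≤ L * profDen p ω := by
    have hI0 : 0 ≤ profDen p ω := integral_nonneg fun s => by positivity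
    rw [← ENNReal.ofReal_le_ofReal_iff (by positivity),
      ofReal_integral_eq_lintegral_ofReal (hden.mono_set hsub) (Eventually.of_forall hD0),
      ENNReal.ofReal_mul hL.le, profDen,
      ofReal_integral_eq_lintegral_ofReal (integrable_den hp0 hωL.continuous)
        (Eventually.of_forall fun s => by positivity), ← hchange,
      ← lintegral_const_mul' _ _ ENNReal.ofReal_ne_top]
    refine lintegral_mono_ae ?_
    filter_upwards [hpt'] with s hs
    rw [← ENNReal.ofReal_mul hL.le]
    exact ENNReal.ofReal_le_ofReal hs.2
  rcases le_or_gt (∫ t in Ioo 0 a, D t) 0 with h0 | h0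
  · exact (mul_nonpos_of_nonneg_of_nonpos hb0 h0).trans
      (setIntegral_nonneg measurableSet_Ioo fun t _ => hN0 t)
  have hdpos : 0 < profDen p ω := pos_of_mul_pos_right (h0.trans_le hden_le) hL.le
  have hω0 : ω 0 = 0 := by
    simp only [hω, hψ0]; rw [hWeq 0 ⟨le_rfl, zero_le_one⟩, hw0]
  have hq := hbound ω ⟨⟨_, hωL⟩, hω0, hdpos⟩
  rw [le_div_iff₀ (by positivity)] at hq
  have hLp : L ^ p = L ^ (p - 1) * L := by rw [Real.rpow_sub_one hL.ne']; field_simp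
  have hLpos : 0 < L ^ (p - 1) := by positivity
  refine le_of_mul_le_mul_left ?_ hLpos
  calc L ^ (p - 1) * (b * ∫ t in Ioo 0 a, D t) ≤ L ^ (p - 1) * (b * (L * profDen p ω)) := by gcongr
    _ = b * (L ^ p * profDen p ω) := by rw [hLp]; ring
    _ ≤ _ := hq.trans hnum_le

theorem Profile.le_of_mem_rayleighSet {n : ℕ} {cn p u0 v0 T L : ℝ} {u v U V τ : ℝ → ℝ}
    (h : Profile n cn u0 v0 u v L) (hb : BalancedCurve u0 v0 T U V) (hcn : 0 < cn)
    (hp : 1 < p) (hv0 : 0 < v0)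
    (hτc : ContinuousOn τ (Icc 0 1)) (hτm : MonotoneOn τ (Icc 0 1)) (hτ0 : τ 0 = 0) (hτ1 : τ 1 = 1)
    (hτ : ∀ s ∈ Icc (0 : ℝ) 1, U (τ s) = u s ∧ V (τ s) = v s) {b : ℝ} (hb0 : 0 ≤ b)
    (hbound : ∀ ω, IsTest p ω → b ≤ profNum n cn p v ω / (L ^ p * profDen p ω)) {q : ℝ}
    (hq : q ∈ rayleighSet n cn p (planeCurve U V)) : b ≤ q := by
  obtain ⟨w, ⟨K, hw⟩, hw0, hnum, hden, hpos, rfl⟩ := hq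
  rw [le_div_iff₀ hpos]
  set D := denH n cn p (Ico 0 1) (planeCurve U V) w with hD
  have hlim : Tendsto (fun a => b * ∫ t in (0 : ℝ)..a, D t) (𝓝[<] 1)
      (𝓝 (b * ∫ t in (0 : ℝ)..1, D t)) := by
    have hc := intervalIntegral.continuousOn_primitive_interval'
      (μ := volume) hden (left_mem_uIcc)
    rw [uIcc_of_le zero_le_one] at hc
    have := (hc 1 ⟨zero_le_one, le_rfl⟩).mono_left (nhdsWithin_mono _ Ioo_subset_Icc_self)
    rw [nhdsWithin_Ioo_eq_nhdsLT one_pos] at this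
    exact this.const_mul b
  refine le_of_tendsto hlim ?_
  filter_upwards [Ioo_mem_nhdsLT (zero_lt_one (α := ℝ))] with a ha
  rw [intervalIntegral.integral_of_le ha.1.le, integral_Ioc_eq_integral_Ioo,
    intervalIntegral_eq_Ioo]
  exact h.mul_integral_le hb hcn hp hv0 hτc hτm hτ0 hτ1 hτ ha hb0 hbound hw hw0
    (intervalIntegrable_iff_Ioo.1 hnum) (intervalIntegrable_iff_Ioo.1 hden)

/-- For `p ≥ 2n-1` there is a curve `α ∈ R_h^+` attaining
`Λ_p = sup{λ_{1,p}(γ) : γ ∈ R_h}` such that `u ∘ α` is monotonically increasing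
and `r ∘ α` is monotonically decreasing on `[0,1]`. -/
theorem simons_stmt9 (n : ℕ) (hn : 2 ≤ n) (cn : ℝ) (hcn : 0 < cn)
    (x0 y0 : ℝ) (hy0 : 0 < y0) (hxy : y0 ≤ x0)
    (p : ℝ) (hp : 2 * (n : ℝ) - 1 ≤ p) :
    ∃ α : ℝ → ℝ × ℝ, MemRhPlus n cn x0 y0 α ∧
      (∀ γ : ℝ → ℝ × ℝ, MemRh n cn x0 y0 γ → lambdaH n cn p γ ≤ lambdaH n cn p α) ∧
      MonotoneOn (fun t => ucoord (α t)) (Icc 0 1) ∧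
      AntitoneOn (fun t => rcoord (α t)) (Icc 0 1) := by
  have hn' : (2 : ℝ) ≤ n := by exact_mod_cast hn
  have hp1 : 1 < p := by linarith
  have hx0 : 0 < x0 := hy0.trans_le hxy
  have hu0 : 0 ≤ ucoord (x0, y0) := by simp only [ucoord]; nlinarith
  have hv0 : 0 < vcoord (x0, y0) := mul_pos hx0 hy0
  obtain ⟨u, v, L, h, hmax⟩ := exists_maximal_profile hn hcn hy0 hxy hp
  obtain ⟨T, U, V, τ, hb, hτc, hτm, hτ0, hτ1, hτ⟩ := h.exists_balancedCurve hn hcn hu0 hv0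
  refine ⟨planeCurve U V, hb.memRhPlus hn hcn hx0 hy0, fun γ hγ => ?_, fun s _ t _ hst => ?_,
    fun s _ t _ hst => ?_⟩
  · exact le_csInf (hb.rayleighSet_nonempty hn hcn hp1) fun q hq =>
      h.le_of_mem_rayleighSet hb hcn hp1 hv0 hτc hτm hτ0 hτ1 hτ (lambdaH_nonneg hcn hγ)
        (hmax γ hγ) hq
  · simp only [ucoord_planeCurve]
    exact hb.mono hst
  · simp only [rcoord, ucoord_planeCurve, vcoord_planeCurve (hb.v_nonneg _)]
    exact Real.sqrt_le_sqrt (hb.sq_anti hst)
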